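/- For every fixed integer k ≥ 3, set a = ⌊(2k−1+√(8k−7))/2⌋. For every ε > 0 there exists N such that for all n ≥ N there is an edge-coloring of K_{n,n} using at most (1/(2(k-1)) + 1/(2a) + ε)·n colors in which every cycle on 2k vertices receives at least 3 distinct colors; that is, f(K_{n,n}, C_{2k}, 3) ≤ (1/(2(k-1)) + 1/(2a))·n + o(n). -/

import Mathlib

open Finset

/-- The number of colors used by an edge-coloring `c` of `K_{n,n}`. -/
def usedColorsBip (n : ℕ) (c : Fin n → Fin n → ℕ) : ℕ :=
  ((Finset.univ : Finset (Fin n × Fin n)).image fun p => c p.1 p.2).card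

/-- `v` lists `k` distinct vertices: it is injective on `{0, …, k-1}`. -/
def InjOnFirst (n k : ℕ) (v : ℕ → Fin n) : Prop :=
  ∀ i j, i < k → j < k → v i = v j → i = j

/-- The number of distinct colors on the cycle `C_{2k}` in `K_{n,n}` with left vertices
`a 0, …, a (k-1)` and right vertices `b 0, …, b (k-1)`, whose edges are
`a i — b i` and `a (i+1) — b i` (indices mod `k`). -/
def bipCycleColorCount (n k : ℕ) (c : Fin n → Fin n → ℕ) (a b : ℕ → Fin n) : ℕ :=
  (((Finset.range k).image fun i => c (a i) (b i)) ∪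
    ((Finset.range k).image fun i => c (a ((i + 1) % k)) (b i))).card

namespace RamseyCycle

set_option linter.unusedSectionVars false

section ProductMeasure

variable {X Λ Γ : Type*} [Fintype X] [DecidableEq X] [Fintype Λ] [DecidableEq Λ]
  [Fintype Γ] [DecidableEq Γ]

/-- The expectation of `f` when the coordinates `ξ x` are independent and `ξ x` has law `μ x`. -/
def ev (μ : X → Λ → ℝ) (f : (X → Λ) → ℝ) : ℝ := ∑ ξ : X → Λ, (∏ x, μ x (ξ x)) * f ξ

/-- Every `μ x` is a probability vector. -/
structure IsProb (μ : X → Λ → ℝ) : Prop where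
  nonneg : ∀ x l, 0 ≤ μ x l
  sum_one : ∀ x, ∑ l, μ x l = 1

lemma ev_mono {μ : X → Λ → ℝ} (hμ : IsProb μ) {f g : (X → Λ) → ℝ} (h : ∀ ξ, f ξ ≤ g ξ) :
    ev μ f ≤ ev μ g :=
  sum_le_sum fun ξ _ => mul_le_mul_of_nonneg_left (h ξ) (prod_nonneg fun x _ => hμ.nonneg x _)

lemma ev_add (μ : X → Λ → ℝ) (f g : (X → Λ) → ℝ) :
    ev μ (fun ξ => f ξ + g ξ) = ev μ f + ev μ g := by
  simp [ev, mul_add, sum_add_distrib]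

lemma ev_sub (μ : X → Λ → ℝ) (f g : (X → Λ) → ℝ) :
    ev μ (fun ξ => f ξ - g ξ) = ev μ f - ev μ g := by
  simp [ev, mul_sub, sum_sub_distrib]

lemma ev_const_mul (μ : X → Λ → ℝ) (c : ℝ) (f : (X → Λ) → ℝ) :
    ev μ (fun ξ => c * f ξ) = c * ev μ f := by
  simp only [ev, mul_sum]
  exact sum_congr rfl fun ξ _ => by ring

lemma ev_sum {ι : Type*} (μ : X → Λ → ℝ) (s : Finset ι) (f : ι → (X → Λ) → ℝ) :
    ev μ (fun ξ => ∑ i ∈ s, f i ξ) = ∑ i ∈ s, ev μ (f i) := by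
  simp only [ev, mul_sum]
  exact sum_comm

lemma ev_prod (μ : X → Λ → ℝ) (φ : X → Λ → ℝ) :
    ev μ (fun ξ => ∏ x, φ x (ξ x)) = ∏ x, ∑ l, μ x l * φ x l := by
  rw [prod_univ_sum, Fintype.piFinset_univ]
  simp [ev, prod_mul_distrib]

lemma ev_const {μ : X → Λ → ℝ} (hμ : IsProb μ) (c : ℝ) : ev μ (fun _ => c) = c := by
  have h := ev_prod μ (fun _ _ => (1 : ℝ))
  have h2 := ev_const_mul μ c (fun _ => (1 : ℝ))
  simp only [mul_one, prod_const_one, hμ.sum_one] at h h2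
  rw [h2, h, mul_one]

lemma ev_nonneg {μ : X → Λ → ℝ} (hμ : IsProb μ) {f : (X → Λ) → ℝ} (h : ∀ ξ, 0 ≤ f ξ) :
    0 ≤ ev μ f := by
  simpa [ev_const hμ] using ev_mono hμ (f := fun _ => 0) h

/-- The law of `τ x (ξ x)`. -/
def mapLaw (τ : X → Λ → Γ) (μ : X → Λ → ℝ) : X → Γ → ℝ :=
  fun x l' => ∑ l with τ x l = l', μ x l

lemma ev_map (τ : X → Λ → Γ) (μ : X → Λ → ℝ) (f : (X → Γ) → ℝ) :
    ev μ (fun ξ => f (fun x => τ x (ξ x))) = ev (mapLaw τ μ) f := by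
  simp only [ev, mapLaw]
  rw [← sum_fiberwise (s := (univ : Finset (X → Λ))) (g := fun ξ x => τ x (ξ x))]
  refine sum_congr rfl fun ζ _ => ?_
  rw [prod_univ_sum, sum_mul]
  refine sum_congr ?_ fun ξ hξ => ?_
  · ext ξ
    simp [Fintype.mem_piFinset, funext_iff]
  · rw [Fintype.mem_piFinset] at hξ
    have : (fun x => τ x (ξ x)) = ζ := funext fun x => by simpa using hξ x
    rw [this]

/-- The law of two independent copies. -/
def pairLaw (μ : X → Λ → ℝ) : X → Λ × Λ → ℝ := fun x l => μ x l.1 * μ x l.2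

lemma IsProb.pair {μ : X → Λ → ℝ} (hμ : IsProb μ) : IsProb (pairLaw μ) where
  nonneg x l := mul_nonneg (hμ.nonneg _ _) (hμ.nonneg _ _)
  sum_one x := by
    simp only [pairLaw, Fintype.sum_prod_type, ← mul_sum, hμ.sum_one, mul_one]

lemma ev_pair_mul (μ : X → Λ → ℝ) (f g : (X → Λ) → ℝ) :
    ev (pairLaw μ) (fun η => f (fun x => (η x).1) * g (fun x => (η x).2)) = ev μ f * ev μ g := by
  simp only [ev, pairLaw]
  rw [sum_mul_sum, ← Fintype.sum_prod_type']
  refine Fintype.sum_equiv (Equiv.arrowProdEquivProdArrow X (fun _ => Λ) (fun _ => Λ)) _ _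
    fun η => ?_
  simp only [Equiv.arrowProdEquivProdArrow, Equiv.coe_fn_mk, prod_mul_distrib]
  ring

variable [Zero Λ]

/-- The coordinates with a nonzero label in one of the two copies. -/
def pairSupp (η : X → Λ × Λ) : Finset X := univ.filter fun x => (η x).1 ≠ 0 ∨ (η x).2 ≠ 0

lemma ev_decouple {μ : X → Λ → ℝ} (hμ : IsProb μ) {f g : (X → Λ) → ℝ}
    (hf0 : ∀ ξ, 0 ≤ f ξ) (hf1 : ∀ ξ, f ξ ≤ 1) (hg0 : ∀ ξ, 0 ≤ g ξ) (hg1 : ∀ ξ, g ξ ≤ 1)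
    (Kf Kg : Finset X → Finset X)
    (hf : ∀ A ξ ζ, (∀ x, ξ x ≠ 0 → x ∈ A) → (∀ x, ζ x ≠ 0 → x ∈ A) →
      (∀ x ∈ Kf A, ξ x = ζ x) → f ξ = f ζ)
    (hg : ∀ A ξ ζ, (∀ x, ξ x ≠ 0 → x ∈ A) → (∀ x, ζ x ≠ 0 → x ∈ A) →
      (∀ x ∈ Kg A, ξ x = ζ x) → g ξ = g ζ) :
    ev μ f * ev μ g - ev (pairLaw μ) (fun η =>
        if Disjoint (Kf (pairSupp η)) (Kg (pairSupp η)) then 0 else 1) ≤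
      ev μ (fun ξ => f ξ * g ξ) := by
  classical
  set Θ : (X → Λ × Λ) → (X → Λ × Λ) := fun η x =>
    if x ∈ Kf (pairSupp η) then η x else (η x).swap with hΘ
  have hsupp : ∀ η, pairSupp (Θ η) = pairSupp η := by
    intro η
    ext x
    simp only [pairSupp, mem_filter, mem_univ, true_and, hΘ]
    by_cases h : x ∈ Kf (univ.filter fun x => (η x).1 ≠ 0 ∨ (η x).2 ≠ 0) <;>
      simp [h, or_comm]
  have hinv : Function.Involutive Θ := by
    intro η
    funext x
    have h := hsupp η
    simp only [hΘ] at h ⊢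
    rw [h]
    by_cases hx : x ∈ Kf (pairSupp η) <;> simp [hx]
  have hmarg : ev μ (fun ξ => f ξ * g ξ) =
      ev (pairLaw μ) (fun η => f (fun x => (η x).1) * g (fun x => (η x).1)) := by
    have := ev_pair_mul μ (fun ξ => f ξ * g ξ) (fun _ => 1)
    simp only [mul_one, ev_const hμ] at this
    exact this.symm
  have hswap : ev (pairLaw μ) (fun η => f (fun x => (η x).1) * g (fun x => (η x).1)) =
      ev (pairLaw μ) (fun η => f (fun x => (Θ η x).1) * g (fun x => (Θ η x).1)) := by
    simp only [ev]
    refine (Fintype.sum_equiv hinv.toPerm _ _ fun η => ?_).symm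
    simp only [Function.Involutive.coe_toPerm]
    congr 1
    refine prod_congr rfl fun x _ => ?_
    simp only [pairLaw, hΘ]
    split_ifs <;> simp [mul_comm]
  rw [hmarg, hswap, ← ev_pair_mul, ← ev_sub]
  refine ev_mono hμ.pair fun η => ?_
  by_cases hd : Disjoint (Kf (pairSupp η)) (Kg (pairSupp η))
  · simp only [hd, if_true, sub_zero]
    have e1 : f (fun x => (Θ η x).1) = f (fun x => (η x).1) := by
      refine hf (pairSupp η) _ _ ?_ ?_ ?_
      · intro x hx
        rw [← hsupp η]
        simp only [pairSupp, mem_filter, mem_univ, true_and]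
        exact Or.inl hx
      · intro x hx
        simp only [pairSupp, mem_filter, mem_univ, true_and]
        exact Or.inl hx
      · intro x hx
        simp [hΘ, hx]
    have e2 : g (fun x => (Θ η x).1) = g (fun x => (η x).2) := by
      refine hg (pairSupp η) _ _ ?_ ?_ ?_
      · intro x hx
        rw [← hsupp η]
        simp only [pairSupp, mem_filter, mem_univ, true_and]
        exact Or.inl hx
      · intro x hx
        simp only [pairSupp, mem_filter, mem_univ, true_and]
        exact Or.inr hx
      · intro x hx
        have : x ∉ Kf (pairSupp η) := fun h => (disjoint_left.1 hd) h hx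
        simp [hΘ, this]
    rw [e1, e2]
  · simp only [hd, if_false]
    have h1 := mul_le_one₀ (hf1 fun x => (η x).1) (hg0 fun x => (η x).2) (hg1 _)
    have h2 := mul_nonneg (hf0 fun x => (Θ η x).1) (hg0 fun x => (Θ η x).1)
    linarith

lemma ev_subset_pairSupp_le {μ : X → Λ → ℝ} (hμ : IsProb μ) {π : ℝ}
    (hπ : ∀ x, 1 - μ x 0 ≤ π) (U : Finset X) :
    ev (pairLaw μ) (fun η => if U ⊆ pairSupp η then 1 else 0) ≤ (2 * π) ^ U.card := by
  classical
  have h1 : (fun η : X → Λ × Λ => if U ⊆ pairSupp η then (1 : ℝ) else 0) =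
      fun η => ∏ x, (if x ∈ U then (if (η x).1 ≠ 0 ∨ (η x).2 ≠ 0 then (1 : ℝ) else 0) else 1) := by
    funext η
    rw [prod_ite_mem, univ_inter]
    by_cases h : U ⊆ pairSupp η
    · rw [if_pos h]
      refine (prod_eq_one fun x hx => ?_).symm
      have := h hx
      simp only [pairSupp, mem_filter, mem_univ, true_and] at this
      simp [this]
    · rw [if_neg h]
      obtain ⟨x, hx, hx'⟩ := not_subset.1 h
      refine (prod_eq_zero hx ?_).symm
      simp only [pairSupp, mem_filter, mem_univ, true_and] at hx'
      simp [hx']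
  rw [h1, ev_prod (pairLaw μ) (fun x l =>
    if x ∈ U then (if l.1 ≠ 0 ∨ l.2 ≠ 0 then (1 : ℝ) else 0) else 1)]
  have h2 : ∀ x, ∑ l : Λ × Λ, pairLaw μ x l *
      (if x ∈ U then (if l.1 ≠ 0 ∨ l.2 ≠ 0 then (1 : ℝ) else 0) else 1) ≤
      if x ∈ U then 2 * π else 1 := by
    intro x
    by_cases hx : x ∈ U
    · simp only [hx, if_true]
      have h3 : ∀ l : Λ × Λ, (if l.1 ≠ 0 ∨ l.2 ≠ 0 then (1 : ℝ) else 0) =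
          1 - if l = (0, 0) then 1 else 0 := by
        rintro ⟨a, b⟩
        by_cases ha : a = 0 <;> by_cases hb : b = 0 <;> simp [ha, hb]
      simp only [h3, mul_sub, mul_one, sum_sub_distrib, hμ.pair.sum_one]
      simp only [mul_ite, mul_one, mul_zero, sum_ite_eq', mem_univ, if_true, pairLaw]
      nlinarith [hπ x, sq_nonneg (1 - μ x 0)]
    · simp [hx, hμ.pair.sum_one]
  calc _ ≤ ∏ x, (if x ∈ U then 2 * π else 1) := by
        refine prod_le_prod (fun x _ => sum_nonneg fun l _ => ?_) fun x _ => h2 x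
        refine mul_nonneg (hμ.pair.nonneg _ _) ?_
        split_ifs <;> norm_num
    _ = _ := by rw [prod_ite_mem, univ_inter, prod_const]

end ProductMeasure

section Weighted

variable {Ω : Type*} [Fintype Ω]

open Classical in
/-- The total weight of the outcomes satisfying `P`. -/
noncomputable def pr (w : Ω → ℝ) (P : Ω → Prop) : ℝ := ∑ ω, w ω * if P ω then 1 else 0

lemma pr_mono {w : Ω → ℝ} (hw : ∀ ω, 0 ≤ w ω) {P P' : Ω → Prop} (h : ∀ ω, P ω → P' ω) :
    pr w P ≤ pr w P' := by
  classical
  refine sum_le_sum fun ω _ => mul_le_mul_of_nonneg_left ?_ (hw ω)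
  by_cases hP : P ω
  · simp [hP, h ω hP]
  · simp only [hP, if_false]
    split_ifs <;> norm_num

lemma pr_or_le {w : Ω → ℝ} (hw : ∀ ω, 0 ≤ w ω) (P P' : Ω → Prop) :
    pr w (fun ω => P ω ∨ P' ω) ≤ pr w P + pr w P' := by
  classical
  simp only [pr, ← sum_add_distrib, ← mul_add]
  refine sum_le_sum fun ω _ => mul_le_mul_of_nonneg_left ?_ (hw ω)
  by_cases hP : P ω <;> by_cases hP' : P' ω <;> simp [hP, hP']

lemma pr_exists_le {ι : Type*} {w : Ω → ℝ} (hw : ∀ ω, 0 ≤ w ω) (s : Finset ι)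
    (P : ι → Ω → Prop) :
    pr w (fun ω => ∃ i ∈ s, P i ω) ≤ ∑ i ∈ s, pr w (P i) := by
  classical
  induction s using Finset.induction_on with
  | empty => simp [pr]
  | insert i s hi ih =>
    rw [sum_insert hi]
    refine le_trans (pr_mono hw fun ω h => ?_) (le_trans (pr_or_le hw (P i) _)
      (add_le_add le_rfl ih))
    simpa using h

lemma pr_false (w : Ω → ℝ) {P : Ω → Prop} (h : ∀ ω, ¬ P ω) : pr w P = 0 := by
  simp [pr, h]

end Weighted

section Connection

variable {X : Type*} [DecidableEq X]

/-- The vertices within distance `q` of the targets `𝓣`, along links contained in `A`. -/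
def ball (Lk : Finset (Finset X)) (A : Finset X) (𝓣 : Finset (Finset X)) : ℕ → Finset X
  | 0 => (𝓣.filter (· ⊆ A)).biUnion id
  | q + 1 => ball Lk A 𝓣 q ∪
      (Lk.filter fun L => L ⊆ A ∧ (L ∩ ball Lk A 𝓣 q).Nonempty).biUnion id

variable {Lk : Finset (Finset X)} {A : Finset X} {𝓣 𝓣' : Finset (Finset X)}

lemma ball_mono {q q' : ℕ} (h : q ≤ q') : ball Lk A 𝓣 q ⊆ ball Lk A 𝓣 q' := by
  induction q', h using Nat.le_induction with
  | base => exact Subset.rfl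
  | succ m _ ih => exact ih.trans (by rw [ball]; exact subset_union_left)

lemma subset_ball_zero {M : Finset X} (hM : M ∈ 𝓣) (hMA : M ⊆ A) : M ⊆ ball Lk A 𝓣 0 := by
  intro v hv
  simp only [ball, mem_biUnion, mem_filter, id]
  exact ⟨M, ⟨hM, hMA⟩, hv⟩

lemma mem_ball_zero {v : X} : v ∈ ball Lk A 𝓣 0 ↔ ∃ M ∈ 𝓣, M ⊆ A ∧ v ∈ M := by
  simp [ball, and_assoc]

lemma mem_ball_succ {v : X} {q : ℕ} : v ∈ ball Lk A 𝓣 (q + 1) ↔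
    v ∈ ball Lk A 𝓣 q ∨ ∃ L ∈ Lk, L ⊆ A ∧ (L ∩ ball Lk A 𝓣 q).Nonempty ∧ v ∈ L := by
  simp [ball, and_assoc]

lemma subset_ball_succ {L : Finset X} {q : ℕ} (hL : L ∈ Lk) (hLA : L ⊆ A)
    (h : (L ∩ ball Lk A 𝓣 q).Nonempty) : L ⊆ ball Lk A 𝓣 (q + 1) := fun _ hv =>
  mem_ball_succ.2 (Or.inr ⟨L, hL, hLA, h, hv⟩)

lemma exists_target_meets_ball {q q' : ℕ} {y : X} (hy : y ∈ ball Lk A 𝓣' q)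
    (hy' : y ∈ ball Lk A 𝓣 q') :
    ∃ M ∈ 𝓣', M ⊆ A ∧ (M ∩ ball Lk A 𝓣 (q + q')).Nonempty := by
  induction q generalizing y q' with
  | zero =>
    obtain ⟨M, hM, hMA, hyM⟩ := mem_ball_zero.1 hy
    exact ⟨M, hM, hMA, y, by simpa using ⟨hyM, hy'⟩⟩
  | succ q ih =>
    rcases mem_ball_succ.1 hy with h | ⟨L, hL, hLA, ⟨z, hz⟩, hyL⟩
    · obtain ⟨M, hM, hMA, hm⟩ := ih h hy'
      exact ⟨M, hM, hMA, hm.mono (inter_subset_inter_left (ball_mono (by omega)))⟩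
    · rw [mem_inter] at hz
      have h1 : z ∈ ball Lk A 𝓣 (q' + 1) :=
        subset_ball_succ hL hLA ⟨y, mem_inter.2 ⟨hyL, hy'⟩⟩ hz.1
      obtain ⟨M, hM, hMA, hm⟩ := ih hz.2 h1
      exact ⟨M, hM, hMA, hm.mono (inter_subset_inter_left (ball_mono (by omega)))⟩

/-- There is a chain of `q` links inside `A` from `B` to a target, each meeting only its
predecessor and avoiding `Z`. -/
def Reach (Lk : Finset (Finset X)) (A : Finset X) (𝓣 : Finset (Finset X)) :
    ℕ → Finset X → Finset X → Prop
  | 0, Z, B => ∃ M ∈ 𝓣, (M ∩ B).card = 1 ∧ Disjoint M Z ∧ M \ B ⊆ A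
  | q + 1, Z, B => ∃ L ∈ Lk, (L ∩ B).Nonempty ∧ ¬ L ⊆ B ∧ Disjoint L Z ∧ L \ B ⊆ A ∧
      Reach Lk A 𝓣 q (Z ∪ B) (L \ B)

lemma reach_or_bad (q : ℕ) (Z B : Finset X) (hB : (B ∩ ball Lk A 𝓣 q).Nonempty)
    (hlt : ∀ q' < q, Disjoint (Z ∪ B) (ball Lk A 𝓣 q')) (hZ : Disjoint Z (ball Lk A 𝓣 q)) :
    Reach Lk A 𝓣 q Z B ∨ (∃ M ∈ 𝓣, M ⊆ A ∧ 2 ≤ (M ∩ B).card) ∧ q = 0 ∨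
      ∃ M ∈ 𝓣, ∃ L ∈ Lk, M ⊆ A ∧ L ⊆ A ∧ 2 ≤ (L ∩ M).card ∧ ¬ L ⊆ M := by
  induction q generalizing Z B with
  | zero =>
    obtain ⟨v, hv⟩ := hB
    rw [mem_inter] at hv
    obtain ⟨M, hM, hMA, hvM⟩ := mem_ball_zero.1 hv.2
    have hne : (M ∩ B).card ≠ 0 := by
      rw [Ne, card_eq_zero]
      exact Nonempty.ne_empty ⟨v, mem_inter.2 ⟨hvM, hv.1⟩⟩
    by_cases h1 : (M ∩ B).card = 1
    · exact Or.inl ⟨M, hM, h1, (hZ.mono_right (subset_ball_zero hM hMA)).symm,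
        sdiff_subset.trans hMA⟩
    · exact Or.inr (Or.inl ⟨⟨M, hM, hMA, by omega⟩, rfl⟩)
  | succ q ih =>
    obtain ⟨v, hv⟩ := hB
    rw [mem_inter] at hv
    have hBq := (disjoint_union_left.1 (hlt q (Nat.lt_succ_self q)))
    have hvq : v ∉ ball Lk A 𝓣 q := fun h => disjoint_left.1 hBq.2 hv.1 h
    rcases mem_ball_succ.1 hv.2 with h | ⟨L, hL, hLA, hLq, hvL⟩
    · exact absurd h hvq
    obtain ⟨z, hz⟩ := id hLq
    rw [mem_inter] at hz
    have hzB : z ∉ B := fun h => disjoint_left.1 hBq.2 h hz.2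
    have hLZ : Disjoint L Z := (hZ.mono_right (subset_ball_succ hL hLA hLq)).symm
    have hrec := ih (Z ∪ B) (L \ B) ⟨z, by simp [hz, hzB]⟩ (fun q' hq' => by
        refine disjoint_union_left.2 ⟨hlt q' (by omega), ?_⟩
        rw [disjoint_left]
        intro y hy hy'
        exact hvq (ball_mono (show q' + 1 ≤ q by omega)
          (subset_ball_succ hL hLA ⟨y, mem_inter.2 ⟨(mem_sdiff.1 hy).1, hy'⟩⟩ hvL)))
      (hlt q (Nat.lt_succ_self q))
    rcases hrec with h | ⟨⟨M, hM, hMA, hc⟩, rfl⟩ | h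
    · exact Or.inl ⟨L, hL, ⟨v, mem_inter.2 ⟨hvL, hv.1⟩⟩, fun h => hzB (h hz.1), hLZ,
        sdiff_subset.trans hLA, h⟩
    · refine Or.inr (Or.inr ⟨M, hM, L, hL, hMA, hLA, hc.trans (card_le_card ?_), fun h => ?_⟩)
      · intro y hy
        simp only [mem_inter, mem_sdiff] at hy ⊢
        exact ⟨hy.2.1, hy.1⟩
      · exact hvq (subset_ball_zero hM hMA (h hvL))
    · exact Or.inr (Or.inr h)

end Connection

section ConnectionProbability

variable {X : Type*} [DecidableEq X] {Ω : Type*} [Fintype Ω]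

/-- The `π`-weight of the members of `𝓛` properly containing a set of size at least two is
small. -/
def CodegreeLE (𝓛 : Finset (Finset X)) (π b : ℝ) : Prop :=
  ∀ W : Finset X, 2 ≤ W.card → ∑ L ∈ 𝓛 with W ⊂ L, π ^ (L.card - W.card) ≤ b

/-- The random set `A` contains every `U` with weight at most `π ^ |U|`. -/
structure SparseLaw (w : Ω → ℝ) (A : Ω → Finset X) (π : ℝ) : Prop where
  nonneg : ∀ ω, 0 ≤ w ω
  pi_nonneg : 0 ≤ π
  subset_le : ∀ U : Finset X, pr w (fun ω => U ⊆ A ω) ≤ π ^ U.card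

variable {w : Ω → ℝ} {A : Ω → Finset X} {π : ℝ}

lemma sum_pow_sdiff_le {𝓛 : Finset (Finset X)} {b : ℝ} (hπ : 0 ≤ π)
    (h𝓛 : CodegreeLE 𝓛 π b) (B W : Finset X) (hW : 2 ≤ W.card) :
    ∑ L ∈ 𝓛 with (W ⊂ L ∧ L ∩ B = W), π ^ (L \ B).card ≤ b := by
  refine le_trans ?_ (h𝓛 W hW)
  refine le_trans (le_of_eq (sum_congr rfl fun L hL => ?_))
    (sum_le_sum_of_subset_of_nonneg (s := 𝓛.filter fun L => W ⊂ L ∧ L ∩ B = W) ?_ ?_)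
  · rw [mem_filter] at hL
    rw [card_sdiff, inter_comm, hL.2.2]
  · intro L hL
    rw [mem_filter] at hL ⊢
    exact ⟨hL.1, hL.2.1⟩
  · intro L _ _
    positivity

lemma pr_overlap_le (hA : SparseLaw w A π) {𝓜 𝓛 : Finset (Finset X)} {b : ℝ} {J : ℕ}
    (hJ : ∀ M ∈ 𝓜, M.card ≤ J) (h𝓛 : CodegreeLE 𝓛 π b) (hb : 0 ≤ b) :
    pr w (fun ω => ∃ M ∈ 𝓜, ∃ L ∈ 𝓛, M ⊆ A ω ∧ L ⊆ A ω ∧ 2 ≤ (L ∩ M).card ∧ ¬ L ⊆ M) ≤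
      (∑ M ∈ 𝓜, π ^ M.card) * (2 ^ J * b) := by
  refine (pr_exists_le hA.nonneg 𝓜 _).trans ?_
  rw [sum_mul]
  refine sum_le_sum fun M hM => ?_
  have h1 : pr w (fun ω => ∃ L ∈ 𝓛, M ⊆ A ω ∧ L ⊆ A ω ∧ 2 ≤ (L ∩ M).card ∧ ¬ L ⊆ M) ≤
      pr w (fun ω => ∃ W ∈ M.powerset.filter (2 ≤ ·.card),
        ∃ L ∈ 𝓛.filter (fun L => W ⊂ L ∧ L ∩ M = W), M ∪ (L \ M) ⊆ A ω) := by
    refine pr_mono hA.nonneg ?_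
    rintro ω ⟨L, hL, hMA, hLA, hc, hLM⟩
    refine ⟨L ∩ M, by simp [hc], L, ?_, union_subset hMA (sdiff_subset.trans hLA)⟩
    rw [mem_filter]
    refine ⟨hL, ⟨inter_subset_left, fun h => hLM (h.trans inter_subset_right)⟩, rfl⟩
  refine h1.trans ((pr_exists_le hA.nonneg _ _).trans ?_)
  have h2 : ∀ W ∈ M.powerset.filter (2 ≤ ·.card),
      pr w (fun ω => ∃ L ∈ 𝓛.filter (fun L => W ⊂ L ∧ L ∩ M = W), M ∪ (L \ M) ⊆ A ω) ≤
        π ^ M.card * b := by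
    intro W hW
    rw [mem_filter] at hW
    refine (pr_exists_le hA.nonneg _ _).trans ?_
    refine (sum_le_sum fun L _ => hA.subset_le (M ∪ (L \ M))).trans ?_
    have : ∀ L : Finset X, (M ∪ (L \ M)).card = M.card + (L \ M).card := fun L =>
      card_union_of_disjoint disjoint_sdiff
    simp only [this, pow_add, ← mul_sum]
    exact mul_le_mul_of_nonneg_left (sum_pow_sdiff_le hA.pi_nonneg h𝓛 M W hW.2)
      (pow_nonneg hA.pi_nonneg _)
  refine (sum_le_card_nsmul _ _ _ h2).trans ?_
  rw [nsmul_eq_mul]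
  have h3 : ((M.powerset.filter (2 ≤ ·.card)).card : ℝ) ≤ 2 ^ J := by
    have : (M.powerset.filter (2 ≤ ·.card)).card ≤ 2 ^ J :=
      (card_filter_le _ _).trans (by
        rw [card_powerset]
        exact Nat.pow_le_pow_right (by norm_num) (hJ M hM))
    exact_mod_cast this
  have h4 : 0 ≤ π ^ M.card * b := mul_nonneg (pow_nonneg hA.pi_nonneg _) hb
  nlinarith [mul_le_mul_of_nonneg_right h3 h4]

/-- Bounds on the links and on the neighbourhood `K` of a vertex `x` that make links rarely
connect two different targets at `x`. -/
structure LinkBounds (Lk : Finset (Finset X)) (x : X) (K : Finset X) (J : ℕ) (π δ Q : ℝ) :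
    Prop where
  delta_nonneg : 0 ≤ δ
  delta_le : δ ≤ 1
  one_le : 1 ≤ Q
  card_le : ∀ L ∈ Lk, L.card ≤ J
  degree : ∀ u, ∑ L ∈ Lk with u ∈ L, π ^ (L.card - 1) ≤ Q
  codegree : CodegreeLE Lk π (Q * δ)
  card_K : π * K.card ≤ Q
  common : ∀ u, u ≠ x → u ∉ K → π * (K.filter fun v => ({u, v} : Finset X) ∈ Lk).card ≤ Q * δ

/-- The weight of a vertex in the bound for `Reach`. -/
def hit (K : Finset X) (Q δ : ℝ) (v : X) : ℝ := (if v ∈ K then 1 else 0) + Q * δ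

variable {Lk : Finset (Finset X)} {x : X} {K : Finset X} {J : ℕ} {δ Q : ℝ}

lemma LinkBounds.hit_nonneg (h : LinkBounds Lk x K J π δ Q) (v : X) : 0 ≤ hit K Q δ v := by
  have := mul_nonneg (zero_le_one.trans h.one_le) h.delta_nonneg
  unfold hit
  split_ifs <;> linarith

lemma LinkBounds.hit_le (h : LinkBounds Lk x K J π δ Q) (v : X) : hit K Q δ v ≤ 2 * Q := by
  have := mul_le_mul_of_nonneg_left h.delta_le (zero_le_one.trans h.one_le)
  have := h.one_le
  unfold hit
  split_ifs <;> linarith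

/-- One step of a walk along links increases `hit` by at most a constant factor. -/
lemma LinkBounds.sum_hit_le (h : LinkBounds Lk x K J π δ Q) (hπ : 0 ≤ π) {u : X} (hu : u ≠ x) :
    ∑ L ∈ Lk with u ∈ L, π ^ (L.card - 1) * ∑ v ∈ L.erase u, hit K Q δ v ≤
      (3 * J * Q ^ 2 + 2 * Q ^ 2) * hit K Q δ u := by
  have hQ := h.one_le
  have hQ0 : 0 ≤ Q := zero_le_one.trans hQ
  have hQδ := mul_nonneg hQ0 h.delta_nonneg
  have hdeg := h.degree u
  by_cases huK : u ∈ K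
  · have h1 : ∀ L ∈ Lk.filter (u ∈ ·), π ^ (L.card - 1) * ∑ v ∈ L.erase u, hit K Q δ v ≤
        π ^ (L.card - 1) * (J * (2 * Q)) := by
      intro L hL
      rw [mem_filter] at hL
      refine mul_le_mul_of_nonneg_left ?_ (pow_nonneg hπ _)
      refine (sum_le_card_nsmul _ _ _ fun v _ => h.hit_le v).trans ?_
      rw [nsmul_eq_mul]
      refine mul_le_mul_of_nonneg_right ?_ (by linarith)
      exact_mod_cast (card_le_card (erase_subset u L)).trans (h.card_le L hL.1)
    refine (sum_le_sum h1).trans ?_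
    rw [← sum_mul]
    have h2 : (1 : ℝ) ≤ hit K Q δ u := by simp [hit, huK, hQδ]
    have hJ0 : (0 : ℝ) ≤ J := Nat.cast_nonneg J
    calc _ ≤ Q * (J * (2 * Q)) := mul_le_mul_of_nonneg_right hdeg (by positivity)
      _ ≤ (3 * J * Q ^ 2 + 2 * Q ^ 2) * 1 := by nlinarith [mul_nonneg hJ0 (sq_nonneg Q), sq_nonneg Q]
      _ ≤ _ := mul_le_mul_of_nonneg_left h2 (by positivity)
  · have h1 : ∀ L ∈ Lk.filter (u ∈ ·), π ^ (L.card - 1) * ∑ v ∈ L.erase u, hit K Q δ v ≤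
        π ^ (L.card - 1) * (J * (Q * δ)) +
          ∑ v ∈ K, if v ∈ L.erase u then π ^ (L.card - 1) else 0 := by
      intro L hL
      rw [mem_filter] at hL
      simp only [hit, sum_add_distrib, mul_add, sum_const, nsmul_eq_mul]
      rw [add_comm]
      refine add_le_add (mul_le_mul_of_nonneg_left (mul_le_mul_of_nonneg_right ?_ hQδ)
        (pow_nonneg hπ _)) (le_of_eq ?_)
      · exact_mod_cast (card_le_card (erase_subset u L)).trans (h.card_le L hL.1)
      · rw [mul_sum]
        simp only [mul_ite, mul_one, mul_zero]
        rw [← sum_filter, ← sum_filter]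
        refine sum_congr ?_ fun _ _ => rfl
        ext v
        simp [and_comm]
    refine (sum_le_sum h1).trans ?_
    rw [sum_add_distrib, ← sum_mul, sum_comm]
    have h2 : hit K Q δ u = Q * δ := by simp [hit, huK]
    have h3 : ∀ v ∈ K, ∑ L ∈ Lk with u ∈ L, (if v ∈ L.erase u then π ^ (L.card - 1) else 0) ≤
        π * (Q * δ) + if ({u, v} : Finset X) ∈ Lk then π else 0 := by
      intro v hv
      have huv : u ≠ v := fun e => huK (e ▸ hv)
      have hcard : ({u, v} : Finset X).card = 2 := card_pair huv
      have h4 : ∀ L ∈ Lk.filter (u ∈ ·), (if v ∈ L.erase u then π ^ (L.card - 1) else 0) ≤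
          (if ({u, v} : Finset X) ⊂ L then π * π ^ (L.card - ({u, v} : Finset X).card) else 0) +
          if L = {u, v} then π else 0 := by
        intro L hL
        rw [mem_filter] at hL
        by_cases hvL : v ∈ L.erase u
        · have hvL' := (mem_erase.1 hvL).2
          have hsub : ({u, v} : Finset X) ⊆ L := by
            intro y hy
            simp only [mem_insert, mem_singleton] at hy
            rcases hy with rfl | rfl
            exacts [hL.2, hvL']
          rw [if_pos hvL]
          by_cases hLe : L = {u, v}
          · rw [if_pos hLe, if_neg (by rw [hLe]; exact fun h => h.ne rfl), hLe, hcard]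
            simp
          · have hss : ({u, v} : Finset X) ⊂ L := hsub.ssubset_of_ne (Ne.symm hLe)
            have := card_lt_card hss
            rw [if_pos hss, if_neg hLe, hcard, ← pow_succ', add_zero]
            rw [hcard] at this
            refine le_of_eq (congrArg _ (by omega))
        · rw [if_neg hvL]
          refine add_nonneg ?_ ?_ <;> split_ifs <;> positivity
      refine (sum_le_sum h4).trans ?_
      rw [sum_add_distrib]
      refine add_le_add ?_ ?_
      · rw [← sum_filter, ← mul_sum]
        refine mul_le_mul_of_nonneg_left (le_trans ?_ (h.codegree {u, v} hcard.ge)) hπ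
        refine sum_le_sum_of_subset_of_nonneg ?_ fun _ _ _ => by positivity
        intro L hL
        simp only [mem_filter] at hL ⊢
        exact ⟨hL.1.1, hL.2⟩
      · rw [sum_ite_eq' (Lk.filter (u ∈ ·)) ({u, v} : Finset X) (fun _ => π)]
        refine le_of_eq (if_congr ?_ rfl rfl)
        simp
    have h5 : ∑ v ∈ K, ∑ L ∈ Lk with u ∈ L, (if v ∈ L.erase u then π ^ (L.card - 1) else 0) ≤
        Q * (Q * δ) + Q * δ := by
      refine (sum_le_sum h3).trans ?_
      rw [sum_add_distrib, sum_const, nsmul_eq_mul, ← sum_filter, sum_const, nsmul_eq_mul]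
      have := h.common u hu huK
      have := mul_le_mul_of_nonneg_right h.card_K hQδ
      nlinarith
    rw [h2]
    have h6 := mul_le_mul_of_nonneg_right hdeg
      (show 0 ≤ (J : ℝ) * (Q * δ) by positivity)
    have hJ0 : (0 : ℝ) ≤ J := Nat.cast_nonneg J
    have hQQ : Q ≤ Q ^ 2 := by nlinarith
    have e1 : Q * (J * (Q * δ)) ≤ 3 * J * Q ^ 2 * (Q * δ) := by
      have : Q * J ≤ 3 * J * Q ^ 2 := by nlinarith
      nlinarith [mul_le_mul_of_nonneg_right this hQδ]
    have e2 : Q * (Q * δ) + Q * δ ≤ 2 * Q ^ 2 * (Q * δ) := by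
      have : Q + 1 ≤ 2 * Q ^ 2 := by nlinarith
      nlinarith [mul_le_mul_of_nonneg_right this hQδ]
    linarith

/-- The growth factor of the `Reach` bound per step. -/
def reachFactor (J : ℕ) (Q : ℝ) : ℝ :=
  3 * J * Q ^ 2 + 2 * Q ^ 2 + J * Q + 2 ^ J * Q * (J * (2 * Q) + 1)

end ConnectionProbability

section ReachProbability

variable {X : Type*} [DecidableEq X] {Ω : Type*} [Fintype Ω]
variable {w : Ω → ℝ} {A : Ω → Finset X} {π : ℝ}
variable {Lk : Finset (Finset X)} {x : X} {K : Finset X} {J : ℕ} {δ Q : ℝ}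

lemma reachFactor_nonneg (J : ℕ) {Q : ℝ} (hQ : 1 ≤ Q) : 0 ≤ reachFactor J Q := by
  have : 0 ≤ Q := zero_le_one.trans hQ
  unfold reachFactor
  positivity

lemma card_sdiff_of_inter_singleton {M B : Finset X} {v : X} (h : M ∩ B = {v}) :
    (M \ B).card = M.card - 1 := by
  rw [card_sdiff, inter_comm, h, card_singleton]

lemma pr_reach_le (hA : SparseLaw w A π) (hxA : ∀ ω, x ∉ A ω)
    (h : LinkBounds Lk x K J π δ Q) {𝓣 : Finset (Finset X)}
    (h𝓣 : ∀ v, ∑ M ∈ 𝓣 with v ∈ M, π ^ (M.card - 1) ≤ hit K Q δ v) (q : ℕ) :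
    ∀ Z B U : Finset X, U ⊆ Z ∪ B → B.card ≤ J → x ∉ B →
      pr w (fun ω => U ⊆ A ω ∧ Reach Lk (A ω) 𝓣 q Z B) ≤
        π ^ U.card * (reachFactor J Q ^ q * (∑ v ∈ B, hit K Q δ v + δ)) := by
  have hπ := hA.pi_nonneg
  have hF := reachFactor_nonneg J h.one_le
  induction q with
  | zero =>
    intro Z B U hU _ _
    have h1 : pr w (fun ω => U ⊆ A ω ∧ Reach Lk (A ω) 𝓣 0 Z B) ≤
        pr w (fun ω => ∃ v ∈ B, ∃ M ∈ 𝓣.filter (fun M => v ∈ M ∧ M ∩ B = {v} ∧ Disjoint M Z),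
          U ∪ (M \ B) ⊆ A ω) := by
      refine pr_mono hA.nonneg ?_
      rintro ω ⟨hUA, M, hM, hc, hMZ, hMA⟩
      obtain ⟨v, hv⟩ := card_eq_one.1 hc
      have hvm : v ∈ M ∩ B := by simp [hv]
      rw [mem_inter] at hvm
      refine ⟨v, hvm.2, M, ?_, union_subset hUA hMA⟩
      simp [hM, hvm.1, hv, hMZ]
    refine h1.trans ((pr_exists_le hA.nonneg _ _).trans ?_)
    have h2 : ∀ v ∈ B, pr w (fun ω => ∃ M ∈ 𝓣.filter
          (fun M => v ∈ M ∧ M ∩ B = {v} ∧ Disjoint M Z), U ∪ (M \ B) ⊆ A ω) ≤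
        π ^ U.card * hit K Q δ v := by
      intro v _
      refine (pr_exists_le hA.nonneg _ _).trans ?_
      refine le_trans ?_ (mul_le_mul_of_nonneg_left (h𝓣 v) (pow_nonneg hπ _))
      rw [mul_sum]
      refine le_trans (sum_le_sum (g := fun M => π ^ U.card * π ^ (M.card - 1)) fun M hM => ?_)
        (sum_le_sum_of_subset_of_nonneg ?_ fun _ _ _ => by positivity)
      · rw [mem_filter] at hM
        refine (hA.subset_le _).trans (le_of_eq ?_)
        rw [card_union_of_disjoint, card_sdiff_of_inter_singleton hM.2.2.1, pow_add]
        refine Disjoint.mono_left hU (disjoint_union_left.2 ⟨?_, disjoint_sdiff⟩)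
        exact (hM.2.2.2.mono_left sdiff_subset).symm
      · intro M hM
        rw [mem_filter] at hM ⊢
        exact ⟨hM.1, hM.2.1⟩
    refine (sum_le_sum h2).trans ?_
    rw [← mul_sum, pow_zero, one_mul]
    exact mul_le_mul_of_nonneg_left (by linarith [h.delta_nonneg]) (pow_nonneg hπ _)
  | succ q ih =>
    intro Z B U hU hBJ hxB
    have hQ0 : 0 ≤ Q := zero_le_one.trans h.one_le
    have hδ := h.delta_nonneg
    set F := reachFactor J Q with hFdef
    have hstep : ∀ L ∈ Lk, Disjoint L Z →
        pr w (fun ω => L \ B ⊆ A ω ∧ U ⊆ A ω ∧ Reach Lk (A ω) 𝓣 q (Z ∪ B) (L \ B)) ≤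
        π ^ U.card * (π ^ (L \ B).card * (F ^ q * (∑ v ∈ L \ B, hit K Q δ v + δ))) := by
      intro L hL hLZ
      have hnn : 0 ≤ π ^ U.card * (π ^ (L \ B).card * (F ^ q * (∑ v ∈ L \ B, hit K Q δ v + δ))) := by
        have := sum_nonneg fun v (_ : v ∈ L \ B) => h.hit_nonneg v
        positivity
      by_cases hx : x ∈ L \ B
      · rw [pr_false w fun ω hω => hxA ω (hω.1 hx)]
        exact hnn
      · refine le_trans (pr_mono hA.nonneg fun ω hω => ?_)
          ((ih (Z ∪ B) (L \ B) (U ∪ L \ B) (union_subset_union_left hU)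
            ((card_le_card sdiff_subset).trans (h.card_le L hL)) hx).trans (le_of_eq ?_))
        · exact ⟨union_subset hω.2.1 hω.1, hω.2.2⟩
        · rw [card_union_of_disjoint, pow_add, mul_assoc]
          refine Disjoint.mono_left hU (disjoint_union_left.2 ⟨?_, disjoint_sdiff⟩)
          exact (hLZ.mono_left sdiff_subset).symm
    have h1 : pr w (fun ω => U ⊆ A ω ∧ Reach Lk (A ω) 𝓣 (q + 1) Z B) ≤
        pr w (fun ω => (∃ u ∈ B, ∃ L ∈ Lk.filter (fun L => u ∈ L ∧ L ∩ B = {u} ∧ Disjoint L Z),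
            L \ B ⊆ A ω ∧ U ⊆ A ω ∧ Reach Lk (A ω) 𝓣 q (Z ∪ B) (L \ B)) ∨
          ∃ W ∈ B.powerset.filter (2 ≤ ·.card),
            ∃ L ∈ Lk.filter (fun L => (W ⊂ L ∧ L ∩ B = W) ∧ Disjoint L Z),
            L \ B ⊆ A ω ∧ U ⊆ A ω ∧ Reach Lk (A ω) 𝓣 q (Z ∪ B) (L \ B)) := by
      refine pr_mono hA.nonneg ?_
      rintro ω ⟨hUA, L, hL, hne, hLB, hLZ, hLA, hR⟩
      by_cases hc : (L ∩ B).card = 1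
      · left
        obtain ⟨v, hv⟩ := card_eq_one.1 hc
        have hvm : v ∈ L ∩ B := by simp [hv]
        rw [mem_inter] at hvm
        exact ⟨v, hvm.2, L, by simp [hL, hvm.1, hv, hLZ], hLA, hUA, hR⟩
      · right
        have := card_pos.2 hne
        refine ⟨L ∩ B, by simp; omega, L, ?_, hLA, hUA, hR⟩
        rw [mem_filter]
        exact ⟨hL, ⟨⟨inter_subset_left, fun h => hLB (h.trans inter_subset_right)⟩, rfl⟩, hLZ⟩
    refine h1.trans ((pr_or_le hA.nonneg _ _).trans ?_)
    have hsing : ∀ u ∈ B, pr w (fun ω => ∃ L ∈ Lk.filter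
          (fun L => u ∈ L ∧ L ∩ B = {u} ∧ Disjoint L Z),
            L \ B ⊆ A ω ∧ U ⊆ A ω ∧ Reach Lk (A ω) 𝓣 q (Z ∪ B) (L \ B)) ≤
        π ^ U.card * (F ^ q * ((3 * J * Q ^ 2 + 2 * Q ^ 2) * hit K Q δ u + Q * δ)) := by
      intro u hu
      refine (pr_exists_le hA.nonneg _ _).trans ?_
      have hb := add_le_add (h.sum_hit_le hπ (u := u) (fun e => hxB (e ▸ hu)))
        (mul_le_mul_of_nonneg_right (h.degree u) hδ)
      refine le_trans ?_ (mul_le_mul_of_nonneg_left (mul_le_mul_of_nonneg_left hb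
        (pow_nonneg hF q)) (pow_nonneg hπ U.card))
      rw [sum_mul, ← sum_add_distrib, mul_sum, mul_sum]
      refine le_trans (sum_le_sum (g := fun L => π ^ U.card * (F ^ q *
        (π ^ (L.card - 1) * ∑ v ∈ L.erase u, hit K Q δ v + π ^ (L.card - 1) * δ)))
        fun L hL => ?_) (sum_le_sum_of_subset_of_nonneg ?_ fun L _ _ => ?_)
      · rw [mem_filter] at hL
        refine (hstep L hL.1 hL.2.2.2).trans (le_of_eq ?_)
        have : L \ B = L.erase u := by
          rw [← sdiff_inter_self_left, hL.2.2.1, sdiff_singleton_eq_erase]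
        rw [card_sdiff_of_inter_singleton hL.2.2.1, this]
        ring
      · intro L hL
        rw [mem_filter] at hL ⊢
        exact ⟨hL.1, hL.2.1⟩
      · have := sum_nonneg fun v (_ : v ∈ L.erase u) => h.hit_nonneg v
        positivity
    have hmulti : ∀ W ∈ B.powerset.filter (2 ≤ ·.card), pr w (fun ω => ∃ L ∈ Lk.filter
          (fun L => (W ⊂ L ∧ L ∩ B = W) ∧ Disjoint L Z),
            L \ B ⊆ A ω ∧ U ⊆ A ω ∧ Reach Lk (A ω) 𝓣 q (Z ∪ B) (L \ B)) ≤
        π ^ U.card * (F ^ q * (Q * δ * (J * (2 * Q) + 1))) := by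
      intro W hW
      rw [mem_filter] at hW
      refine (pr_exists_le hA.nonneg _ _).trans ?_
      refine le_trans (sum_le_sum (g := fun L => π ^ (L \ B).card *
        (π ^ U.card * (F ^ q * (J * (2 * Q) + 1)))) fun L hL => ?_) ?_
      · rw [mem_filter] at hL
        refine (hstep L hL.1 hL.2.2).trans ?_
        have h3 : ∑ v ∈ L \ B, hit K Q δ v + δ ≤ J * (2 * Q) + 1 := by
          refine add_le_add ((sum_le_card_nsmul _ _ _ fun v _ => h.hit_le v).trans ?_) h.delta_le
          rw [nsmul_eq_mul]
          refine mul_le_mul_of_nonneg_right ?_ (by positivity)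
          exact_mod_cast (card_le_card sdiff_subset).trans (h.card_le L hL.1)
        calc _ = π ^ (L \ B).card * (π ^ U.card * (F ^ q * (∑ v ∈ L \ B, hit K Q δ v + δ))) := by
              ring
          _ ≤ _ := by gcongr
      · rw [← sum_mul]
        have h4 : ∑ L ∈ Lk with ((W ⊂ L ∧ L ∩ B = W) ∧ Disjoint L Z), π ^ (L \ B).card ≤ Q * δ := by
          refine le_trans (sum_le_sum_of_subset_of_nonneg ?_ fun L _ _ => by positivity)
            (sum_pow_sdiff_le hπ h.codegree B W hW.2)
          intro L hL
          rw [mem_filter] at hL ⊢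
          exact ⟨hL.1, hL.2.1⟩
        calc _ ≤ Q * δ * (π ^ U.card * (F ^ q * (J * (2 * Q) + 1))) := by gcongr
          _ = _ := by ring
    have hs1 := (pr_exists_le hA.nonneg B (fun u ω => ∃ L ∈ Lk.filter
          (fun L => u ∈ L ∧ L ∩ B = {u} ∧ Disjoint L Z),
            L \ B ⊆ A ω ∧ U ⊆ A ω ∧ Reach Lk (A ω) 𝓣 q (Z ∪ B) (L \ B))).trans (sum_le_sum hsing)
    have hs2 := (pr_exists_le hA.nonneg (B.powerset.filter (2 ≤ ·.card)) (fun W ω => ∃ L ∈ Lk.filter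
          (fun L => (W ⊂ L ∧ L ∩ B = W) ∧ Disjoint L Z),
            L \ B ⊆ A ω ∧ U ⊆ A ω ∧ Reach Lk (A ω) 𝓣 q (Z ∪ B) (L \ B))).trans
            (sum_le_card_nsmul _ _ _ hmulti)
    refine (add_le_add hs1 hs2).trans ?_
    rw [← mul_sum, ← mul_sum, sum_add_distrib, ← mul_sum, sum_const, nsmul_eq_mul, nsmul_eq_mul]
    have hcp : ((B.powerset.filter (2 ≤ ·.card)).card : ℝ) ≤ 2 ^ J := by
      have : (B.powerset.filter (2 ≤ ·.card)).card ≤ 2 ^ J :=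
        (card_filter_le _ _).trans (by
          rw [card_powerset]
          exact Nat.pow_le_pow_right (by norm_num) hBJ)
      exact_mod_cast this
    have hBc : (B.card : ℝ) ≤ J := by exact_mod_cast hBJ
    have hS := sum_nonneg fun v (_ : v ∈ B) => h.hit_nonneg v
    set S := ∑ v ∈ B, hit K Q δ v
    calc _ ≤ π ^ U.card * (F ^ q * ((3 * J * Q ^ 2 + 2 * Q ^ 2) * S + J * (Q * δ))) +
          2 ^ J * (π ^ U.card * (F ^ q * (Q * δ * (J * (2 * Q) + 1)))) := by gcongr
      _ = π ^ U.card * (F ^ q * ((3 * J * Q ^ 2 + 2 * Q ^ 2) * S +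
          (J * Q + 2 ^ J * Q * (J * (2 * Q) + 1)) * δ)) := by ring
      _ ≤ π ^ U.card * (F ^ q * (F * (S + δ))) := by
          gcongr
          rw [hFdef, reachFactor]
          have e1 : 0 ≤ (J * Q + 2 ^ J * Q * (J * (2 * Q) + 1)) * S := by positivity
          have e2 : 0 ≤ (3 * J * Q ^ 2 + 2 * Q ^ 2) * δ := by positivity
          nlinarith
      _ = _ := by rw [pow_succ]; ring

/-- The constant in the bound for the probability that two targets are connected. -/
noncomputable def connConst (J : ℕ) (Q Q' : ℝ) (T : ℕ) : ℝ :=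
  (∑ q ∈ range (2 * T + 1), reachFactor J Q ^ q) * (Q' + Q) + 3 * (Q * (2 ^ J * Q))

theorem pr_connected_le (hA : SparseLaw w A π) (hxA : ∀ ω, x ∉ A ω)
    (h : LinkBounds Lk x K J π δ Q) {𝓣 𝓣' : Finset (Finset X)}
    (h𝓣 : ∀ v, ∑ M ∈ 𝓣 with v ∈ M, π ^ (M.card - 1) ≤ hit K Q δ v)
    (hJ : ∀ M ∈ 𝓣, M.card ≤ J) (hJ' : ∀ M ∈ 𝓣', M.card ≤ J)
    (hw : ∑ M ∈ 𝓣, π ^ M.card ≤ Q) (hw' : ∑ M ∈ 𝓣', π ^ M.card ≤ Q)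
    (hc : CodegreeLE 𝓣 π (Q * δ)) (hc' : CodegreeLE 𝓣' π (Q * δ))
    (hne : ∀ M ∈ 𝓣, ∀ M' ∈ 𝓣', 2 ≤ (M ∩ M').card → M ≠ M') {Q' : ℝ}
    (hcross : ∑ M ∈ 𝓣', π ^ M.card * ∑ v ∈ M, hit K Q δ v ≤ Q' * δ) (T : ℕ) :
    pr w (fun ω => ¬ Disjoint (ball Lk (A ω) 𝓣' T) (ball Lk (A ω) 𝓣 T)) ≤
      connConst J Q Q' T * δ := by
  have hQ0 : 0 ≤ Q := zero_le_one.trans h.one_le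
  have hδ := h.delta_nonneg
  have hb : 0 ≤ Q * δ := mul_nonneg hQ0 hδ
  have hF := reachFactor_nonneg J h.one_le
  have h1 : pr w (fun ω => ¬ Disjoint (ball Lk (A ω) 𝓣' T) (ball Lk (A ω) 𝓣 T)) ≤
      pr w (fun ω => (∃ q ∈ range (2 * T + 1), ∃ M ∈ 𝓣', M ⊆ A ω ∧ Reach Lk (A ω) 𝓣 q ∅ M) ∨
        (∃ M ∈ 𝓣, ∃ L ∈ Lk, M ⊆ A ω ∧ L ⊆ A ω ∧ 2 ≤ (L ∩ M).card ∧ ¬ L ⊆ M) ∨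
        (∃ M ∈ 𝓣', ∃ L ∈ 𝓣, M ⊆ A ω ∧ L ⊆ A ω ∧ 2 ≤ (L ∩ M).card ∧ ¬ L ⊆ M) ∨
        (∃ M ∈ 𝓣, ∃ L ∈ 𝓣', M ⊆ A ω ∧ L ⊆ A ω ∧ 2 ≤ (L ∩ M).card ∧ ¬ L ⊆ M)) := by
    refine pr_mono hA.nonneg fun ω hω => ?_
    obtain ⟨y, hy, hy'⟩ := not_disjoint_iff.1 hω
    obtain ⟨M, hM, hMA, hMb⟩ := exists_target_meets_ball hy hy'
    have hex : ∃ q, (M ∩ ball Lk (A ω) 𝓣 q).Nonempty := ⟨_, hMb⟩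
    have hmin := fun q' (hq' : q' < Nat.find hex) => Nat.find_min hex hq'
    have hsp := Nat.find_spec hex
    have hle := Nat.find_min' hex hMb
    rcases reach_or_bad (Nat.find hex) ∅ M hsp (fun q' hq' => by
        rw [empty_union, disjoint_iff_inter_eq_empty]
        exact not_nonempty_iff_eq_empty.1 (hmin q' hq')) (disjoint_empty_left _) with
      hR | ⟨⟨M', hM', hMA', hcd⟩, -⟩ | hbad
    · exact Or.inl ⟨_, mem_range.2 (by omega), M, hM, hMA, hR⟩
    · by_cases hs : M' ⊆ M
      · refine Or.inr (Or.inr (Or.inr ⟨M', hM', M, hM, hMA', hMA, by rwa [inter_comm], fun h => ?_⟩))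
        exact hne M' hM' M hM hcd (hs.antisymm h)
      · exact Or.inr (Or.inr (Or.inl ⟨M, hM, M', hM', hMA, hMA', hcd, hs⟩))
    · exact Or.inr (Or.inl hbad)
  refine h1.trans ((pr_or_le hA.nonneg _ _).trans ((add_le_add le_rfl
    ((pr_or_le hA.nonneg _ _).trans (add_le_add le_rfl (pr_or_le hA.nonneg _ _)))).trans ?_))
  have o1 := pr_overlap_le hA hJ h.codegree hb
  have o2 := pr_overlap_le hA hJ' hc hb
  have o3 := pr_overlap_le hA hJ hc' hb
  have hp : (0 : ℝ) ≤ 2 ^ J * (Q * δ) := by positivity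
  have p1 := mul_le_mul_of_nonneg_right hw hp
  have p2 := mul_le_mul_of_nonneg_right hw' hp
  have hreach : pr w (fun ω => ∃ q ∈ range (2 * T + 1), ∃ M ∈ 𝓣', M ⊆ A ω ∧
      Reach Lk (A ω) 𝓣 q ∅ M) ≤ ∑ q ∈ range (2 * T + 1), reachFactor J Q ^ q * ((Q' + Q) * δ) := by
    refine (pr_exists_le hA.nonneg _ _).trans (sum_le_sum fun q _ => ?_)
    refine (pr_exists_le hA.nonneg _ _).trans ?_
    have h2 : ∀ M ∈ 𝓣', pr w (fun ω => M ⊆ A ω ∧ Reach Lk (A ω) 𝓣 q ∅ M) ≤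
        reachFactor J Q ^ q * (π ^ M.card * ∑ v ∈ M, hit K Q δ v + π ^ M.card * δ) := by
      intro M hM
      by_cases hx : x ∈ M
      · rw [pr_false w fun ω hω => hxA ω (hω.1 hx)]
        have := sum_nonneg fun v (_ : v ∈ M) => h.hit_nonneg v
        have := hA.pi_nonneg
        positivity
      · refine (pr_reach_le hA hxA h h𝓣 q ∅ M M (by simp) (hJ' M hM) hx).trans (le_of_eq ?_)
        ring
    refine (sum_le_sum h2).trans ?_
    rw [← mul_sum, sum_add_distrib, ← sum_mul]
    refine mul_le_mul_of_nonneg_left ?_ (pow_nonneg hF q)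
    have := mul_le_mul_of_nonneg_right hw' hδ
    linarith
  rw [← sum_mul] at hreach
  unfold connConst
  nlinarith

end ReachProbability

section Acceptance

variable {X : Type*} [Fintype X] [DecidableEq X]

/-- The set accepted in the first `i` rounds: in round `i + 1` a vertex labelled `i + 1` is
accepted unless it completes a link with earlier accepted and currently labelled vertices. -/
def acc (Lk : Finset (Finset X)) (ξ : X → ℕ) : ℕ → Finset X
  | 0 => ∅
  | i + 1 => acc Lk ξ i ∪ univ.filter fun x => ξ x = i + 1 ∧
      ∀ L ∈ Lk, x ∈ L → ¬ L.erase x ⊆ acc Lk ξ i ∪ univ.filter fun y => ξ y = i + 1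

variable {Lk : Finset (Finset X)} {ξ ζ : X → ℕ}

lemma mem_acc_succ {i : ℕ} {x : X} : x ∈ acc Lk ξ (i + 1) ↔ x ∈ acc Lk ξ i ∨ (ξ x = i + 1 ∧
      ∀ L ∈ Lk, x ∈ L → ¬ L.erase x ⊆ acc Lk ξ i ∪ univ.filter fun y => ξ y = i + 1) := by
  simp [acc]

lemma acc_mono {i j : ℕ} (h : i ≤ j) : acc Lk ξ i ⊆ acc Lk ξ j := by
  induction j, h using Nat.le_induction with
  | base => exact Subset.rfl
  | succ m _ ih => exact ih.trans fun x hx => mem_acc_succ.2 (Or.inl hx)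

lemma label_of_mem_acc {i : ℕ} {x : X} (h : x ∈ acc Lk ξ i) : 1 ≤ ξ x ∧ ξ x ≤ i := by
  induction i with
  | zero => simp [acc] at h
  | succ i ih =>
    rcases mem_acc_succ.1 h with h | ⟨h, -⟩
    · have := ih h
      omega
    · omega

lemma acc_link_free (h2 : ∀ L ∈ Lk, 2 ≤ L.card) (i : ℕ) {L : Finset X} (hL : L ∈ Lk) :
    ¬ L ⊆ acc Lk ξ i := by
  induction i with
  | zero =>
    intro h
    have := h2 L hL
    have := card_le_card h
    simp [acc] at this
    simp_all
  | succ i ih =>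
    intro h
    obtain ⟨x, hxL, hx⟩ := not_subset.1 ih
    rcases mem_acc_succ.1 (h hxL) with h' | ⟨-, h'⟩
    · exact hx h'
    · refine h' L hL hxL fun y hy => ?_
      rcases mem_acc_succ.1 (h (mem_of_mem_erase hy)) with h'' | ⟨h'', -⟩
      · exact mem_union_left _ h''
      · simp [h'']

lemma acc_congr {i : ℕ} (h : ∀ y j, 1 ≤ j → j ≤ i → (ξ y = j ↔ ζ y = j)) :
    acc Lk ξ i = acc Lk ζ i := by
  induction i with
  | zero => rfl
  | succ i ih =>
    have e := ih fun y j h1 h2 => h y j h1 (by omega)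
    have e2 : (univ.filter fun y => ξ y = i + 1) = univ.filter fun y => ζ y = i + 1 := by
      ext y
      simp [h y (i + 1) (by omega) le_rfl]
    simp only [acc, e, e2]
    congr 1
    ext x
    simp only [mem_filter, h x (i + 1) (by omega) le_rfl]

lemma mem_acc_local {A : Finset X} {𝓣 : Finset (Finset X)} {T : ℕ}
    (hξ : ∀ y, ξ y ≠ 0 → y ∈ A) (hζ : ∀ y, ζ y ≠ 0 → y ∈ A)
    (h : ∀ y ∈ ball Lk A 𝓣 T, ξ y = ζ y) {i q : ℕ} (hiq : i + q ≤ T) {v : X}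
    (hv : v ∈ ball Lk A 𝓣 q) : v ∈ acc Lk ξ i ↔ v ∈ acc Lk ζ i := by
  induction i generalizing q v with
  | zero => simp [acc]
  | succ i ih =>
    have hvT : v ∈ ball Lk A 𝓣 T := ball_mono (by omega) hv
    rw [mem_acc_succ, mem_acc_succ, ih (by omega) hv, ← h v hvT]
    refine or_congr Iff.rfl (and_congr_right fun hlab => ?_)
    have hvA : v ∈ A := hξ v (by omega)
    refine forall_congr' fun L => forall_congr' fun hL => forall_congr' fun hvL => not_congr ?_
    by_cases hLA : L ⊆ A
    · have hLb : L ⊆ ball Lk A 𝓣 (q + 1) :=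
        subset_ball_succ hL hLA ⟨v, mem_inter.2 ⟨hvL, hv⟩⟩
      refine forall_congr' fun y => forall_congr' fun hy => ?_
      have hyb := hLb (mem_of_mem_erase hy)
      have hyT : y ∈ ball Lk A 𝓣 T := ball_mono (by omega) hyb
      simp only [mem_union, mem_filter, mem_univ, true_and]
      rw [ih (q := q + 1) (by omega) hyb, h y hyT]
    · obtain ⟨y, hyL, hyA⟩ := not_subset.1 hLA
      have hyv : y ∈ L.erase v := mem_erase.2 ⟨fun e => hyA (e ▸ hvA), hyL⟩
      have key : ∀ θ : X → ℕ, (∀ y, θ y ≠ 0 → y ∈ A) →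
          ¬ L.erase v ⊆ acc Lk θ i ∪ univ.filter fun y => θ y = i + 1 := by
        intro θ hθ hs
        have h0 : θ y = 0 := by
          by_contra h0
          exact hyA (hθ y h0)
        have := hs hyv
        simp only [mem_union, mem_filter, mem_univ, true_and] at this
        rcases this with h1 | h1
        · have := label_of_mem_acc h1
          omega
        · omega
      exact iff_of_false (key ξ hξ) (key ζ hζ)

/-- No target is contained in the accepted set. -/
def Clean (Lk 𝓣 : Finset (Finset X)) (ξ : X → ℕ) (i : ℕ) : Prop :=
  ∀ M ∈ 𝓣, ¬ M ⊆ acc Lk ξ i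

lemma clean_local {A : Finset X} {𝓣 : Finset (Finset X)} {T i : ℕ}
    (hξ : ∀ y, ξ y ≠ 0 → y ∈ A) (hζ : ∀ y, ζ y ≠ 0 → y ∈ A)
    (h : ∀ y ∈ ball Lk A 𝓣 T, ξ y = ζ y) (hi : i ≤ T) :
    Clean Lk 𝓣 ξ i ↔ Clean Lk 𝓣 ζ i := by
  refine forall_congr' fun M => forall_congr' fun hM => not_congr ?_
  by_cases hMA : M ⊆ A
  · exact forall_congr' fun v => forall_congr' fun hv =>
      mem_acc_local hξ hζ h (q := 0) (by omega) (subset_ball_zero hM hMA hv)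
  · have key : ∀ θ : X → ℕ, (∀ y, θ y ≠ 0 → y ∈ A) → ¬ M ⊆ acc Lk θ i := by
      intro θ hθ hs
      refine hMA fun y hy => hθ y ?_
      have := label_of_mem_acc (hs hy)
      omega
    exact iff_of_false (key ξ hξ) (key ζ hζ)

end Acceptance

section Independence

variable {X Λ : Type*} [Fintype X] [DecidableEq X] [Fintype Λ] [DecidableEq Λ]

lemma ev_eq_sum_indicator (μ : X → Λ → ℝ) (u : (X → Λ) → X → Λ) (g : (X → Λ) → ℝ)
    (f : (X → Λ) → ℝ) :
    ev μ (fun ξ => g ξ * f (u ξ)) = ∑ ζ, f ζ * ev μ (fun ξ => g ξ * if u ξ = ζ then 1 else 0) := by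
  simp_rw [← ev_const_mul]
  rw [← ev_sum]
  congr 1
  funext ξ
  simp [mul_comm]

/-- The coordinate at `x` is independent of the others. -/
lemma ev_mul_update {μ : X → Λ → ℝ} (hμ : IsProb μ) (x : X) (l₀ : Λ) (g : Λ → ℝ)
    (f : (X → Λ) → ℝ) :
    ev μ (fun ξ => g (ξ x) * f (Function.update ξ x l₀)) =
      (∑ l, μ x l * g l) * ev μ (fun ξ => f (Function.update ξ x l₀)) := by
  have key : ∀ (g : Λ → ℝ) (ζ : X → Λ),
      ev μ (fun ξ => g (ξ x) * if Function.update ξ x l₀ = ζ then 1 else 0) =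
      (∑ l, μ x l * g l) * ((if ζ x = l₀ then 1 else 0) * ∏ y ∈ univ.erase x, μ y (ζ y)) := by
    intro g ζ
    have h1 : (fun ξ : X → Λ => g (ξ x) * if Function.update ξ x l₀ = ζ then (1 : ℝ) else 0) =
        fun ξ => ∏ y, (fun (y : X) (l : Λ) => if y = x then g l * (if ζ x = l₀ then 1 else 0)
          else if l = ζ y then 1 else 0) y (ξ y) := by
      funext ξ
      rw [← mul_prod_erase univ _ (mem_univ x)]
      simp only [if_true]
      rw [mul_assoc]
      congr 1
      have h2 : ∏ y ∈ univ.erase x, (if y = x then g (ξ y) * (if ζ x = l₀ then 1 else 0)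
          else if ξ y = ζ y then (1 : ℝ) else 0) =
          ∏ y ∈ univ.erase x, if ξ y = ζ y then (1 : ℝ) else 0 :=
        prod_congr rfl fun y hy => by rw [if_neg (ne_of_mem_erase hy)]
      rw [h2, prod_boole]
      by_cases hu : Function.update ξ x l₀ = ζ
      · rw [if_pos hu, if_pos (by rw [← hu]; simp), if_pos, mul_one]
        intro y hy
        rw [← hu, Function.update_of_ne (ne_of_mem_erase hy)]
      · rw [if_neg hu]
        by_cases h3 : ζ x = l₀
        · rw [if_pos h3, one_mul, if_neg]
          intro h4
          refine hu (funext fun y => ?_)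
          by_cases hy : y = x
          · subst hy
            simp [h3]
          · rw [Function.update_of_ne hy]
            exact h4 y (mem_erase.2 ⟨hy, mem_univ y⟩)
        · simp [h3]
    rw [h1, ev_prod μ (fun (y : X) (l : Λ) => if y = x then g l * (if ζ x = l₀ then 1 else 0)
          else if l = ζ y then 1 else 0), ← mul_prod_erase univ _ (mem_univ x)]
    simp only [if_true]
    rw [← mul_assoc]
    congr 1
    · rw [sum_mul]
      exact sum_congr rfl fun l _ => by ring
    · refine prod_congr rfl fun y hy => ?_
      simp [ne_of_mem_erase hy]
  have e1 := ev_eq_sum_indicator μ (fun ξ => Function.update ξ x l₀) (fun ξ => g (ξ x)) f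
  have e2 := ev_eq_sum_indicator μ (fun ξ => Function.update ξ x l₀) (fun _ => 1) f
  simp only [one_mul] at e2
  rw [e1, e2, mul_sum]
  refine sum_congr rfl fun ζ _ => ?_
  have k2 := key (fun _ => 1) ζ
  simp only [one_mul, mul_one, hμ.sum_one] at k2
  rw [key g ζ, k2]
  ring

/-- Conditioning on the label at `x` being `l₀` increases expectations by a bounded factor. -/
lemma ev_update_le {μ : X → Λ → ℝ} (hμ : IsProb μ) (x : X) (l₀ : Λ)
    {f : (X → Λ) → ℝ} (hf : ∀ ξ, 0 ≤ f ξ) :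
    μ x l₀ * ev μ (fun ξ => f (Function.update ξ x l₀)) ≤ ev μ f := by
  have h := ev_mul_update hμ x l₀ (fun l => if l = l₀ then 1 else 0) f
  simp only [mul_ite, mul_one, mul_zero, sum_ite_eq', mem_univ, if_true] at h
  rw [← h]
  refine ev_mono hμ fun ξ => ?_
  by_cases hx : ξ x = l₀
  · rw [if_pos hx, one_mul, ← hx, Function.update_eq_self]
  · rw [if_neg hx, zero_mul]
    exact hf ξ

end Independence

section ConflictSystem

variable {X R : Type*} [Fintype X] [DecidableEq X] [Fintype R] [DecidableEq R]

/-- A vertex set with adjacencies split into neighbourhoods `K ρ x` of size at most `D`, and a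
family `𝒞` of conflicts, all nearly linear up to the error `δ`. -/
structure ConflictSystem (K : R → X → Finset X) (𝒞 : Finset (Finset X)) (J : ℕ) (D δ C : ℝ) :
    Prop where
  one_le_delta_mul : 1 ≤ δ * D
  delta_pos : 0 < δ
  one_le_C : 1 ≤ C
  two_le_J : 2 ≤ J
  irrefl : ∀ ρ x, x ∉ K ρ x
  symm : ∀ ρ x y, y ∈ K ρ x → ∃ ρ', x ∈ K ρ' y
  degree : ∀ ρ x, ((K ρ x).card : ℝ) ≤ D
  inter : ∀ ρ ρ' x, ρ ≠ ρ' → ((K ρ x ∩ K ρ' x).card : ℝ) ≤ C * δ * D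
  common : ∀ ρ x u, u ≠ x → u ∉ K ρ x →
    (((K ρ x).filter fun v => ∃ ρ', v ∈ K ρ' u).card : ℝ) ≤ C * δ * D
  three_le : ∀ L ∈ 𝒞, 3 ≤ L.card
  card_le : ∀ L ∈ 𝒞, L.card ≤ J
  conflict_degree : ∀ x j, ((𝒞.filter fun L => L.card = j ∧ x ∈ L).card : ℝ) ≤ C * D ^ (j - 1)
  conflict_codegree : ∀ (W : Finset X) j, 2 ≤ W.card → W.card < j →
    ((𝒞.filter fun L => L.card = j ∧ W ⊆ L).card : ℝ) ≤ C * δ * D ^ (j - W.card)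
  completions : ∀ M : Finset X, (∀ ρ, ∀ x ∈ M, ∀ y ∈ M, y ∉ K ρ x) →
    ∑ x, ((𝒞.filter fun S => x ∈ S ∧ S.erase x ⊆ M).card : ℝ) ≤ C * Fintype.card X

/-- Adjacent pairs together with the conflicts. -/
def links (K : R → X → Finset X) (𝒞 : Finset (Finset X)) : Finset (Finset X) :=
  𝒞 ∪ (univ.filter fun p : X × X => ∃ ρ, p.1 ∈ K ρ p.2).image fun p => {p.1, p.2}

variable {K : R → X → Finset X} {𝒞 : Finset (Finset X)} {J : ℕ} {D δ C P : ℝ}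

lemma mem_links {L : Finset X} :
    L ∈ links K 𝒞 ↔ L ∈ 𝒞 ∨ ∃ x y ρ, y ∈ K ρ x ∧ L = {y, x} := by
  simp only [links, mem_union, mem_image, mem_filter, mem_univ, true_and, Prod.exists]
  refine or_congr Iff.rfl ⟨?_, ?_⟩
  · rintro ⟨a, b, ⟨ρ, h⟩, rfl⟩
    exact ⟨b, a, ρ, h, rfl⟩
  · rintro ⟨x, y, ρ, h, rfl⟩
    exact ⟨y, x, ⟨ρ, h⟩, rfl⟩

namespace ConflictSystem

lemma D_pos (h : ConflictSystem K 𝒞 J D δ C) : 0 < D := by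
  have h1 := h.one_le_delta_mul
  have h2 := h.delta_pos
  by_contra hD
  nlinarith

lemma pair_mem (h : ConflictSystem K 𝒞 J D δ C) {L : Finset X} (hL : L ∈ links K 𝒞)
    (hn : L ∉ 𝒞) {u : X} (hu : u ∈ L) : ∃ ρ, ∃ v ∈ K ρ u, L = {u, v} := by
  rcases mem_links.1 hL with hL | ⟨x, y, ρ, hy, rfl⟩
  · exact absurd hL hn
  · simp only [mem_insert, mem_singleton] at hu
    rcases hu with rfl | rfl
    · obtain ⟨ρ', h'⟩ := h.symm ρ x u hy
      exact ⟨ρ', x, h', rfl⟩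
    · exact ⟨ρ, y, hy, by rw [pair_comm]⟩

lemma pair_card (h : ConflictSystem K 𝒞 J D δ C) {ρ : R} {u v : X} (hv : v ∈ K ρ u) :
    ({u, v} : Finset X).card = 2 :=
  card_pair fun e => h.irrefl ρ u (by rwa [← e] at hv)

lemma two_le (h : ConflictSystem K 𝒞 J D δ C) {L : Finset X} (hL : L ∈ links K 𝒞) :
    2 ≤ L.card := by
  rcases mem_links.1 hL with hL | ⟨x, y, ρ, hy, rfl⟩
  · have := h.three_le L hL
    omega
  · rw [pair_comm, h.pair_card hy]

lemma mem_of_three_le (h : ConflictSystem K 𝒞 J D δ C) {L : Finset X} (hL : L ∈ links K 𝒞)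
    (h3 : 3 ≤ L.card) : L ∈ 𝒞 := by
  rcases mem_links.1 hL with hL | ⟨x, y, ρ, hy, rfl⟩
  · exact hL
  · rw [pair_comm, h.pair_card hy] at h3
    omega

/-- The `P / D`-weight of a family with bounded numbers of members of each size. -/
lemma sum_pow_le (h : ConflictSystem K 𝒞 J D δ C) (hP : 1 ≤ P) {𝓛 : Finset (Finset X)}
    (h𝓛 : 𝓛 ⊆ 𝒞) {m : ℕ} (hm : ∀ L ∈ 𝓛, m < L.card) {c : ℝ} (hc : 0 ≤ c)
    (hcount : ∀ j, m < j → ((𝓛.filter fun L => L.card = j).card : ℝ) ≤ c * D ^ (j - m)) :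
    ∑ L ∈ 𝓛, (P / D) ^ (L.card - m) ≤ (J + 1) * (c * P ^ J) := by
  have hD := h.D_pos
  have hP0 : 0 ≤ P := zero_le_one.trans hP
  rw [← sum_fiberwise_of_maps_to (s := 𝓛) (t := range (J + 1)) (g := card)
    fun L hL => mem_range.2 (Nat.lt_succ_of_le (h.card_le L (h𝓛 hL)))]
  refine (sum_le_card_nsmul _ _ (c * P ^ J) fun j hj => ?_).trans (by simp)
  have h1 : ∑ L ∈ 𝓛 with L.card = j, (P / D) ^ (L.card - m) =
      ∑ L ∈ 𝓛 with L.card = j, (P / D) ^ (j - m) :=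
    sum_congr rfl fun L hL => by rw [(mem_filter.1 hL).2]
  rw [h1, sum_const, nsmul_eq_mul]
  by_cases hmj : m < j
  · calc _ ≤ c * D ^ (j - m) * (P / D) ^ (j - m) :=
          mul_le_mul_of_nonneg_right (hcount j hmj) (by positivity)
      _ = c * P ^ (j - m) := by
          rw [div_pow]
          field_simp
      _ ≤ c * P ^ J := by
          refine mul_le_mul_of_nonneg_left (pow_le_pow_right₀ hP ?_) hc
          have := mem_range.1 hj
          omega
  · have : 𝓛.filter (fun L => L.card = j) = ∅ := by
      refine filter_eq_empty_iff.2 fun L hL e => hmj ?_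
      rw [← e]
      exact hm L hL
    rw [this]
    simp
    positivity

/-- A common bound for all the constants at edge weight `P / D`. -/
def linkConst (r J : ℕ) (C P : ℝ) : ℝ := r * P + (J + 1) * (C * P ^ J) + C * P + 1

lemma one_le_linkConst (h : ConflictSystem K 𝒞 J D δ C) (hP : 1 ≤ P) (r : ℕ) :
    1 ≤ linkConst r J C P := by
  have := h.one_le_C
  unfold linkConst
  have : 0 ≤ r * P + (J + 1) * (C * P ^ J) + C * P := by positivity
  linarith

lemma sum_conflicts_le (h : ConflictSystem K 𝒞 J D δ C) (hP : 1 ≤ P) (x : X) :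
    ∑ L ∈ 𝒞 with x ∈ L, (P / D) ^ (L.card - 1) ≤ (J + 1) * (C * P ^ J) := by
  refine h.sum_pow_le hP (filter_subset _ _) (m := 1) (fun L hL => ?_)
    (zero_le_one.trans h.one_le_C) fun j _ => ?_
  · have := h.three_le L (mem_filter.1 hL).1
    omega
  · rw [filter_filter]
    refine le_trans (le_of_eq ?_) (h.conflict_degree x j)
    congr 2
    ext L
    simp [and_comm]

lemma codegree_conflicts (h : ConflictSystem K 𝒞 J D δ C) (hP : 1 ≤ P) :
    CodegreeLE 𝒞 (P / D) ((J + 1) * (C * P ^ J) * δ) := by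
  intro W hW
  have hδ := h.delta_pos.le
  have hC := zero_le_one.trans h.one_le_C
  refine (h.sum_pow_le hP (filter_subset _ _) (m := W.card) (c := C * δ) (fun L hL => ?_)
    (by positivity) fun j hj => ?_).trans (le_of_eq (by ring))
  · exact card_lt_card (mem_filter.1 hL).2
  · rw [filter_filter]
    refine le_trans ?_ (h.conflict_codegree W j hW hj)
    norm_cast
    refine card_le_card fun L hL => ?_
    simp only [mem_filter] at hL ⊢
    exact ⟨hL.1, hL.2.2, hL.2.1.subset⟩

lemma codegree_links (h : ConflictSystem K 𝒞 J D δ C) (hP : 1 ≤ P) :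
    CodegreeLE (links K 𝒞) (P / D) ((J + 1) * (C * P ^ J) * δ) := by
  intro W hW
  refine le_trans (le_of_eq (sum_congr ?_ fun _ _ => rfl)) (h.codegree_conflicts hP W hW)
  ext L
  simp only [mem_filter]
  refine and_congr_left fun hs => ⟨fun hL => h.mem_of_three_le hL ?_, fun hL =>
    mem_links.2 (Or.inl hL)⟩
  have := card_lt_card hs
  omega

lemma degree_links (h : ConflictSystem K 𝒞 J D δ C) (hP : 1 ≤ P) (u : X) :
    ∑ L ∈ links K 𝒞 with u ∈ L, (P / D) ^ (L.card - 1) ≤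
      (J + 1) * (C * P ^ J) + Fintype.card R * P := by
  have hD := h.D_pos
  have hP0 : 0 ≤ P := zero_le_one.trans hP
  have hsub : (links K 𝒞).filter (u ∈ ·) ⊆ 𝒞.filter (u ∈ ·) ∪
      (univ : Finset R).biUnion fun ρ => (K ρ u).image fun v => {u, v} := by
    intro L hL
    rw [mem_filter] at hL
    by_cases hn : L ∈ 𝒞
    · exact mem_union_left _ (mem_filter.2 ⟨hn, hL.2⟩)
    · obtain ⟨ρ, v, hv, rfl⟩ := h.pair_mem hL.1 hn hL.2
      refine mem_union_right _ (mem_biUnion.2 ⟨ρ, mem_univ _, mem_image.2 ⟨v, hv, rfl⟩⟩)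
  have hnn : ∀ L : Finset X, 0 ≤ (P / D) ^ (L.card - 1) := fun L => by positivity
  refine (sum_le_sum_of_subset_of_nonneg hsub fun L _ _ => hnn L).trans ?_
  have hun : ∀ s t : Finset (Finset X), ∑ L ∈ s ∪ t, (P / D) ^ (L.card - 1) ≤
      ∑ L ∈ s, (P / D) ^ (L.card - 1) + ∑ L ∈ t, (P / D) ^ (L.card - 1) := by
    intro s t
    rw [← sum_union_inter]
    have := sum_nonneg fun L (_ : L ∈ s ∩ t) => hnn L
    linarith
  refine (hun _ _).trans (add_le_add (h.sum_conflicts_le hP u) ?_)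
  have hcard : ∀ L ∈ (univ : Finset R).biUnion fun ρ => (K ρ u).image fun v => ({u, v} : Finset X),
      (P / D) ^ (L.card - 1) = P / D := by
    intro L hL
    simp only [mem_biUnion, mem_image, mem_univ, true_and] at hL
    obtain ⟨ρ, v, hv, rfl⟩ := hL
    rw [h.pair_card hv]
    simp
  rw [sum_congr rfl hcard, sum_const, nsmul_eq_mul]
  have hc : (((univ : Finset R).biUnion fun ρ => (K ρ u).image fun v =>
      ({u, v} : Finset X)).card : ℝ) ≤ Fintype.card R * D := by
    refine le_trans (Nat.cast_le.2 card_biUnion_le) ?_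
    push_cast
    refine (sum_le_card_nsmul _ _ D fun ρ _ => ?_).trans (by simp)
    exact le_trans (Nat.cast_le.2 card_image_le) (h.degree ρ u)
  calc _ ≤ Fintype.card R * D * (P / D) := mul_le_mul_of_nonneg_right hc (by positivity)
    _ = _ := by field_simp

lemma linkBounds_of (h : ConflictSystem K 𝒞 J D δ C) (hδ : δ ≤ 1) (hP : 1 ≤ P) (x : X)
    {N : Finset X} (hN : (N.card : ℝ) ≤ D)
    (hcommon : ∀ u, u ≠ x → u ∉ N →
      ((N.filter fun v => ∃ ρ', v ∈ K ρ' u).card : ℝ) ≤ C * δ * D) :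
    LinkBounds (links K 𝒞) x N J (P / D) δ (linkConst (Fintype.card R) J C P) := by
  have hD := h.D_pos
  have hP0 : 0 ≤ P := zero_le_one.trans hP
  have hC := h.one_le_C
  have hδ0 := h.delta_pos.le
  have hm : 0 ≤ ((J : ℝ) + 1) * (C * P ^ J) := by positivity
  refine ⟨hδ0, hδ, h.one_le_linkConst hP _, fun L hL => ?_,
    fun u => (h.degree_links hP u).trans ?_, fun W hW => (h.codegree_links hP W hW).trans ?_, ?_,
    fun u hu huN => ?_⟩
  · by_cases hn : L ∈ 𝒞
    · exact h.card_le L hn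
    · have := mt (h.mem_of_three_le hL) hn
      have := h.two_le_J
      omega
  · unfold linkConst
    nlinarith
  · refine mul_le_mul_of_nonneg_right ?_ hδ0
    unfold linkConst
    have : 0 ≤ (Fintype.card R : ℝ) * P + C * P := by positivity
    linarith
  · calc P / D * N.card ≤ P / D * D := mul_le_mul_of_nonneg_left hN (by positivity)
      _ = P := by field_simp
      _ ≤ _ := by
        unfold linkConst
        have : 0 ≤ (Fintype.card R : ℝ) * P := by positivity
        nlinarith
  · have h1 : (N.filter fun v => ({u, v} : Finset X) ∈ links K 𝒞) ⊆
        N.filter fun v => ∃ ρ', v ∈ K ρ' u := by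
      intro v hv
      rw [mem_filter] at hv ⊢
      refine ⟨hv.1, ?_⟩
      have hn : ({u, v} : Finset X) ∉ 𝒞 := fun hm => by
        have := h.three_le _ hm
        have := card_le_two (a := u) (b := v)
        omega
      obtain ⟨ρ, v', hv', e⟩ := h.pair_mem hv.2 hn (mem_insert_self u _)
      have : v' = v := by
        have h2 : v' ∈ ({u, v} : Finset X) := by rw [e]; simp
        simp only [mem_insert, mem_singleton] at h2
        rcases h2 with rfl | h2
        · exact absurd hv' (h.irrefl ρ _)
        · exact h2
      exact ⟨ρ, this ▸ hv'⟩
    calc _ ≤ P / D * (C * δ * D) := by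
          refine mul_le_mul_of_nonneg_left (le_trans ?_ (hcommon u hu huN)) (by positivity)
          exact_mod_cast card_le_card h1
      _ = C * P * δ := by field_simp
      _ ≤ _ := by
        refine mul_le_mul_of_nonneg_right ?_ hδ0
        unfold linkConst
        have : 0 ≤ (Fintype.card R : ℝ) * P := by positivity
        linarith

end ConflictSystem

end ConflictSystem

section Targets

variable {X R : Type*} [Fintype X] [DecidableEq X] [Fintype R] [DecidableEq R]

/-- The sets whose acceptance makes `x` unavailable, grouped by neighbourhoods and by a
labelling `γ` of the remainders of the conflicts. -/
def target (K : R → X → Finset X) (𝒞 : Finset (Finset X)) (x : X) {m : ℕ}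
    (γ : Finset X → Fin m) : R ⊕ Fin m → Finset (Finset X)
  | Sum.inl ρ => (K ρ x).image singleton
  | Sum.inr g => ((𝒞.filter (x ∈ ·)).image (·.erase x)).filter (γ · = g)

/-- The neighbourhood belonging to a target index. -/
def targetNbhd (K : R → X → Finset X) (x : X) {m : ℕ} : R ⊕ Fin m → Finset X
  | Sum.inl ρ => K ρ x
  | Sum.inr _ => ∅

variable {K : R → X → Finset X} {𝒞 : Finset (Finset X)} {J : ℕ} {D δ C P : ℝ}
  {x : X} {m : ℕ} {γ : Finset X → Fin m}

namespace ConflictSystem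

lemma mem_target_inr (g : Fin m) {M : Finset X} (hM : M ∈ target K 𝒞 x γ (Sum.inr g)) :
    x ∉ M ∧ insert x M ∈ 𝒞 ∧ γ M = g := by
  simp only [target, mem_filter, mem_image] at hM
  obtain ⟨⟨S, ⟨hS, hx⟩, rfl⟩, hg⟩ := hM
  exact ⟨notMem_erase x S, by rwa [insert_erase hx], hg⟩

lemma exists_target_of_link (h : ConflictSystem K 𝒞 J D δ C) {L : Finset X}
    (hL : L ∈ links K 𝒞) (hx : x ∈ L) (γ : Finset X → Fin m) :
    ∃ τ, L.erase x ∈ target K 𝒞 x γ τ := by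
  by_cases hn : L ∈ 𝒞
  · refine ⟨Sum.inr (γ (L.erase x)), ?_⟩
    simp only [target, mem_filter, mem_image, and_true]
    exact ⟨L, ⟨hn, hx⟩, rfl⟩
  · obtain ⟨ρ, v, hv, rfl⟩ := h.pair_mem hL hn hx
    refine ⟨Sum.inl ρ, mem_image.2 ⟨v, hv, ?_⟩⟩
    have : v ≠ x := fun e => h.irrefl ρ x (e ▸ hv)
    ext y
    simp only [mem_singleton, mem_erase, mem_insert]
    constructor
    · rintro rfl
      exact ⟨this, Or.inr rfl⟩
    · rintro ⟨h1, h2 | h2⟩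
      exacts [absurd h2 h1, h2]

lemma linkBounds (h : ConflictSystem K 𝒞 J D δ C) (hδ : δ ≤ 1) (hP : 1 ≤ P) (x : X)
    (τ : R ⊕ Fin m) : LinkBounds (links K 𝒞) x (targetNbhd K x τ) J (P / D) δ
      (linkConst (Fintype.card R) J C P) := by
  cases τ with
  | inl ρ => exact h.linkBounds_of hδ hP x (h.degree ρ x) (h.common ρ x)
  | inr g =>
    have := h.D_pos.le
    have := h.one_le_C
    have := h.delta_pos
    exact h.linkBounds_of hδ hP x (by simpa [targetNbhd]) fun u _ _ => by
      simp [targetNbhd]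
      positivity

/-- Summing over the remainders of conflicts at `x`. -/
lemma sum_target_inr_le (hD : 0 ≤ P / D) (g : Fin m) (Pr : Finset X → Prop)
    [DecidablePred Pr] (W : Finset X) (f : Finset X → ℕ)
    (hPr : ∀ M ∈ target K 𝒞 x γ (Sum.inr g), Pr M → W ⊆ insert x M)
    (hf : ∀ M ∈ target K 𝒞 x γ (Sum.inr g), Pr M → f M = (insert x M).card - W.card)
    (hne : ∀ M ∈ target K 𝒞 x γ (Sum.inr g), Pr M → W ≠ insert x M) :
    ∑ M ∈ target K 𝒞 x γ (Sum.inr g) with Pr M, (P / D) ^ f M ≤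
      ∑ L ∈ 𝒞 with W ⊂ L, (P / D) ^ (L.card - W.card) := by
  have hinj : Set.InjOn (insert x) ((target K 𝒞 x γ (Sum.inr g)).filter Pr : Set (Finset X)) := by
    intro M hM M' hM' e
    have h1 := (mem_target_inr g (mem_filter.1 (mem_coe.1 hM)).1).1
    have h2 := (mem_target_inr g (mem_filter.1 (mem_coe.1 hM')).1).1
    rw [← erase_insert h1, ← erase_insert h2]
    exact congrArg (fun S => erase S x) e
  rw [sum_congr (g := fun M => (P / D) ^ ((insert x M).card - W.card)) rfl fun M hM => by
    rw [hf M (mem_filter.1 hM).1 (mem_filter.1 hM).2]]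
  rw [← sum_image (f := fun L => (P / D) ^ (L.card - W.card)) hinj]
  refine sum_le_sum_of_subset_of_nonneg ?_ fun L _ _ => pow_nonneg hD _
  intro L hL
  obtain ⟨M, hM, rfl⟩ := mem_image.1 hL
  rw [mem_filter] at hM ⊢
  exact ⟨(mem_target_inr g hM.1).2.1, (hPr M hM.1 hM.2).ssubset_of_ne (hne M hM.1 hM.2)⟩

lemma mul_le_linkConst (h : ConflictSystem K 𝒞 J D δ C) (hP : 1 ≤ P) :
    C * P ≤ linkConst (Fintype.card R) J C P := by
  have := h.one_le_C
  have : (0 : ℝ) ≤ Fintype.card R * P + (J + 1) * (C * P ^ J) + 1 := by positivity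
  unfold linkConst
  linarith

lemma mul_pow_le_linkConst (h : ConflictSystem K 𝒞 J D δ C) (hP : 1 ≤ P) :
    (J + 1) * (C * P ^ J) ≤ linkConst (Fintype.card R) J C P := by
  have := h.one_le_C
  have : (0 : ℝ) ≤ Fintype.card R * P + C * P + 1 := by positivity
  unfold linkConst
  linarith

lemma target_sum_mem (h : ConflictSystem K 𝒞 J D δ C) (hP : 1 ≤ P) (τ : R ⊕ Fin m) (v : X) :
    ∑ M ∈ target K 𝒞 x γ τ with v ∈ M, (P / D) ^ (M.card - 1) ≤
      hit (targetNbhd K x τ) (linkConst (Fintype.card R) J C P) δ v := by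
  have hD := h.D_pos
  have hQ := zero_le_one.trans (h.one_le_linkConst hP (Fintype.card R))
  have hδ := h.delta_pos.le
  have hPD : 0 ≤ P / D := by positivity
  cases τ with
  | inl ρ =>
    have e : (target K 𝒞 x γ (Sum.inl ρ)).filter (v ∈ ·) = if v ∈ K ρ x then {{v}} else ∅ := by
      ext M
      simp only [target, mem_filter, mem_image]
      constructor
      · rintro ⟨⟨y, hy, rfl⟩, hv⟩
        rw [mem_singleton] at hv
        simp [hv, hy]
      · intro hM
        split_ifs at hM with hv
        · rw [mem_singleton] at hM
          exact ⟨⟨v, hv, hM.symm⟩, by simp [hM]⟩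
        · simp at hM
    rw [e, hit, targetNbhd]
    have := mul_nonneg hQ hδ
    split_ifs <;> simp <;> linarith
  | inr g =>
    have e : hit (targetNbhd K x (Sum.inr g : R ⊕ Fin m)) (linkConst (Fintype.card R) J C P) δ v =
      linkConst (Fintype.card R) J C P * δ := by simp [hit, targetNbhd]
    rw [e]
    by_cases hvx : v = x
    · have e2 : (target K 𝒞 x γ (Sum.inr g)).filter (v ∈ ·) = ∅ := by
        refine filter_eq_empty_iff.2 fun M hM hv => (mem_target_inr g hM).1 (hvx ▸ hv)
      rw [e2, sum_empty]
      positivity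
    · have h2 : ({x, v} : Finset X).card = 2 := card_pair (Ne.symm hvx)
      refine (sum_target_inr_le hPD g (v ∈ ·) {x, v} (fun M => M.card - 1) ?_ ?_ ?_).trans
        ((h.codegree_conflicts hP _ h2.ge).trans
          (mul_le_mul_of_nonneg_right (h.mul_pow_le_linkConst hP) hδ))
      · intro M _ hv
        exact insert_subset_insert _ (singleton_subset_iff.2 hv)
      · intro M hM _
        rw [card_insert_of_notMem (mem_target_inr g hM).1, h2]
        omega
      · intro M hM _ e
        have := h.three_le _ (mem_target_inr g hM).2.1
        rw [← e, h2] at this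
        omega

lemma target_sum (h : ConflictSystem K 𝒞 J D δ C) (hP : 1 ≤ P) (τ : R ⊕ Fin m) :
    ∑ M ∈ target K 𝒞 x γ τ, (P / D) ^ M.card ≤ linkConst (Fintype.card R) J C P := by
  have hD := h.D_pos
  have hPD : 0 ≤ P / D := by positivity
  cases τ with
  | inl ρ =>
    simp only [target]
    rw [sum_image (by simp)]
    simp only [card_singleton, pow_one, sum_const, nsmul_eq_mul]
    have h1 : ((K ρ x).card : ℝ) * (P / D) ≤ D * (P / D) :=
      mul_le_mul_of_nonneg_right (h.degree ρ x) hPD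
    have h2 : D * (P / D) = P := by field_simp
    have h3 := h.mul_le_linkConst hP
    have h4 := h.one_le_C
    nlinarith
  | inr g =>
    have h1 := sum_target_inr_le (K := K) (𝒞 := 𝒞) (x := x) (γ := γ) hPD g (fun _ => True) {x} card
      (fun M _ _ => by simp)
      (fun M hM _ => by rw [card_insert_of_notMem (mem_target_inr g hM).1]; simp)
      (fun M hM _ e => by
        have := h.three_le _ (mem_target_inr g hM).2.1
        rw [← e, card_singleton] at this
        omega)
    rw [filter_true_of_mem fun _ _ => trivial] at h1
    refine h1.trans (le_trans ?_ ((h.sum_conflicts_le hP x).trans (h.mul_pow_le_linkConst hP)))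
    rw [card_singleton]
    refine sum_le_sum_of_subset_of_nonneg ?_ fun L _ _ => pow_nonneg hPD _
    intro L hL
    rw [mem_filter] at hL ⊢
    exact ⟨hL.1, hL.2.subset (mem_singleton_self x)⟩

lemma target_codegree (h : ConflictSystem K 𝒞 J D δ C) (hP : 1 ≤ P) (τ : R ⊕ Fin m) :
    CodegreeLE (target K 𝒞 x γ τ) (P / D) (linkConst (Fintype.card R) J C P * δ) := by
  have hD := h.D_pos
  have hPD : 0 ≤ P / D := by positivity
  have hQ := zero_le_one.trans (h.one_le_linkConst hP (Fintype.card R))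
  have hδ := h.delta_pos.le
  intro W hW
  cases τ with
  | inl ρ =>
    rw [filter_false_of_mem, sum_empty]
    · positivity
    · intro M hM hs
      simp only [target, mem_image] at hM
      obtain ⟨v, _, rfl⟩ := hM
      have := card_lt_card hs
      rw [card_singleton] at this
      omega
  | inr g =>
    by_cases hx : x ∈ W
    · rw [filter_false_of_mem, sum_empty]
      · positivity
      · intro M hM hs
        exact (mem_target_inr g hM).1 (hs.subset hx)
    · have hc : (insert x W).card = W.card + 1 := card_insert_of_notMem hx
      refine (sum_target_inr_le hPD g (W ⊂ ·) (insert x W) (fun M => M.card - W.card)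
        ?_ ?_ ?_).trans ((h.codegree_conflicts hP _ (by omega)).trans
          (mul_le_mul_of_nonneg_right (h.mul_pow_le_linkConst hP) hδ))
      · intro M _ hs
        exact insert_subset_insert _ hs.subset
      · intro M hM _
        rw [card_insert_of_notMem (mem_target_inr g hM).1, hc]
        omega
      · intro M hM hs e
        have := card_lt_card hs
        have h3 := card_insert_of_notMem (mem_target_inr g hM).1
        rw [← e] at h3
        omega

lemma target_card_le (h : ConflictSystem K 𝒞 J D δ C) (τ : R ⊕ Fin m) {M : Finset X}
    (hM : M ∈ target K 𝒞 x γ τ) : M.card ≤ J := by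
  cases τ with
  | inl ρ =>
    simp only [target, mem_image] at hM
    obtain ⟨v, _, rfl⟩ := hM
    have := h.two_le_J
    simp
    omega
  | inr g =>
    exact (card_le_card (subset_insert x M)).trans (h.card_le _ (mem_target_inr g hM).2.1)

lemma target_ne {τ τ' : R ⊕ Fin m} (hτ : τ ≠ τ') {M M' : Finset X}
    (hM : M ∈ target K 𝒞 x γ τ) (hM' : M' ∈ target K 𝒞 x γ τ') (h2 : 2 ≤ (M ∩ M').card) :
    M ≠ M' := by
  have key : ∀ ρ, ∀ S ∈ target K 𝒞 x γ (Sum.inl ρ), S.card = 1 := by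
    intro ρ S hS
    simp only [target, mem_image] at hS
    obtain ⟨v, _, rfl⟩ := hS
    simp
  have h3 := card_le_card (inter_subset_left (s₁ := M) (s₂ := M'))
  have h4 := card_le_card (inter_subset_right (s₁ := M) (s₂ := M'))
  cases τ with
  | inl ρ => have := key ρ M hM; omega
  | inr g =>
    cases τ' with
    | inl ρ => have := key ρ M' hM'; omega
    | inr g' =>
      rintro rfl
      exact hτ (congrArg Sum.inr ((mem_target_inr g hM).2.2.symm.trans (mem_target_inr g' hM').2.2))

lemma target_cross (h : ConflictSystem K 𝒞 J D δ C) (hP : 1 ≤ P) {τ τ' : R ⊕ Fin m}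
    (hτ : τ ≠ τ') :
    ∑ M ∈ target K 𝒞 x γ τ', (P / D) ^ M.card *
      ∑ v ∈ M, hit (targetNbhd K x τ) (linkConst (Fintype.card R) J C P) δ v ≤
        (J + 2) * linkConst (Fintype.card R) J C P ^ 2 * δ := by
  set Q := linkConst (Fintype.card R) J C P with hQdef
  have hD := h.D_pos
  have hPD : 0 ≤ P / D := by positivity
  have hQ1 : 1 ≤ Q := h.one_le_linkConst hP (Fintype.card R)
  have hδ := h.delta_pos.le
  have hC := h.one_le_C
  set N := targetNbhd K x τ
  set N' := targetNbhd K x τ'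
  have hcard : ∀ τ : R ⊕ Fin m, ((targetNbhd K x τ).card : ℝ) ≤ D := by
    rintro (ρ | g)
    · exact h.degree ρ x
    · simpa [targetNbhd] using hD.le
  have hinter : ((N ∩ N').card : ℝ) ≤ C * δ * D := by
    have h0 : (0 : ℝ) ≤ C * δ * D := by positivity
    rcases τ with ρ | g <;> rcases τ' with ρ' | g'
    · exact h.inter ρ ρ' x fun e => hτ (by rw [e])
    all_goals simpa [N, N', targetNbhd] using h0
  have h1 : ∀ M ∈ target K 𝒞 x γ τ', (P / D) ^ M.card * ∑ v ∈ M, hit N Q δ v ≤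
      (P / D) ^ M.card * (J * (Q * δ)) +
        ∑ v ∈ N, if v ∈ M then P / D * (P / D) ^ (M.card - 1) else 0 := by
    intro M hM
    simp only [hit, sum_add_distrib, mul_add, sum_const, nsmul_eq_mul]
    rw [add_comm]
    refine add_le_add (mul_le_mul_of_nonneg_left (mul_le_mul_of_nonneg_right ?_
      (by positivity)) (pow_nonneg hPD _)) (le_of_eq ?_)
    · exact_mod_cast h.target_card_le τ' hM
    · rw [mul_sum]
      simp only [mul_ite, mul_one, mul_zero]
      rw [← sum_filter, ← sum_filter]
      refine sum_congr ?_ fun v hv => ?_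
      · ext v
        simp [and_comm]
      · have : 0 < M.card := card_pos.2 ⟨v, (mem_filter.1 hv).2⟩
        rw [← pow_succ', Nat.sub_add_cancel this]
  refine (sum_le_sum h1).trans ?_
  rw [sum_add_distrib, ← sum_mul, sum_comm]
  have h2 := mul_le_mul_of_nonneg_right (h.target_sum (x := x) (γ := γ) hP τ')
    (show 0 ≤ (J : ℝ) * (Q * δ) by positivity)
  have h3 : ∑ v ∈ N, ∑ M ∈ target K 𝒞 x γ τ', (if v ∈ M then P / D * (P / D) ^ (M.card - 1) else 0)
      ≤ ∑ v ∈ N, P / D * hit N' Q δ v := by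
    refine sum_le_sum fun v _ => ?_
    rw [← sum_filter, ← mul_sum]
    exact mul_le_mul_of_nonneg_left (h.target_sum_mem hP τ' v) hPD
  have h4 : ∑ v ∈ N, P / D * hit N' Q δ v = P / D * (N ∩ N').card + P / D * N.card * (Q * δ) := by
    simp only [hit, mul_add, sum_add_distrib, sum_const, nsmul_eq_mul, ← mul_sum]
    rw [← sum_filter, filter_mem_eq_inter]
    simp
    ring
  have h5 : P / D * (N ∩ N').card ≤ C * P * δ := by
    calc _ ≤ P / D * (C * δ * D) := mul_le_mul_of_nonneg_left hinter hPD
      _ = _ := by field_simp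
  have h6 : P / D * N.card ≤ P := by
    calc _ ≤ P / D * D := mul_le_mul_of_nonneg_left (hcard τ) hPD
      _ = _ := by field_simp
  have h7 : C * P ≤ Q := h.mul_le_linkConst hP
  have h8 : C * P * δ ≤ Q * Q * δ := by
    refine mul_le_mul_of_nonneg_right (h7.trans ?_) hδ
    nlinarith
  have h9 : P / D * N.card * (Q * δ) ≤ Q * (Q * δ) := by
    refine mul_le_mul_of_nonneg_right (h6.trans (le_trans ?_ h7)) (by positivity)
    nlinarith
  nlinarith

/-- The constant in the connection probability of two targets. -/
noncomputable def targetConst (r J : ℕ) (C P : ℝ) (T : ℕ) : ℝ :=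
  connConst J (linkConst r J C P) ((J + 2) * linkConst r J C P ^ 2) T

lemma pr_targets_connected (h : ConflictSystem K 𝒞 J D δ C) (hδ : δ ≤ 1) (hP : 1 ≤ P)
    {Ω : Type*} [Fintype Ω] {w : Ω → ℝ} {A : Ω → Finset X} (hA : SparseLaw w A (P / D))
    (hxA : ∀ ω, x ∉ A ω) {τ τ' : R ⊕ Fin m} (hτ : τ ≠ τ') (T : ℕ) :
    pr w (fun ω => ¬ Disjoint (ball (links K 𝒞) (A ω) (target K 𝒞 x γ τ') T)
        (ball (links K 𝒞) (A ω) (target K 𝒞 x γ τ) T)) ≤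
      targetConst (Fintype.card R) J C P T * δ :=
  pr_connected_le hA hxA (h.linkBounds hδ hP x τ) (h.target_sum_mem hP τ)
    (fun _ hM => h.target_card_le τ hM) (fun _ hM => h.target_card_le τ' hM) (h.target_sum hP τ)
    (h.target_sum hP τ') (h.target_codegree hP τ) (h.target_codegree hP τ')
    (fun _ hM _ hM' h2 => target_ne hτ hM hM' h2) (h.target_cross hP hτ) T

end ConflictSystem

end Targets

/-- Distributing small weights greedily over `m` groups. -/
lemma exists_grouping {ι : Type*} [DecidableEq ι] (s : Finset ι) (a : ι → ℝ)
    (h1 : ∀ i ∈ s, a i ≤ 1 / 4) (h0 : ∀ i ∈ s, 0 ≤ a i) {m : ℕ} (hm : 0 < m)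
    (hs : ∑ i ∈ s, a i ≤ m / 4) :
    ∃ γ : ι → Fin m, ∀ g, ∑ i ∈ s with γ i = g, a i ≤ 1 / 2 := by
  induction s using Finset.induction_on with
  | empty => exact ⟨fun _ => ⟨0, hm⟩, fun g => by simp⟩
  | insert i s hi ih =>
    rw [sum_insert hi] at hs
    have hi0 := h0 i (mem_insert_self i s)
    have hs' : ∑ j ∈ s, a j ≤ m / 4 := by linarith
    obtain ⟨γ, hγ⟩ := ih (fun j hj => h1 j (mem_insert_of_mem hj))
      (fun j hj => h0 j (mem_insert_of_mem hj)) hs'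
    have hex : ∃ g ∈ (univ : Finset (Fin m)), ∑ j ∈ s with γ j = g, a j ≤ 1 / 4 := by
      refine exists_le_of_sum_le ⟨⟨0, hm⟩, mem_univ _⟩ ?_
      rw [sum_fiberwise]
      simp only [sum_const, card_univ, Fintype.card_fin, nsmul_eq_mul]
      linarith
    obtain ⟨g, -, hg⟩ := hex
    refine ⟨Function.update γ i g, fun g' => ?_⟩
    have e : ∀ g', s.filter (fun j => Function.update γ i g j = g') = s.filter (γ · = g') := by
      intro g'
      refine filter_congr fun j hj => ?_
      rw [Function.update_of_ne (ne_of_mem_of_not_mem hj hi)]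
    rw [filter_insert, e]
    simp only [Function.update_self]
    split_ifs with hgg
    · subst hgg
      rw [sum_insert (by simp [hi])]
      linarith [h1 i (mem_insert_self i s)]
    · exact hγ g'

section Availability

variable {X R : Type*} [Fintype X] [DecidableEq X] [Fintype R] [DecidableEq R]
variable {K : R → X → Finset X} {𝒞 : Finset (Finset X)} {J : ℕ} {D δ C P : ℝ}
  {x : X} {m T : ℕ} {γ : Finset X → Fin m}

/-- The labels with the label at `x` removed. -/
def lab (x : X) (ξ : X → Fin (T + 1)) : X → ℕ := fun y => (Function.update ξ x 0 y : ℕ)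

open Classical in
/-- The indicator that no member of `𝓣` is accepted when `x` is unlabelled. -/
noncomputable def cleanInd (Lk 𝓣 : Finset (Finset X)) (x : X) (i : ℕ) (ξ : X → Fin (T + 1)) : ℝ :=
  if Clean Lk 𝓣 (lab x ξ) i then 1 else 0

lemma cleanInd_nonneg (Lk 𝓣 : Finset (Finset X)) (x : X) (i : ℕ) (ξ : X → Fin (T + 1)) :
    0 ≤ cleanInd Lk 𝓣 x i ξ := by
  unfold cleanInd
  split_ifs <;> norm_num

lemma cleanInd_le_one (Lk 𝓣 : Finset (Finset X)) (x : X) (i : ℕ) (ξ : X → Fin (T + 1)) :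
    cleanInd Lk 𝓣 x i ξ ≤ 1 := by
  unfold cleanInd
  split_ifs <;> norm_num

lemma cleanInd_local {Lk 𝓣 : Finset (Finset X)} {i : ℕ} (hi : i ≤ T) (A : Finset X)
    {ξ ζ : X → Fin (T + 1)} (hξ : ∀ y, ξ y ≠ 0 → y ∈ A) (hζ : ∀ y, ζ y ≠ 0 → y ∈ A)
    (h : ∀ y ∈ ball Lk (A.erase x) 𝓣 T, ξ y = ζ y) :
    cleanInd Lk 𝓣 x i ξ = cleanInd Lk 𝓣 x i ζ := by
  have key : ∀ θ : X → Fin (T + 1), (∀ y, θ y ≠ 0 → y ∈ A) → ∀ y, lab x θ y ≠ 0 → y ∈ A.erase x := by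
    intro θ hθ y hy
    by_cases hyx : y = x
    · subst hyx
      simp [lab] at hy
    · rw [lab, Function.update_of_ne hyx] at hy
      refine mem_erase.2 ⟨hyx, hθ y fun e => hy ?_⟩
      simp [e]
  have := clean_local (Lk := Lk) (𝓣 := 𝓣) (key ξ hξ) (key ζ hζ) (T := T) (i := i) (fun y hy => by
    by_cases hyx : y = x
    · subst hyx
      simp [lab]
    · simp only [lab, Function.update_of_ne hyx, h y hy]) hi
  unfold cleanInd
  by_cases hz : Clean Lk 𝓣 (lab x ζ) i
  · rw [if_pos (this.2 hz), if_pos hz]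
  · rw [if_neg fun q => hz (this.1 q), if_neg hz]

lemma connConst_nonneg {J : ℕ} {Q Q' : ℝ} (hQ : 1 ≤ Q) (hQ' : 0 ≤ Q') (T : ℕ) :
    0 ≤ connConst J Q Q' T := by
  have h1 : 0 ≤ ∑ q ∈ range (2 * T + 1), reachFactor J Q ^ q :=
    sum_nonneg fun q _ => pow_nonneg (reachFactor_nonneg J hQ) q
  unfold connConst
  positivity

namespace ConflictSystem

lemma targetConst_nonneg (h : ConflictSystem K 𝒞 J D δ C) (hP : 1 ≤ P) (T : ℕ) :
    0 ≤ targetConst (Fintype.card R) J C P T :=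
  connConst_nonneg (h.one_le_linkConst hP _) (by positivity) T

set_option maxHeartbeats 400000 in
/-- The events that the different targets are clean are nearly independent. -/
lemma prod_clean_ge (h : ConflictSystem K 𝒞 J D δ C) (hδ : δ ≤ 1) (hP : 1 ≤ P)
    {μ : X → Fin (T + 1) → ℝ} (hμ : IsProb μ) (hsp : ∀ y, 1 - μ y 0 ≤ P / D / 2)
    {i : ℕ} (hi : i ≤ T) (c : R ⊕ Fin m → ℝ) (hc0 : ∀ τ, 0 ≤ c τ) (hc1 : ∀ τ, c τ ≤ 1)
    (hc : ∀ τ, c τ ≤ ev μ (cleanInd (links K 𝒞) (target K 𝒞 x γ τ) x i))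
    (I : Finset (R ⊕ Fin m)) :
    ∏ τ ∈ I, c τ - (I.card : ℝ) ^ 2 * (targetConst (Fintype.card R) J C P T * δ) ≤
      ev μ (fun ξ => ∏ τ ∈ I, cleanInd (links K 𝒞) (target K 𝒞 x γ τ) x i ξ) := by
  classical
  have he : 0 ≤ targetConst (Fintype.card R) J C P T * δ :=
    mul_nonneg (h.targetConst_nonneg hP T) h.delta_pos.le
  set e := targetConst (Fintype.card R) J C P T * δ with hedef
  induction I using Finset.induction_on with
  | empty => simp [ev_const hμ]
  | insert τ I hτ ih =>
    simp only [prod_insert hτ]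
    set f := cleanInd (T := T) (links K 𝒞) (target K 𝒞 x γ τ) x i with hf
    set g := fun ξ : X → Fin (T + 1) =>
      ∏ τ ∈ I, cleanInd (links K 𝒞) (target K 𝒞 x γ τ) x i ξ with hg
    have hg0 : ∀ ξ, 0 ≤ g ξ := fun ξ => prod_nonneg fun τ _ => cleanInd_nonneg _ _ _ _ _
    have hg1 : ∀ ξ, g ξ ≤ 1 := fun ξ => prod_le_one (fun τ _ => cleanInd_nonneg _ _ _ _ _)
      fun τ _ => cleanInd_le_one _ _ _ _ _
    have hdec := ev_decouple hμ (f := f) (g := g) (cleanInd_nonneg _ _ _ _)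
      (cleanInd_le_one _ _ _ _) hg0 hg1
      (fun A => ball (links K 𝒞) (A.erase x) (target K 𝒞 x γ τ) T)
      (fun A => I.biUnion fun τ' => ball (links K 𝒞) (A.erase x) (target K 𝒞 x γ τ') T)
      (fun A ξ ζ hξ hζ hag => cleanInd_local hi A hξ hζ hag)
      (fun A ξ ζ hξ hζ hag => prod_congr rfl fun τ' hτ' => cleanInd_local hi A hξ hζ
        fun y hy => hag y (mem_biUnion.2 ⟨τ', hτ', hy⟩))
    set w : (X → Fin (T + 1) × Fin (T + 1)) → ℝ := fun η => ∏ y, pairLaw μ y (η y) with hw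
    set A : (X → Fin (T + 1) × Fin (T + 1)) → Finset X := fun η => (pairSupp η).erase x with hA
    have hD := h.D_pos
    have hw0 : ∀ η, 0 ≤ w η := fun η => prod_nonneg fun y _ => hμ.pair.nonneg _ _
    have hlaw : SparseLaw w A (P / D) := by
      refine ⟨hw0, by positivity, fun U => ?_⟩
      have h1 := ev_subset_pairSupp_le hμ hsp U
      rw [show 2 * (P / D / 2) = P / D by ring] at h1
      refine le_trans (pr_mono hw0 (P' := fun η => U ⊆ pairSupp η) fun η hη =>
        hη.trans (erase_subset _ _)) (le_trans (le_of_eq ?_) h1)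
      simp only [pr, ev, hw]
      exact sum_congr rfl fun η _ => by congr
    have herr : ev (pairLaw μ) (fun η => if Disjoint
        (ball (links K 𝒞) ((pairSupp η).erase x) (target K 𝒞 x γ τ) T)
        (I.biUnion fun τ' => ball (links K 𝒞) ((pairSupp η).erase x) (target K 𝒞 x γ τ') T)
        then 0 else 1) ≤ I.card * e := by
      have h1 : ev (pairLaw μ) (fun η => if Disjoint
        (ball (links K 𝒞) ((pairSupp η).erase x) (target K 𝒞 x γ τ) T)
        (I.biUnion fun τ' => ball (links K 𝒞) ((pairSupp η).erase x) (target K 𝒞 x γ τ') T)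
        then 0 else 1) ≤ pr w (fun η => ∃ τ' ∈ I, ¬ Disjoint
          (ball (links K 𝒞) (A η) (target K 𝒞 x γ τ) T)
          (ball (links K 𝒞) (A η) (target K 𝒞 x γ τ') T)) := by
        simp only [pr, ev, hw]
        refine sum_le_sum fun η _ => mul_le_mul_of_nonneg_left ?_ (hw0 η)
        by_cases hd : Disjoint (ball (links K 𝒞) ((pairSupp η).erase x) (target K 𝒞 x γ τ) T)
            (I.biUnion fun τ' => ball (links K 𝒞) ((pairSupp η).erase x) (target K 𝒞 x γ τ') T)
        · rw [if_pos hd]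
          split_ifs <;> norm_num
        · rw [if_neg hd, if_pos (by
            rw [disjoint_biUnion_right] at hd
            push Not at hd
            exact hd)]
      refine h1.trans ((pr_exists_le hw0 _ _).trans ?_)
      refine (sum_le_card_nsmul _ _ e fun τ' hτ' => ?_).trans (by rw [nsmul_eq_mul])
      exact h.pr_targets_connected hδ hP hlaw (fun η => notMem_erase x _)
        (ne_of_mem_of_not_mem hτ' hτ) T
    have hcard : ((insert τ I).card : ℝ) = I.card + 1 := by
      rw [card_insert_of_notMem hτ]
      push_cast
      ring
    have hevg : 0 ≤ ev μ g := ev_nonneg hμ hg0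
    have h3 : c τ * ev μ g ≤ ev μ f * ev μ g := mul_le_mul_of_nonneg_right (hc τ) hevg
    have h4 : c τ * (∏ τ ∈ I, c τ - (I.card : ℝ) ^ 2 * e) ≤ c τ * ev μ g :=
      mul_le_mul_of_nonneg_left ih (hc0 τ)
    have h5 : c τ * ((I.card : ℝ) ^ 2 * e) ≤ 1 * ((I.card : ℝ) ^ 2 * e) :=
      mul_le_mul_of_nonneg_right (hc1 τ) (by positivity)
    have h6 : (0 : ℝ) ≤ I.card * e := by positivity
    rw [hcard]
    nlinarith

end ConflictSystem

/-- The probability that `x` is available after round `i`, when `x` itself is unlabelled. -/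
noncomputable def availProb (Lk : Finset (Finset X)) (μ : X → Fin (T + 1) → ℝ) (i : ℕ)
    (x : X) : ℝ :=
  ev μ (cleanInd Lk ((Lk.filter (x ∈ ·)).image (·.erase x)) x i)

/-- The expected number of conflicts at `x` whose remainder has been accepted. -/
noncomputable def expComp (Lk 𝒞 : Finset (Finset X)) (μ : X → Fin (T + 1) → ℝ) (i : ℕ)
    (x : X) : ℝ :=
  ev μ fun ξ => ((𝒞.filter fun S => x ∈ S ∧ S.erase x ⊆ acc Lk (fun y => (ξ y : ℕ)) i).card : ℝ)

/-- The probability that all of `M` is accepted within `i` rounds. -/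
noncomputable def accProb (Lk : Finset (Finset X)) (μ : X → Fin (T + 1) → ℝ) (i : ℕ)
    (M : Finset X) : ℝ :=
  ev μ fun ξ => if M ⊆ acc Lk (fun y => (ξ y : ℕ)) i then 1 else 0

lemma expComp_eq (Lk 𝒞 : Finset (Finset X)) (μ : X → Fin (T + 1) → ℝ) (i : ℕ) (x : X) :
    expComp Lk 𝒞 μ i x = ∑ S ∈ 𝒞 with x ∈ S, accProb Lk μ i (S.erase x) := by
  simp only [expComp, accProb]
  rw [← ev_sum]
  congr 1
  funext ξ
  rw [sum_boole, filter_filter]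

lemma accProb_nonneg {Lk : Finset (Finset X)} {μ : X → Fin (T + 1) → ℝ} (hμ : IsProb μ) (i : ℕ)
    (M : Finset X) : 0 ≤ accProb Lk μ i M :=
  ev_nonneg hμ fun ξ => by split_ifs <;> norm_num

lemma accProb_anti {Lk : Finset (Finset X)} {μ : X → Fin (T + 1) → ℝ} (hμ : IsProb μ) (i : ℕ)
    {M M' : Finset X} (h : M ⊆ M') : accProb Lk μ i M' ≤ accProb Lk μ i M := by
  refine ev_mono hμ fun ξ => ?_
  by_cases hM : M' ⊆ acc Lk (fun y => (ξ y : ℕ)) i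
  · rw [if_pos hM, if_pos (h.trans hM)]
  · rw [if_neg hM]
    split_ifs <;> norm_num

/-- A family is clean with probability at least one minus the expected number of accepted
members. -/
lemma one_sub_sum_le_clean {Lk : Finset (Finset X)} {μ : X → Fin (T + 1) → ℝ} (hμ : IsProb μ)
    (x : X) (i : ℕ) (𝓣 : Finset (Finset X)) {b : ℝ} (hb : 0 ≤ b) (hx : 1 ≤ b * μ x 0) :
    1 - ∑ M ∈ 𝓣, b * accProb Lk μ i M ≤ ev μ (cleanInd Lk 𝓣 x i) := by
  have h1 : ∀ M, ev μ (fun ξ => if M ⊆ acc Lk (lab x ξ) i then (1 : ℝ) else 0) ≤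
      b * accProb Lk μ i M := by
    intro M
    have h2 := ev_update_le hμ x 0
      (f := fun ξ => if M ⊆ acc Lk (fun y => (ξ y : ℕ)) i then (1 : ℝ) else 0)
      (fun ξ => by split_ifs <;> norm_num)
    have h3 : 0 ≤ ev μ (fun ξ => if M ⊆ acc Lk (lab x ξ) i then (1 : ℝ) else 0) :=
      ev_nonneg hμ fun ξ => by split_ifs <;> norm_num
    have h4 := mul_le_mul_of_nonneg_left h2 hb
    have h5 := mul_le_mul_of_nonneg_right hx h3
    change ev μ (fun ξ => if M ⊆ acc Lk (lab x ξ) i then (1 : ℝ) else 0) ≤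
      b * ev μ fun ξ => if M ⊆ acc Lk (fun y => (ξ y : ℕ)) i then (1 : ℝ) else 0
    change b * (μ x 0 * ev μ (fun ξ => if M ⊆ acc Lk (lab x ξ) i then (1 : ℝ) else 0)) ≤ _ at h4
    linarith
  have h2 : ev μ (fun ξ => 1 - ∑ M ∈ 𝓣, if M ⊆ acc Lk (lab x ξ) i then (1 : ℝ) else 0) ≤
      ev μ (cleanInd Lk 𝓣 x i) := by
    refine ev_mono hμ fun ξ => ?_
    by_cases hc : Clean Lk 𝓣 (lab x ξ) i
    · rw [cleanInd, if_pos hc]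
      have : 0 ≤ ∑ M ∈ 𝓣, if M ⊆ acc Lk (lab x ξ) i then (1 : ℝ) else 0 :=
        sum_nonneg fun M _ => by split_ifs <;> norm_num
      linarith
    · rw [cleanInd, if_neg hc]
      simp only [Clean, not_forall, not_not] at hc
      obtain ⟨M, hM, hs⟩ := hc
      have := single_le_sum (f := fun M => if M ⊆ acc Lk (lab x ξ) i then (1 : ℝ) else 0)
        (fun M _ => by split_ifs <;> norm_num) hM
      simp only [hs, if_true] at this
      linarith
  rw [ev_sub, ev_const hμ, ev_sum] at h2
  have := sum_le_sum fun M (_ : M ∈ 𝓣) => h1 M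
  linarith

lemma ConflictSystem.availProb_ge (h : ConflictSystem K 𝒞 J D δ C) (hδ : δ ≤ 1) (hP : 1 ≤ P)
    {μ : X → Fin (T + 1) → ℝ} (hμ : IsProb μ) (hsp : ∀ y, 1 - μ y 0 ≤ P / D / 2)
    {i : ℕ} (hi : i ≤ T) {ε : ℝ} (hε : 0 < ε) (hε1 : ε < 1) (hPD : P / D ≤ ε) (hD8 : 8 ≤ D)
    (hacc : ∀ y, accProb (links K 𝒞) μ i {y} ≤ (1 - ε) / D)
    (hm : 0 < m) {C' : ℝ} (hcomp : expComp (links K 𝒞) 𝒞 μ i x ≤ C') (hmC : 8 * C' ≤ m) :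
    (ε / 2) ^ Fintype.card R * (1 / 2) ^ m -
        ((Fintype.card R : ℝ) + m) ^ 2 * (targetConst (Fintype.card R) J C P T * δ) ≤
      availProb (links K 𝒞) μ i x := by
  classical
  have hD := h.D_pos
  have hx0 : 1 - ε / 2 ≤ μ x 0 := by
    have := hsp x
    linarith
  set b := 1 / (1 - ε / 2) with hb
  have hb0 : 0 < b := by
    rw [hb]
    apply one_div_pos.2
    linarith
  have hbx : 1 ≤ b * μ x 0 := by
    rw [hb, one_div, ← div_eq_inv_mul, le_div_iff₀ (by linarith)]
    linarith
  have hb2 : b ≤ 2 := by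
    rw [hb, div_le_iff₀ (by linarith)]
    linarith
  set 𝓜 := (𝒞.filter (x ∈ ·)).image (·.erase x) with h𝓜
  have hinj : Set.InjOn (fun S : Finset X => S.erase x) (𝒞.filter (x ∈ ·) : Set (Finset X)) := by
    intro S hS S' hS' e
    rw [← insert_erase (mem_filter.1 (mem_coe.1 hS)).2, ← insert_erase (mem_filter.1 (mem_coe.1 hS')).2]
    exact congrArg (insert x) e
  obtain ⟨γ, hγ⟩ := exists_grouping 𝓜 (fun M => b * accProb (links K 𝒞) μ i M) (fun M hM => by
      obtain ⟨S, hS, rfl⟩ := mem_image.1 hM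
      rw [mem_filter] at hS
      have h3 := h.three_le S hS.1
      have h4 : 0 < (S.erase x).card := by
        rw [card_erase_of_mem hS.2]
        omega
      obtain ⟨y, hy⟩ := card_pos.1 h4
      have h5 := (accProb_anti (Lk := links K 𝒞) hμ i (singleton_subset_iff.2 hy)).trans (hacc y)
      have h6 : (1 - ε) / D ≤ 1 / 8 := by
        rw [div_le_iff₀ hD]
        linarith
      nlinarith) (fun M _ => mul_nonneg hb0.le (accProb_nonneg hμ i M)) hm (by
      rw [← mul_sum, h𝓜, sum_image hinj, ← expComp_eq]
      have h0 : 0 ≤ expComp (links K 𝒞) 𝒞 μ i x := ev_nonneg hμ fun ξ => Nat.cast_nonneg _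
      nlinarith)
  set c : R ⊕ Fin m → ℝ := Sum.elim (fun _ => ε / 2) (fun _ => 1 / 2) with hc
  have hcle : ∀ τ, c τ ≤ ev μ (cleanInd (links K 𝒞) (target K 𝒞 x γ τ) x i) := by
    rintro (ρ | g)
    · refine le_trans ?_ (one_sub_sum_le_clean hμ x i _ hb0.le hbx)
      simp only [hc, Sum.elim_inl, target]
      rw [sum_image (by simp)]
      have h1 : ∑ y ∈ K ρ x, b * accProb (links K 𝒞) μ i {y} ≤ (K ρ x).card * (b * ((1 - ε) / D)) := by
        rw [← nsmul_eq_mul]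
        exact sum_le_card_nsmul _ _ _ fun y _ => mul_le_mul_of_nonneg_left (hacc y) hb0.le
      have h2 : ((K ρ x).card : ℝ) * (b * ((1 - ε) / D)) ≤ D * (b * ((1 - ε) / D)) := by
        refine mul_le_mul_of_nonneg_right (h.degree ρ x) (mul_nonneg hb0.le (div_nonneg ?_ hD.le))
        linarith
      have h3 : D * (b * ((1 - ε) / D)) = b * (1 - ε) := by field_simp
      have h4 : b * (1 - ε) ≤ 1 - ε / 2 := by
        rw [hb, one_div, ← div_eq_inv_mul, div_le_iff₀ (by linarith)]
        nlinarith
      linarith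
    · refine le_trans ?_ (one_sub_sum_le_clean hμ x i _ hb0.le hbx)
      simp only [hc, Sum.elim_inr, target]
      linarith [hγ g]
  have hmain := h.prod_clean_ge hδ hP hμ hsp hi c
    (by rintro (ρ | g) <;> simp [hc]; linarith)
    (by rintro (ρ | g) <;> simp [hc] <;> linarith) hcle univ
  have hprod : ∏ τ, c τ = (ε / 2) ^ Fintype.card R * (1 / 2) ^ m := by
    rw [Fintype.prod_sum_type]
    simp [hc, div_pow]
  rw [hprod, card_univ, Fintype.card_sum, Fintype.card_fin] at hmain
  push_cast at hmain
  refine hmain.trans (ev_mono hμ fun ξ => ?_)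
  by_cases hcl : Clean (links K 𝒞) (((links K 𝒞).filter (x ∈ ·)).image (·.erase x)) (lab x ξ) i
  · rw [cleanInd, if_pos hcl]
    exact prod_le_one (fun τ _ => cleanInd_nonneg _ _ _ _ _) fun τ _ => cleanInd_le_one _ _ _ _ _
  · rw [cleanInd, if_neg hcl]
    simp only [Clean, not_forall, not_not, mem_image, mem_filter] at hcl
    obtain ⟨M, ⟨L, ⟨hL, hx⟩, rfl⟩, hs⟩ := hcl
    obtain ⟨τ, hτ⟩ := h.exists_target_of_link hL hx γ
    refine le_of_eq (prod_eq_zero (mem_univ τ) ?_)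
    rw [cleanInd, if_neg]
    exact fun hcl => hcl _ hτ hs

end Availability

section Stages

variable {X : Type*} [Fintype X] [DecidableEq X] {T : ℕ} {Lk 𝒞 : Finset (Finset X)}

/-- The law in which the label `i + 1` takes over the mass `s x` from the label `0`. -/
noncomputable def bump (μ : X → Fin (T + 1) → ℝ) (i : ℕ) (s : X → ℝ) : X → Fin (T + 1) → ℝ :=
  fun x l => if (l : ℕ) = i + 1 then s x else if l = 0 then μ x 0 - s x else μ x l

/-- Forget the label `i + 1`. -/
def dropLabel (i : ℕ) (l : Fin (T + 1)) : Fin (T + 1) := if (l : ℕ) = i + 1 then 0 else l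

variable {μ : X → Fin (T + 1) → ℝ} {i : ℕ} {s : X → ℝ}

lemma bump_top (hi : i < T) (x : X) : bump μ i s x ⟨i + 1, by omega⟩ = s x := by
  simp [bump]

lemma bump_zero (x : X) : bump μ i s x 0 = μ x 0 - s x := by
  simp [bump]

lemma mapLaw_bump (hi : i < T) (hμ : ∀ x (l : Fin (T + 1)), i < l → μ x l = 0) :
    mapLaw (fun _ => dropLabel i) (bump μ i s) = μ := by
  funext x l'
  simp only [mapLaw]
  by_cases h0 : l' = 0
  · subst h0
    have : (univ.filter fun l : Fin (T + 1) => dropLabel i l = 0) = {0, ⟨i + 1, by omega⟩} := by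
      ext l
      simp only [dropLabel, mem_filter, mem_univ, true_and, mem_insert, mem_singleton, Fin.ext_iff]
      split_ifs with h
      · simp [h]
      · simp [h]
    rw [this, sum_pair (by simp [Fin.ext_iff]), bump_top hi, bump_zero]
    ring
  · by_cases h1 : (l' : ℕ) = i + 1
    · have : (univ.filter fun l : Fin (T + 1) => dropLabel i l = l') = ∅ := by
        ext l
        rw [mem_filter]
        simp only [dropLabel, mem_univ, true_and, notMem_empty, iff_false]
        split_ifs with h
        · exact fun e => h0 e.symm
        · rintro rfl
          exact h h1
      rw [this, sum_empty, hμ x l' (by omega)]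
    · have : (univ.filter fun l : Fin (T + 1) => dropLabel i l = l') = {l'} := by
        ext l
        rw [mem_filter]
        simp only [dropLabel, mem_univ, true_and, mem_singleton]
        split_ifs with h
        · refine ⟨fun e => absurd e.symm h0, ?_⟩
          rintro rfl
          exact absurd h h1
        · rfl
      rw [this, sum_singleton, bump, if_neg h1, if_neg h0]

lemma bump_isProb (hμ : IsProb μ) (hi : i < T) (hμ0 : ∀ x (l : Fin (T + 1)), i < l → μ x l = 0)
    (hs0 : ∀ x, 0 ≤ s x) (hs1 : ∀ x, s x ≤ μ x 0) : IsProb (bump μ i s) where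
  nonneg x l := by
    unfold bump
    split_ifs
    · exact hs0 x
    · linarith [hs1 x]
    · exact hμ.nonneg x l
  sum_one x := by
    have h := hμ.sum_one x
    rw [← mapLaw_bump (s := s) hi hμ0] at h
    simp only [mapLaw] at h
    rwa [sum_fiberwise (s := (univ : Finset (Fin (T + 1)))) (g := dropLabel i)] at h

lemma ev_bump (hi : i < T) (hμ : ∀ x (l : Fin (T + 1)), i < l → μ x l = 0)
    {f : (X → Fin (T + 1)) → ℝ} (hf : ∀ ξ, f (fun x => dropLabel i (ξ x)) = f ξ) :
    ev (bump μ i s) f = ev μ f := by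
  have h := ev_map (fun _ => dropLabel i) (bump μ i s) f
  rw [mapLaw_bump hi hμ] at h
  rw [← h]
  congr 1
  funext ξ
  exact (hf ξ).symm

lemma acc_dropLabel (ξ : X → Fin (T + 1)) :
    acc Lk (fun y => (dropLabel i (ξ y) : ℕ)) i = acc Lk (fun y => (ξ y : ℕ)) i := by
  refine acc_congr fun y j h1 h2 => ?_
  unfold dropLabel
  split_ifs with h
  · simp only [Fin.val_zero]
    omega
  · rfl

lemma acc_lab_dropLabel (x : X) (ξ : X → Fin (T + 1)) :
    acc Lk (lab x fun y => dropLabel i (ξ y)) i = acc Lk (lab x ξ) i := by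
  refine acc_congr fun y j h1 h2 => ?_
  unfold lab
  by_cases hy : y = x
  · subst hy
    simp
  · simp only [Function.update_of_ne hy]
    unfold dropLabel
    split_ifs with h
    · simp only [Fin.val_zero]
      omega
    · rfl

lemma accProb_bump (hi : i < T) (hμ : ∀ x (l : Fin (T + 1)), i < l → μ x l = 0) (M : Finset X) :
    accProb Lk (bump μ i s) i M = accProb Lk μ i M :=
  ev_bump hi hμ fun ξ => by simp only [acc_dropLabel]

lemma expComp_bump (hi : i < T) (hμ : ∀ x (l : Fin (T + 1)), i < l → μ x l = 0) (x : X) :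
    expComp Lk 𝒞 (bump μ i s) i x = expComp Lk 𝒞 μ i x :=
  ev_bump hi hμ fun ξ => by simp only [acc_dropLabel]

lemma availProb_bump (hi : i < T) (hμ : ∀ x (l : Fin (T + 1)), i < l → μ x l = 0) (x : X) :
    availProb Lk (bump μ i s) i x = availProb Lk μ i x :=
  ev_bump hi hμ fun ξ => by
    unfold cleanInd Clean
    rw [acc_lab_dropLabel]

lemma expComp_mono (hμ : IsProb μ) {j : ℕ} (hij : i ≤ j) (x : X) :
    expComp Lk 𝒞 μ i x ≤ expComp Lk 𝒞 μ j x :=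
  ev_mono hμ fun ξ => Nat.cast_le.2 (card_le_card fun S hS => by
    rw [mem_filter] at hS ⊢
    exact ⟨hS.1, hS.2.1, hS.2.2.trans (acc_mono hij)⟩)

open Classical in
/-- The indicator that `x` is accepted exactly in round `i + 1`. -/
noncomputable def newInd (Lk : Finset (Finset X)) (i : ℕ) (x : X) (ξ : X → Fin (T + 1)) : ℝ :=
  if (ξ x : ℕ) = i + 1 ∧ x ∈ acc Lk (fun y => (ξ y : ℕ)) (i + 1) then 1 else 0

lemma accProb_succ (i : ℕ) (x : X) :
    accProb Lk μ (i + 1) {x} = accProb Lk μ i {x} + ev μ (newInd Lk i x) := by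
  unfold accProb
  rw [← ev_add]
  congr 1
  funext ξ
  simp only [singleton_subset_iff, newInd]
  by_cases h : (ξ x : ℕ) = i + 1
  · have h1 : x ∉ acc Lk (fun y => (ξ y : ℕ)) i := fun hx => by
      have := (label_of_mem_acc hx).2
      omega
    simp [h, h1]
  · have : x ∈ acc Lk (fun y => (ξ y : ℕ)) (i + 1) ↔ x ∈ acc Lk (fun y => (ξ y : ℕ)) i := by
      rw [mem_acc_succ]
      simp [h]
    simp [h, this]

/-- The links at `x` with `x` removed. -/
def linkSet (Lk : Finset (Finset X)) (x : X) : Finset (Finset X) :=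
  (Lk.filter (x ∈ ·)).image (·.erase x)

lemma acc_lab_eq {x : X} {ξ : X → Fin (T + 1)} (hx : (ξ x : ℕ) = i + 1) :
    acc Lk (lab x ξ) i = acc Lk (fun y => (ξ y : ℕ)) i := by
  refine acc_congr fun y j h1 h2 => ?_
  unfold lab
  by_cases hy : y = x
  · subst hy
    simp only [Function.update_self, Fin.val_zero]
    omega
  · simp only [Function.update_of_ne hy]

lemma newInd_le (x : X) (ξ : X → Fin (T + 1)) :
    newInd Lk i x ξ ≤ (if (ξ x : ℕ) = i + 1 then 1 else 0) * cleanInd Lk (linkSet Lk x) x i ξ := by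
  unfold newInd
  split_ifs with h h' h'
  · have hc : Clean Lk (linkSet Lk x) (lab x ξ) i := by
      intro M hM hs
      simp only [linkSet, mem_image, mem_filter] at hM
      obtain ⟨L, ⟨hL, hx⟩, rfl⟩ := hM
      rw [acc_lab_eq h'] at hs
      rcases mem_acc_succ.1 h.2 with h2 | h2
      · have := (label_of_mem_acc h2).2
        omega
      · exact h2.2 L hL hx (hs.trans subset_union_left)
    rw [cleanInd, if_pos hc, one_mul]
  · exact absurd h.1 h'
  · exact mul_nonneg zero_le_one (cleanInd_nonneg _ _ _ _ _)
  · simp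

/-- The weight of a label in the event that `x` and `y` receive the label `i + 1` and the rest of
`L` is labelled. -/
def boxWeight (i : ℕ) (L : Finset X) (x y z : X) (l : Fin (T + 1)) : ℝ :=
  if z = x ∨ z = y then (if (l : ℕ) = i + 1 then 1 else 0) else
    if z ∈ L then (if l = 0 then 0 else 1) else 1

lemma boxWeight_nonneg (i : ℕ) (L : Finset X) (x y z : X) (l : Fin (T + 1)) :
    0 ≤ boxWeight i L x y z l := by
  unfold boxWeight
  split_ifs <;> norm_num

lemma le_newInd (x : X) (ξ : X → Fin (T + 1)) :
    (if (ξ x : ℕ) = i + 1 then 1 else 0) * cleanInd Lk (linkSet Lk x) x i ξ -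
      ∑ L ∈ Lk with x ∈ L, ∑ y ∈ L.erase x, ∏ z, boxWeight i L x y z (ξ z) ≤ newInd Lk i x ξ := by
  have h0 : ∀ L y, 0 ≤ ∏ z, boxWeight i L x y z (ξ z) := fun L y =>
    prod_nonneg fun z _ => boxWeight_nonneg i L x y z (ξ z)
  have hS : 0 ≤ ∑ L ∈ Lk with x ∈ L, ∑ y ∈ L.erase x, ∏ z, boxWeight i L x y z (ξ z) :=
    sum_nonneg fun L _ => sum_nonneg fun y _ => h0 L y
  by_cases hx : (ξ x : ℕ) = i + 1
  swap
  · simp only [hx, if_false, zero_mul, newInd, false_and]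
    linarith
  by_cases hacc : x ∈ acc Lk (fun y => (ξ y : ℕ)) (i + 1)
  · have := cleanInd_le_one Lk (linkSet Lk x) x i ξ
    simp only [hx, if_true, one_mul, newInd, hacc, and_self]
    linarith
  by_cases hc : Clean Lk (linkSet Lk x) (lab x ξ) i
  swap
  · simp only [cleanInd, hc, if_false, mul_zero, newInd, hacc, and_false]
    linarith
  simp only [hx, if_true, one_mul, newInd, hacc, and_false, if_false, cleanInd, hc]
  have hex : ∃ L ∈ Lk, x ∈ L ∧
      L.erase x ⊆ acc Lk (fun y => (ξ y : ℕ)) i ∪ univ.filter fun y => (ξ y : ℕ) = i + 1 := by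
    by_contra hne
    push Not at hne
    exact hacc (mem_acc_succ.2 (Or.inr ⟨hx, hne⟩))
  obtain ⟨L, hL, hxL, hsub⟩ := hex
  have hns : ¬ L.erase x ⊆ acc Lk (fun y => (ξ y : ℕ)) i := by
    rw [← acc_lab_eq hx]
    exact hc _ (mem_image.2 ⟨L, mem_filter.2 ⟨hL, hxL⟩, rfl⟩)
  obtain ⟨y, hyL, hy⟩ := not_subset.1 hns
  have hytop : (ξ y : ℕ) = i + 1 := by
    rcases mem_union.1 (hsub hyL) with h | h
    · exact absurd h hy
    · simpa using h
  have hone : ∏ z, boxWeight i L x y z (ξ z) = 1 := by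
    refine prod_eq_one fun z _ => ?_
    unfold boxWeight
    split_ifs with h1 h2 h3 h4
    · rfl
    · rcases h1 with rfl | rfl
      · exact absurd hx h2
      · exact absurd hytop h2
    · exfalso
      push Not at h1
      rcases mem_union.1 (hsub (mem_erase.2 ⟨h1.1, h3⟩)) with h | h
      · have := (label_of_mem_acc h).1
        simp [h4] at this
      · simp [h4] at h
    · rfl
    · rfl
  have h1 := single_le_sum (f := fun y => ∏ z, boxWeight i L x y z (ξ z)) (fun y _ => h0 L y) hyL
  have h2 := single_le_sum (f := fun L => ∑ y ∈ L.erase x, ∏ z, boxWeight i L x y z (ξ z))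
    (fun L _ => sum_nonneg fun y _ => h0 L y)
    (show L ∈ Lk.filter (x ∈ ·) from mem_filter.2 ⟨hL, hxL⟩)
  linarith

lemma sum_label_eq (hi : i < T) (ν : Fin (T + 1) → ℝ) :
    ∑ l : Fin (T + 1), ν l * (if (l : ℕ) = i + 1 then 1 else 0) = ν ⟨i + 1, by omega⟩ := by
  rw [sum_eq_single ⟨i + 1, by omega⟩]
  · simp
  · intro l _ hl
    rw [if_neg fun e => hl (Fin.ext e), mul_zero]
  · simp

lemma ev_label_clean (hμ : IsProb μ) (hi : i < T) (x : X) :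
    ev μ (fun ξ => (if (ξ x : ℕ) = i + 1 then 1 else 0) * cleanInd Lk (linkSet Lk x) x i ξ) =
      μ x ⟨i + 1, by omega⟩ * availProb Lk μ i x := by
  classical
  have h := ev_mul_update hμ x 0 (fun l => if (l : ℕ) = i + 1 then 1 else 0)
    (fun ζ => if Clean Lk (linkSet Lk x) (fun y => (ζ y : ℕ)) i then 1 else 0)
  rw [sum_label_eq hi] at h
  have e : ∀ ξ : X → Fin (T + 1), cleanInd Lk (linkSet Lk x) x i ξ =
      if Clean Lk (linkSet Lk x) (fun y => (Function.update ξ x 0 y : ℕ)) i then 1 else 0 :=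
    fun ξ => by
      unfold cleanInd lab
      congr
  unfold availProb
  change _ = _ * ev μ (fun ξ => cleanInd Lk (linkSet Lk x) x i ξ)
  simp only [e]
  exact h

lemma ev_box_le (hμ : IsProb μ) (hi : i < T) {π : ℝ} (hπ : ∀ z, 1 - μ z 0 ≤ π) {L : Finset X}
    {x y : X} (hx : x ∈ L) (hy : y ∈ L.erase x) :
    ev μ (fun ξ => ∏ z, boxWeight i L x y z (ξ z)) ≤
      μ x ⟨i + 1, by omega⟩ * (μ y ⟨i + 1, by omega⟩ * π ^ (L.card - 2)) := by
  rw [ev_prod]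
  have hxu := mem_univ x
  rw [← mul_prod_erase univ _ (mem_univ x), ← mul_prod_erase (univ.erase x) _
    (mem_erase.2 ⟨(mem_erase.1 hy).1, mem_univ y⟩)]
  have e1 : ∑ l, μ x l * boxWeight i L x y x l = μ x ⟨i + 1, by omega⟩ := by
    simp only [boxWeight, true_or, if_true]
    exact sum_label_eq hi _
  have e2 : ∑ l, μ y l * boxWeight i L x y y l = μ y ⟨i + 1, by omega⟩ := by
    simp only [boxWeight, or_true, if_true]
    exact sum_label_eq hi _
  rw [e1, e2]
  refine mul_le_mul_of_nonneg_left (mul_le_mul_of_nonneg_left ?_ (hμ.nonneg _ _)) (hμ.nonneg _ _)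
  have hle : ∏ z ∈ (univ.erase x).erase y, ∑ l, μ z l * boxWeight i L x y z l ≤
      ∏ z ∈ (univ.erase x).erase y, if z ∈ L then π else 1 := by
    refine prod_le_prod (fun z _ => sum_nonneg fun l _ =>
      mul_nonneg (hμ.nonneg _ _) (boxWeight_nonneg _ _ _ _ _ _)) fun z hz => ?_
    simp only [mem_erase, mem_univ, and_true] at hz
    have hn : ¬ (z = x ∨ z = y) := by tauto
    simp only [boxWeight, hn, if_false]
    by_cases hz : z ∈ L
    · simp only [hz, if_true]
      have := hμ.sum_one z
      rw [← add_sum_erase univ _ (mem_univ 0)] at this ⊢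
      simp only [if_true, mul_zero, zero_add]
      have e : ∑ l ∈ univ.erase (0 : Fin (T + 1)), μ z l * (if l = 0 then 0 else 1) =
          ∑ l ∈ univ.erase (0 : Fin (T + 1)), μ z l :=
        sum_congr rfl fun l hl => by rw [if_neg (mem_erase.1 hl).1, mul_one]
      rw [e]
      linarith [hπ z]
    · simp only [hz, if_false, mul_one]
      exact (hμ.sum_one z).le
  refine hle.trans (le_of_eq ?_)
  rw [prod_ite, prod_const, prod_const_one, mul_one]
  congr 1
  have : ((univ.erase x).erase y).filter (· ∈ L) = (L.erase x).erase y := by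
    ext z
    simp only [mem_filter, mem_erase, mem_univ, and_true]
    tauto
  rw [this, card_erase_of_mem hy, card_erase_of_mem hx]
  omega

end Stages

section Stages

variable {X : Type*} [Fintype X] [DecidableEq X] {T : ℕ} {Lk 𝒞 : Finset (Finset X)}

/-- The invariant of the greedy process after `i` rounds. -/
structure Stage (Lk 𝒞 : Finset (Finset X)) (β b η C' : ℝ) (μ : X → Fin (T + 1) → ℝ) (i : ℕ) :
    Prop where
  isProb : IsProb μ
  eq_zero : ∀ x (l : Fin (T + 1)), i < l → μ x l = 0
  le : ∀ x (l : Fin (T + 1)), l ≠ 0 → μ x l ≤ b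
  acc_le : ∀ x, accProb Lk μ i {x} ≤ i * β
  acc_ge : ∀ x, expComp Lk 𝒞 μ i x ≤ C' → i * (β * (1 - η)) ≤ accProb Lk μ i {x}

variable {μ : X → Fin (T + 1) → ℝ} {i : ℕ} {β b η C' : ℝ}

lemma Stage.one_sub_le (h : Stage Lk 𝒞 β b η C' μ i) (x : X) : 1 - μ x 0 ≤ T * b := by
  have h1 := h.isProb.sum_one x
  rw [← add_sum_erase univ _ (mem_univ 0)] at h1
  have h2 := sum_le_card_nsmul (univ.erase (0 : Fin (T + 1))) (μ x) b
    fun l hl => h.le x l (mem_erase.1 hl).1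
  rw [card_erase_of_mem (mem_univ _), card_univ, Fintype.card_fin, nsmul_eq_mul] at h2
  simp only [Nat.add_sub_cancel] at h2
  linarith

lemma Stage.zero : Stage Lk 𝒞 (T := T) β (max b 0) η C' (fun _ l => if l = 0 then 1 else 0) 0 where
  isProb := ⟨fun x l => by split_ifs <;> norm_num, fun x => by simp⟩
  eq_zero x l hl := if_neg fun e => by simp [e] at hl
  le x l hl := by simp [hl]
  acc_le x := by simp [accProb, acc, ev]
  acc_ge x _ := by simp [accProb, acc, ev]

lemma Stage.succ (h : Stage Lk 𝒞 β b η C' μ i) (hi : i < T) (hβ : 0 ≤ β) {p : ℝ} (hp : 0 < p)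
    (hb : b = β / p) (hTb : T * b ≤ 1) {J : ℕ} (hJ : ∀ L ∈ Lk, L.card ≤ J)
    (h2 : ∀ L ∈ Lk, 2 ≤ L.card) {Q : ℝ}
    (hQ : ∀ x, ∑ L ∈ Lk with x ∈ L, (T * b) ^ (L.card - 1) ≤ Q)
    (hη : J * Q / (p * T) ≤ η)
    (havail : ∀ x, expComp Lk 𝒞 μ i x ≤ C' → p ≤ availProb Lk μ i x) :
    ∃ μ' : X → Fin (T + 1) → ℝ, Stage Lk 𝒞 β b η C' μ' (i + 1) := by
  classical
  have hT : (0 : ℝ) < T := by exact_mod_cast (by omega : 0 < T)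
  have hb0 : 0 ≤ b := by
    rw [hb]
    positivity
  set s : X → ℝ := fun x => if expComp Lk 𝒞 μ i x ≤ C' then β / availProb Lk μ i x else 0 with hs
  have hs0 : ∀ x, 0 ≤ s x := fun x => by
    simp only [hs]
    split_ifs with hx
    · exact div_nonneg hβ (hp.le.trans (havail x hx))
    · rfl
  have hsb : ∀ x, s x ≤ b := fun x => by
    simp only [hs]
    split_ifs with hx
    · rw [hb]
      exact div_le_div_of_nonneg_left hβ hp (havail x hx)
    · exact hb0
  have hmul : ∀ x, expComp Lk 𝒞 μ i x ≤ C' → s x * availProb Lk μ i x = β := fun x hx => by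
    simp only [hs, hx, if_true]
    exact div_mul_cancel₀ _ (hp.trans_le (havail x hx)).ne'
  have hmul_le : ∀ x, s x * availProb Lk μ i x ≤ β := fun x => by
    by_cases hx : expComp Lk 𝒞 μ i x ≤ C'
    · exact (hmul x hx).le
    · simp only [hs, hx, if_false, zero_mul]
      exact hβ
  have hs1 : ∀ x, s x ≤ μ x 0 := fun x => by
    have h1 := h.isProb.sum_one x
    have htm : (⟨i + 1, by omega⟩ : Fin (T + 1)) ∈ univ.erase (0 : Fin (T + 1)) :=
      mem_erase.2 ⟨by simp [Fin.ext_iff], mem_univ _⟩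
    have htop := h.eq_zero x ⟨i + 1, by omega⟩ (by simp)
    rw [← add_sum_erase univ _ (mem_univ 0), ← add_sum_erase (univ.erase 0) _ htm, htop] at h1
    have h2 := sum_le_card_nsmul ((univ.erase (0 : Fin (T + 1))).erase ⟨i + 1, by omega⟩) (μ x) b
      fun l hl => h.le x l (mem_erase.1 (mem_erase.1 hl).2).1
    rw [card_erase_of_mem htm, card_erase_of_mem (mem_univ _), card_univ, Fintype.card_fin, nsmul_eq_mul,
      Nat.add_sub_cancel, Nat.cast_sub (by omega : 1 ≤ T)] at h2
    push_cast at h2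
    have := hsb x
    linarith
  have hprob := bump_isProb h.isProb hi h.eq_zero hs0 hs1
  have hle : ∀ x (l : Fin (T + 1)), l ≠ 0 → bump μ i s x l ≤ b := fun x l hl => by
    unfold bump
    rw [if_neg hl]
    split_ifs
    · exact hsb x
    · exact h.le x l hl
  have hone : ∀ z, 1 - bump μ i s z 0 ≤ T * b := fun z => by
    have h1 := hprob.sum_one z
    rw [← add_sum_erase univ _ (mem_univ 0)] at h1
    have h2 := sum_le_card_nsmul (univ.erase (0 : Fin (T + 1))) (bump μ i s z) b
      fun l hl => hle z l (mem_erase.1 hl).1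
    rw [card_erase_of_mem (mem_univ _), card_univ, Fintype.card_fin, nsmul_eq_mul] at h2
    simp only [Nat.add_sub_cancel] at h2
    linarith
  have hclean : ∀ x, ev (bump μ i s) (fun ξ => (if (ξ x : ℕ) = i + 1 then 1 else 0) *
      cleanInd Lk (linkSet Lk x) x i ξ) = s x * availProb Lk μ i x := fun x => by
    rw [ev_label_clean hprob hi, bump_top hi, availProb_bump hi h.eq_zero]
  refine ⟨bump μ i s, hprob, fun x l hl => ?_, hle, fun x => ?_, fun x hx => ?_⟩
  · unfold bump
    rw [if_neg (by omega), if_neg (by rintro rfl; simp at hl), h.eq_zero x l (by omega)]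
  · rw [accProb_succ, accProb_bump hi h.eq_zero]
    have h1 := ev_mono hprob (newInd_le (Lk := Lk) (i := i) x)
    rw [hclean] at h1
    have h3 := h.acc_le x
    have h4 := hmul_le x
    push_cast
    linarith
  · have hgood : expComp Lk 𝒞 μ i x ≤ C' := by
      rw [← expComp_bump (s := s) hi h.eq_zero]
      exact (expComp_mono hprob (Nat.le_succ i) x).trans hx
    rw [accProb_succ, accProb_bump hi h.eq_zero]
    have h1 := ev_mono hprob (le_newInd (Lk := Lk) (i := i) x)
    rw [ev_sub, hclean, hmul x hgood, ev_sum] at h1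
    simp only [ev_sum] at h1
    have herr : ∑ L ∈ Lk with x ∈ L, ∑ y ∈ L.erase x,
        ev (bump μ i s) (fun ξ => ∏ z, boxWeight i L x y z (ξ z)) ≤ β * η := by
      calc _ ≤ ∑ L ∈ Lk with x ∈ L, s x * (J / T) * (T * b) ^ (L.card - 1) := by
            refine sum_le_sum fun L hL => ?_
            rw [mem_filter] at hL
            have hterm : ∀ y ∈ L.erase x, ev (bump μ i s)
                (fun ξ => ∏ z, boxWeight i L x y z (ξ z)) ≤ s x * (b * (T * b) ^ (L.card - 2)) := by
              intro y hy
              refine (ev_box_le hprob hi hone hL.2 hy).trans ?_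
              rw [bump_top hi, bump_top hi]
              exact mul_le_mul_of_nonneg_left (mul_le_mul_of_nonneg_right (hsb y)
                (by positivity)) (hs0 x)
            refine (sum_le_card_nsmul _ _ _ hterm).trans ?_
            rw [nsmul_eq_mul]
            have hcard : ((L.erase x).card : ℝ) ≤ J := by
              exact_mod_cast (card_le_card (erase_subset x L)).trans (hJ L hL.1)
            have hpow : (T * b) ^ (L.card - 1) = (T * b) ^ (L.card - 2) * (T * b) := by
              rw [← pow_succ]
              congr 1
              have := h2 L hL.1
              omega
            rw [hpow]
            have e : s x * (J / T) * ((T * b) ^ (L.card - 2) * (T * b)) =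
                J * (s x * (b * (T * b) ^ (L.card - 2))) := by
              field_simp
            rw [e]
            have := hs0 x
            exact mul_le_mul_of_nonneg_right hcard (by positivity)
        _ ≤ s x * (J / T) * Q := by
            rw [← mul_sum]
            have := hs0 x
            exact mul_le_mul_of_nonneg_left (hQ x) (by positivity)
        _ ≤ b * (J / T) * Q := by
            have hQ0 : 0 ≤ Q := le_trans (sum_nonneg fun L _ => by positivity) (hQ x)
            have := hsb x
            gcongr
        _ = β * (J * Q / (p * T)) := by
            rw [hb]
            field_simp
        _ ≤ β * η := mul_le_mul_of_nonneg_left hη hβ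
    have h3 := h.acc_ge x hgood
    push_cast
    linarith

end Stages

section Abstract

lemma exists_ev_le {X Λ : Type*} [Fintype X] [DecidableEq X] [Fintype Λ] [DecidableEq Λ]
    [Nonempty Λ]
    {μ : X → Λ → ℝ} (hμ : IsProb μ) (f : (X → Λ) → ℝ) : ∃ ξ, ev μ f ≤ f ξ := by
  obtain ⟨ξ, hξ⟩ := Finite.exists_max f
  exact ⟨ξ, (ev_mono hμ hξ).trans (ev_const hμ _).le⟩

variable {X R : Type*} [Fintype X] [DecidableEq X] [Fintype R] [DecidableEq R]
  {K : R → X → Finset X} {𝒞 : Finset (Finset X)} {J T : ℕ} {D δ C : ℝ}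

/-- A process that ends well produces a heavy link-free set. -/
lemma ConflictSystem.exists_of_stage (h : ConflictSystem K 𝒞 J D δ C) {β b ε W C' : ℝ}
    {μ : X → Fin (T + 1) → ℝ} (hst : Stage (links K 𝒞) 𝒞 β b ε C' μ T) (hε : 0 < ε) (hε1 : ε < 1)
    (hβ : T * β = (1 - ε) / D) (hW : 1 ≤ W) (hC' : C' = W * C / ε)
    (wt : X → ℝ) (hwt : ∀ x, 1 ≤ wt x) (hwtW : ∀ x, wt x ≤ W) :
    ∃ M : Finset X, (∀ L ∈ links K 𝒞, ¬ L ⊆ M) ∧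
      (1 - 3 * ε) * (∑ x, wt x) / D ≤ ∑ x ∈ M, wt x := by
  classical
  have hD := h.D_pos
  have hC1 := h.one_le_C
  have hC'0 : 0 < C' := by
    rw [hC']
    positivity
  set A : (X → Fin (T + 1)) → Finset X := fun ξ => acc (links K 𝒞) (fun y => (ξ y : ℕ)) T with hA
  have hfree : ∀ ξ, ∀ L ∈ links K 𝒞, ¬ L ⊆ A ξ := fun ξ L hL =>
    acc_link_free (fun L hL => h.two_le hL) T hL
  have hcomp : ∑ x, expComp (links K 𝒞) 𝒞 μ T x ≤ C * Fintype.card X := by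
    unfold expComp
    rw [← ev_sum]
    refine (ev_mono hst.isProb fun ξ => h.completions (A ξ) fun ρ x hx y hy hK => ?_).trans
      (ev_const hst.isProb _).le
    refine hfree ξ {y, x} (mem_links.2 (Or.inr ⟨x, y, ρ, hK, rfl⟩)) ?_
    intro z hz
    simp only [mem_insert, mem_singleton] at hz
    rcases hz with rfl | rfl
    · exact hy
    · exact hx
  set bad := univ.filter fun x => ¬ expComp (links K 𝒞) 𝒞 μ T x ≤ C' with hbad
  have hwt0 : ∀ x, 0 ≤ wt x := fun x => zero_le_one.trans (hwt x)
  have hcardX : (Fintype.card X : ℝ) ≤ ∑ x, wt x := by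
    have := card_nsmul_le_sum univ wt 1 fun x _ => hwt x
    simpa using this
  have hbadc : (bad.card : ℝ) * C' ≤ C * Fintype.card X := by
    have h1 := card_nsmul_le_sum bad (expComp (links K 𝒞) 𝒞 μ T) C' fun x hx =>
      (not_le.1 (mem_filter.1 hx).2).le
    rw [nsmul_eq_mul] at h1
    refine h1.trans (le_trans (sum_le_sum_of_subset_of_nonneg (subset_univ _) fun x _ _ => ?_) hcomp)
    exact ev_nonneg hst.isProb fun ξ => Nat.cast_nonneg _
  have hbadw : ∑ x ∈ bad, wt x ≤ ε * ∑ x, wt x := by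
    have h1 := sum_le_card_nsmul bad wt W fun x _ => hwtW x
    rw [nsmul_eq_mul] at h1
    have h2 : (bad.card : ℝ) * W ≤ ε * Fintype.card X := by
      rw [hC', mul_div_assoc', div_le_iff₀ hε] at hbadc
      have : C * (bad.card * W) ≤ C * (ε * Fintype.card X) := by linarith
      exact le_of_mul_le_mul_left this (by linarith)
    nlinarith
  have hgood : (1 - ε) * ∑ x, wt x ≤ ∑ x with expComp (links K 𝒞) 𝒞 μ T x ≤ C', wt x := by
    have := sum_filter_add_sum_filter_not univ (fun x => expComp (links K 𝒞) 𝒞 μ T x ≤ C') wt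
    linarith
  have hev : ev μ (fun ξ => ∑ x ∈ A ξ, wt x) = ∑ x, wt x * accProb (links K 𝒞) μ T {x} := by
    unfold accProb
    simp_rw [← ev_const_mul]
    rw [← ev_sum]
    congr 1
    funext ξ
    simp only [singleton_subset_iff, mul_ite, mul_one, mul_zero]
    rw [← sum_filter]
    congr 1
    ext x
    simp [hA]
  have hS0 : 0 ≤ ∑ x, wt x := sum_nonneg fun x _ => hwt0 x
  obtain ⟨ξ, hξ⟩ := exists_ev_le hst.isProb (fun ξ => ∑ x ∈ A ξ, wt x)
  refine ⟨A ξ, hfree ξ, le_trans ?_ hξ⟩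
  rw [hev]
  have h1 : ∑ x with expComp (links K 𝒞) 𝒞 μ T x ≤ C', wt x * ((1 - ε) / D * (1 - ε)) ≤
      ∑ x, wt x * accProb (links K 𝒞) μ T {x} := by
    refine le_trans (sum_le_sum fun x hx => mul_le_mul_of_nonneg_left ?_ (hwt0 x))
      (sum_le_sum_of_subset_of_nonneg (subset_univ _) fun x _ _ =>
        mul_nonneg (hwt0 x) (accProb_nonneg hst.isProb _ _))
    have := hst.acc_ge x (mem_filter.1 hx).2
    rwa [← mul_assoc, hβ] at this
  refine le_trans ?_ h1
  rw [← sum_mul]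
  have h2 : (1 - ε) * (∑ x, wt x) * ((1 - ε) / D * (1 - ε)) ≤
      (∑ x with expComp (links K 𝒞) 𝒞 μ T x ≤ C', wt x) * ((1 - ε) / D * (1 - ε)) := by
    refine mul_le_mul_of_nonneg_right hgood ?_
    have : 0 ≤ 1 - ε := by linarith
    positivity
  refine le_trans ?_ h2
  have e : (1 - ε) * (∑ x, wt x) * ((1 - ε) / D * (1 - ε)) = (1 - ε) ^ 3 * (∑ x, wt x) / D := by
    ring
  rw [e]
  have h3 : 1 - 3 * ε ≤ (1 - ε) ^ 3 := by nlinarith [sq_nonneg ε]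
  exact div_le_div_of_nonneg_right (mul_le_mul_of_nonneg_right h3 hS0) hD.le

/-- A conflict system with small error has a link-free set of almost the full weight. -/
theorem exists_linkFree (r J : ℕ) {ε C W : ℝ} (hε : 0 < ε) (hε1 : ε < 1) (hC : 1 ≤ C)
    (hW : 1 ≤ W) : ∃ δ₀ > 0, ∀ {X R : Type} [Fintype X] [DecidableEq X] [Fintype R] [DecidableEq R]
      {K : R → X → Finset X} {𝒞 : Finset (Finset X)} {D δ : ℝ},
      ConflictSystem K 𝒞 J D δ C → Fintype.card R = r → δ ≤ δ₀ →
      ∀ wt : X → ℝ, (∀ x, 1 ≤ wt x) → (∀ x, wt x ≤ W) →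
      ∃ M : Finset X, (∀ L ∈ links K 𝒞, ¬ L ⊆ M) ∧
        (1 - 3 * ε) * (∑ x, wt x) / D ≤ ∑ x ∈ M, wt x := by
  set C' := W * C / ε with hC'
  have hC'0 : 0 < C' := by positivity
  set m := ⌈8 * C'⌉₊ + 1 with hm
  have hmC : 8 * C' ≤ m := (Nat.le_ceil _).trans (by exact_mod_cast Nat.le_succ _)
  set p := (ε / 2) ^ r * (1 / 2) ^ m / 2 with hp
  have hp0 : 0 < p := by positivity
  have hp1 : p ≤ 1 := by
    have h1 : (ε / 2) ^ r ≤ 1 := pow_le_one₀ (by positivity) (by linarith)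
    have h2 : ((1 : ℝ) / 2) ^ m ≤ 1 := pow_le_one₀ (by positivity) (by norm_num)
    have h3 : (ε / 2) ^ r * (1 / 2) ^ m ≤ 1 := mul_le_one₀ h1 (by positivity) h2
    rw [hp]
    linarith
  set P := 2 / p with hP
  have hP1 : 1 ≤ P := by
    rw [hP, le_div_iff₀ hp0]
    linarith
  set Q := ((J : ℝ) + 1) * (C * P ^ J) + r * P with hQ
  have hQ0 : 0 ≤ Q := by positivity
  set T := ⌈J * Q / (p * ε)⌉₊ + 1 with hT
  have hT0 : (0 : ℝ) < T := by positivity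
  have hTη : J * Q / (p * T) ≤ ε := by
    have h1 : J * Q / (p * ε) ≤ T := (Nat.le_ceil _).trans (by exact_mod_cast Nat.le_succ _)
    rw [div_le_iff₀ (by positivity)] at h1 ⊢
    linarith
  set c := ((r : ℝ) + m) ^ 2 * |ConflictSystem.targetConst r J C P T| + 1 with hc
  have hc0 : 0 < c := by positivity
  refine ⟨min (1 / 8) (min (ε / P) (p / c)), by positivity, ?_⟩
  intro X R _ _ _ _ K 𝒞 D δ h hr hδ wt hwt hwtW
  have hδ8 : δ ≤ 1 / 8 := hδ.trans (min_le_left _ _)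
  have hδP : δ ≤ ε / P := hδ.trans ((min_le_right _ _).trans (min_le_left _ _))
  have hδc : δ ≤ p / c := hδ.trans ((min_le_right _ _).trans (min_le_right _ _))
  have hδ0 := h.delta_pos
  have hD := h.D_pos
  have h1D := h.one_le_delta_mul
  have hD8 : 8 ≤ D := by nlinarith
  have hPD : P / D ≤ ε := by
    rw [le_div_iff₀ (by positivity)] at hδP
    rw [div_le_iff₀ hD]
    nlinarith
  have herr : ((r : ℝ) + m) ^ 2 * (ConflictSystem.targetConst r J C P T * δ) ≤ p := by
    rw [le_div_iff₀ hc0] at hδc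
    have h1 : ConflictSystem.targetConst r J C P T * δ ≤ |ConflictSystem.targetConst r J C P T| * δ :=
      mul_le_mul_of_nonneg_right (le_abs_self _) hδ0.le
    have h2 := mul_le_mul_of_nonneg_left h1 (sq_nonneg ((r : ℝ) + m))
    rw [hc] at hδc
    nlinarith
  set β := (1 - ε) / (T * D) with hβ
  have hβ0 : 0 ≤ β := div_nonneg (by linarith) (by positivity)
  have hTβ : T * β = (1 - ε) / D := by
    rw [hβ]
    field_simp
  set b := β / p with hb
  have hb0 : 0 ≤ b := by positivity
  have hTb : T * b ≤ P / D / 2 := by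
    rw [hb, ← mul_div_assoc, hTβ, hP]
    have e : 2 / p / D / 2 = 1 / D / p := by
      field_simp
    rw [e]
    have : 1 - ε ≤ 1 := by linarith
    gcongr
  have hPD0 : 0 ≤ P / D := by positivity
  have hstage : ∀ i ≤ T, ∃ μ : X → Fin (T + 1) → ℝ, Stage (links K 𝒞) 𝒞 β b ε C' μ i := by
    intro i
    induction i with
    | zero =>
      intro _
      have := Stage.zero (T := T) (Lk := links K 𝒞) (𝒞 := 𝒞) (β := β) (b := b) (η := ε) (C' := C')
      rw [max_eq_left hb0] at this
      exact ⟨_, this⟩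
    | succ i ih =>
      intro hi
      obtain ⟨μ, hμ⟩ := ih (by omega)
      refine hμ.succ (by omega) hβ0 hp0 hb (by linarith) (J := J) (Q := Q) (fun L hL => ?_)
        (fun L hL => h.two_le hL) (fun x => ?_) hTη fun x hx => ?_
      · rcases mem_links.1 hL with hL | ⟨x, y, ρ, hy, rfl⟩
        · exact h.card_le L hL
        · rw [pair_comm, h.pair_card hy]
          exact h.two_le_J
      · refine le_trans (sum_le_sum fun L _ => ?_) (le_trans (h.degree_links hP1 x) ?_)
        · exact pow_le_pow_left₀ (by positivity) (by linarith) _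
        · rw [hr]
      · have := h.availProb_ge (x := x) (m := m) (by linarith) hP1 hμ.isProb
          (fun y => (hμ.one_sub_le y).trans hTb) (by omega : i ≤ T) hε hε1 hPD hD8
          (fun y => (hμ.acc_le y).trans (by
            rw [← hTβ]
            have : (i : ℝ) ≤ T := by exact_mod_cast (by omega : i ≤ T)
            gcongr)) (by omega) hx hmC
        rw [hr] at this
        linarith
  obtain ⟨μ, hμ⟩ := hstage T le_rfl
  exact h.exists_of_stage hμ hε hε1 hTβ hW hC' wt hwt hwtW

end Abstract

/-- Frames of blocks: `act f` is the set of slots in use, each with its own base. -/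
structure Frame (F S Q B : Type) where
  act : F → S → Prop
  base : F → S → B
  col : F → Q
  base_inj : ∀ f p q, act f p → act f q → base f p = base f q → p = q

/-- The coefficients of the second slot in the four types of key. -/
def coef : Fin 4 → ℤ := ![-1, 0, 1, -2]

section Counting

variable {S : Type} [Fintype S] [DecidableEq S] {N : ℕ} [NeZero N]

/-- Set two coordinates to zero. -/
def zeroAt (e f : S) (g : S → ZMod N) : S → ZMod N :=
  Function.update (Function.update g e 0) f 0

lemma zeroAt_apply_left (e f : S) (g : S → ZMod N) : zeroAt e f g e = 0 := by
  unfold zeroAt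
  by_cases h : e = f
  · subst h
    simp
  · rw [Function.update_of_ne h, Function.update_self]

lemma zeroAt_apply_right (e f : S) (g : S → ZMod N) : zeroAt e f g f = 0 := by
  simp [zeroAt]

lemma zeroAt_of_ne {e f t : S} (he : t ≠ e) (hf : t ≠ f) (g : S → ZMod N) :
    zeroAt e f g t = g t := by
  rw [zeroAt, Function.update_of_ne hf, Function.update_of_ne he]

lemma eq_of_zeroAt {e f : S} {g g' : S → ZMod N} (h : zeroAt e f g = zeroAt e f g')
    (he : g e = g' e) (hf : g f = g' f) : g = g' := by
  funext t
  by_cases h1 : t = e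
  · rw [h1, he]
  by_cases h2 : t = f
  · rw [h2, hf]
  rw [← zeroAt_of_ne h1 h2 g, h, zeroAt_of_ne h1 h2 g']

lemma card_zero_set (U : Finset S) :
    (univ.filter fun g : S → ZMod N => ∀ u ∈ U, g u = 0).card = N ^ (Fintype.card S - U.card) := by
  classical
  have e : (univ.filter fun g : S → ZMod N => ∀ u ∈ U, g u = 0) =
      Fintype.piFinset fun u => if u ∈ U then {0} else univ := by
    ext g
    simp only [mem_filter, mem_univ, true_and, Fintype.mem_piFinset]
    refine forall_congr' fun u => ?_
    split_ifs with h <;> simp [h]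
  rw [e, Fintype.card_piFinset]
  have : ∀ u, (if u ∈ U then ({0} : Finset (ZMod N)) else univ).card = if u ∈ U then 1 else N := by
    intro u
    split_ifs <;> simp [ZMod.card]
  simp only [this]
  rw [prod_ite, prod_const_one, one_mul, prod_const]
  congr 1
  have : univ.filter (fun u => u ∉ U) = univ \ U := by
    ext u
    simp
  rw [this, card_sdiff_of_subset (subset_univ U), card_univ]

/-- The coefficients that occur are units modulo `N`. -/
def SmallUnits (N : ℕ) : Prop := IsUnit (2 : ZMod N) ∧ IsUnit (3 : ZMod N)

lemma SmallUnits.cancel (hN : SmallUnits N) {c : ℤ}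
    (hc : c = 1 ∨ c = -1 ∨ c = 2 ∨ c = -2 ∨ c = 3 ∨ c = -3)
    {d : ZMod N} (h : (c : ZMod N) * d = 0) : d = 0 := by
  have hu : IsUnit (c : ZMod N) := by
    rcases hc with rfl | rfl | rfl | rfl | rfl | rfl
    · simp
    · simp
    · simpa using hN.1
    · simpa using hN.1
    · simpa using hN.2
    · simpa using hN.2
  exact hu.mul_right_eq_zero.1 h

lemma coef_cases {τ : Fin 4} (h : τ ≠ 1) : coef τ = 1 ∨ coef τ = -1 ∨ coef τ = -2 := by
  fin_cases τ <;> simp_all [coef]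

/-- Two keys that are not equivalent are independent in suitable coordinates. -/
lemma exists_coordinates (hN : SmallUnits N) {τ τ' : Fin 4} {p q p' q' : S}
    (h1 : p = q ↔ τ = 1) (h2 : p' = q' ↔ τ' = 1)
    (hne : ¬ (τ = τ' ∧ p = p' ∧ q = q'))
    (hsw : ¬ (τ = τ' ∧ (τ = 0 ∨ τ = 2) ∧ p = q' ∧ q = p')) :
    ∃ e f : S, e ≠ f ∧ ∀ d : S → ZMod N, (∀ t, t ≠ e → t ≠ f → d t = 0) →
      d p + coef τ * d q = 0 → d p' + coef τ' * d q' = 0 → d e = 0 ∧ d f = 0 := by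
  have single : ∀ {τ : Fin 4} {p q : S}, (p = q ↔ τ = 1) → ∀ d : S → ZMod N, ∀ u, (u = p ∨ u = q) →
      (∀ t, t = p ∨ t = q → t ≠ u → d t = 0) → d p + coef τ * d q = 0 → d u = 0 := by
    intro τ p q h d u hu hd he
    by_cases hτ : τ = 1
    · have := h.2 hτ
      subst this
      rw [hτ] at he
      simp only [coef, Matrix.cons_val_one, Matrix.cons_val_zero, Int.cast_zero, zero_mul,
        add_zero] at he
      rcases hu with rfl | rfl <;> exact he
    · have hpq : p ≠ q := fun e => hτ (h.1 e)
      rcases hu with rfl | rfl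
      · rwa [hd q (Or.inr rfl) hpq.symm, mul_zero, add_zero] at he
      · rw [hd p (Or.inl rfl) hpq, zero_add] at he
        refine hN.cancel ?_ he
        rcases coef_cases hτ with h | h | h <;> simp [h]
  have aux : ∀ {τ τ' : Fin 4} {p q p' q' : S}, (p = q ↔ τ = 1) → (p' = q' ↔ τ' = 1) →
      ∀ u, (u = p' ∨ u = q') → u ≠ p → u ≠ q →
      ∃ e f : S, e ≠ f ∧ ∀ d : S → ZMod N, (∀ t, t ≠ e → t ≠ f → d t = 0) →
        d p + coef τ * d q = 0 → d p' + coef τ' * d q' = 0 → d e = 0 ∧ d f = 0 := by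
    intro τ τ' p q p' q' h1 h2 u hu hup huq
    refine ⟨p, u, hup.symm, fun d hd he he' => ?_⟩
    have hp : d p = 0 := by
      refine single h1 d p (Or.inl rfl) (fun t ht htp => ?_) he
      refine hd t htp ?_
      rcases ht with rfl | rfl
      · exact absurd rfl htp
      · exact huq.symm
    refine ⟨hp, single h2 d u hu (fun t _ htu => ?_) he'⟩
    by_cases htp : t = p
    · rw [htp, hp]
    · exact hd t htp htu
  by_cases ha : p' ≠ p ∧ p' ≠ q
  · exact aux h1 h2 p' (Or.inl rfl) ha.1 ha.2
  by_cases hb : q' ≠ p ∧ q' ≠ q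
  · exact aux h1 h2 q' (Or.inr rfl) hb.1 hb.2
  by_cases hc : p ≠ p' ∧ p ≠ q'
  · obtain ⟨e, f, hef, h⟩ := aux h2 h1 p (Or.inl rfl) hc.1 hc.2
    exact ⟨e, f, hef, fun d hd u v => h d hd v u⟩
  by_cases hd : q ≠ p' ∧ q ≠ q'
  · obtain ⟨e, f, hef, h⟩ := aux h2 h1 q (Or.inr rfl) hd.1 hd.2
    exact ⟨e, f, hef, fun d hd u v => h d hd v u⟩
  simp only [ne_eq, not_and_or, not_not] at ha hb hc hd
  by_cases hpq : p = q
  · exfalso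
    subst hpq
    have e1 : p' = p := ha.elim id id
    have e2 : q' = p := hb.elim id id
    exact hne ⟨by rw [h1.1 rfl, h2.1 (e1.trans e2.symm)], e1.symm, e2.symm⟩
  have hτ : τ ≠ 1 := fun e => hpq (h1.2 e)
  refine ⟨p, q, hpq, fun d _ he he' => ?_⟩
  rcases ha with hpp | hpp
  · have hqq : q = q' := by
      rcases hd with h | h
      · exact absurd (h.trans hpp).symm hpq
      · exact h
    subst hpp hqq
    have hττ : τ ≠ τ' := fun e => hne ⟨e, rfl, rfl⟩
    have hτ' : τ' ≠ 1 := fun e => hpq (h2.2 e)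
    have hdq : d q = 0 := by
      refine hN.cancel (c := coef τ - coef τ') ?_ ?_
      · clear * - hττ hτ hτ'
        revert τ τ'
        decide
      · push_cast
        linear_combination he - he'
    refine ⟨?_, hdq⟩
    simpa [hdq] using he
  · have hqp : p = q' := by
      rcases hc with h | h
      · exact absurd (h.trans hpp) hpq
      · exact h
    subst hpp hqp
    have hτ' : τ' ≠ 1 := fun e => hpq (h2.2 e).symm
    have hdq : d p = 0 := by
      refine hN.cancel (c := 1 - coef τ * coef τ') ?_ ?_
      · have : ¬ (τ = τ' ∧ (τ = 0 ∨ τ = 2)) := fun h => hsw ⟨h.1, h.2, rfl, rfl⟩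
        clear * - this hτ hτ'
        revert τ τ'
        decide
      · push_cast
        linear_combination he - coef τ * he'
    refine ⟨hdq, ?_⟩
    simpa [hdq] using he'

lemma card_independent_le (hN : SmallUnits N) {τ τ' : Fin 4} {p q p' q' : S}
    (h1 : p = q ↔ τ = 1) (h2 : p' = q' ↔ τ' = 1)
    (hne : ¬ (τ = τ' ∧ p = p' ∧ q = q'))
    (hsw : ¬ (τ = τ' ∧ (τ = 0 ∨ τ = 2) ∧ p = q' ∧ q = p')) (u v : ZMod N) :
    (univ.filter fun g : S → ZMod N => g p + coef τ * g q = u ∧ g p' + coef τ' * g q' = v).card ≤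
      N ^ (Fintype.card S - 2) := by
  obtain ⟨e, f, hef, h⟩ := exists_coordinates hN h1 h2 hne hsw
  rw [← card_pair hef, ← card_zero_set]
  refine card_le_card_of_injOn (zeroAt e f) (fun g _ => ?_) fun g hg g' hg' he => ?_
  · simp only [coe_filter, mem_univ, true_and, Set.mem_ofPred_eq, mem_insert, mem_singleton]
    rintro t (rfl | rfl)
    · exact zeroAt_apply_left _ _ _
    · exact zeroAt_apply_right _ _ _
  · simp only [coe_filter, mem_univ, true_and, Set.mem_ofPred_eq] at hg hg'
    have := h (fun t => g t - g' t) (fun t ht ht' => by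
        rw [← zeroAt_of_ne ht ht' g, he, zeroAt_of_ne ht ht' g', sub_self])
      (by linear_combination hg.1 - hg'.1) (by linear_combination hg.2 - hg'.2)
    exact eq_of_zeroAt he (sub_eq_zero.1 this.1) (sub_eq_zero.1 this.2)

lemma card_functional_le {τ : Fin 4} {p q : S} (h1 : p = q ↔ τ = 1) (u : ZMod N) :
    (univ.filter fun g : S → ZMod N => g p + coef τ * g q = u).card ≤
      N ^ (Fintype.card S - 1) := by
  rw [← card_singleton p, ← card_zero_set]
  refine card_le_card_of_injOn (zeroAt p p) (fun g _ => ?_) fun g hg g' hg' he => ?_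
  · simp [zeroAt_apply_left]
  · simp only [coe_filter, mem_univ, true_and, Set.mem_ofPred_eq] at hg hg'
    have hp : g p = g' p := by
      by_cases hpq : p = q
      · subst hpq
        rw [h1.1 rfl] at hg hg'
        simp only [coef, Matrix.cons_val_one, Matrix.cons_val_zero, Int.cast_zero, zero_mul,
          add_zero] at hg hg'
        rw [hg, hg']
      · have : g q = g' q := by
          rw [← zeroAt_of_ne (Ne.symm hpq) (Ne.symm hpq) g, he,
            zeroAt_of_ne (Ne.symm hpq) (Ne.symm hpq) g']
        rw [this] at hg
        linear_combination hg - hg'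
    exact eq_of_zeroAt he hp hp

end Counting

section Keys

variable {F S Q B : Type} [Fintype F] [DecidableEq F] [Fintype S] [DecidableEq S]
  [Fintype Q] [DecidableEq Q] [Fintype B] [DecidableEq B]

namespace Frame

variable (Φ : Frame F S Q B) {N : ℕ} [NeZero N]

/-- A pair of slots of the frame `f` on which a key of type `τ` may be read off. -/
def Valid (f : F) (τ : Fin 4) (p q : S) : Prop :=
  Φ.act f p ∧ Φ.act f q ∧ (p = q ↔ τ = 1)

/-- The blocks `x` and `y` have the same key of type `τ`. -/
def SameKey (τ : Fin 4) (x : F × (S → ZMod N)) (p q : S) (y : F × (S → ZMod N)) (p' q' : S) :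
    Prop :=
  (τ ≠ 0 → Φ.col x.1 = Φ.col y.1) ∧ Φ.base x.1 p = Φ.base y.1 p' ∧
    Φ.base x.1 q = Φ.base y.1 q' ∧ x.2 p + coef τ * x.2 q = y.2 p' + coef τ * y.2 q'

variable {Φ}

lemma Valid.swap {f : F} {τ : Fin 4} {p q : S} (h : Φ.Valid f τ p q) : Φ.Valid f τ q p :=
  ⟨h.2.1, h.1, eq_comm.trans h.2.2⟩

lemma SameKey.symm {τ : Fin 4} {x y : F × (S → ZMod N)} {p q p' q' : S}
    (h : Φ.SameKey τ x p q y p' q') : Φ.SameKey τ y p' q' x p q :=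
  ⟨fun hτ => (h.1 hτ).symm, h.2.1.symm, h.2.2.1.symm, h.2.2.2.symm⟩

lemma SameKey.trans {τ : Fin 4} {x y w : F × (S → ZMod N)} {p q p' q' p'' q'' : S}
    (h : Φ.SameKey τ x p q y p' q') (h' : Φ.SameKey τ y p' q' w p'' q'') :
    Φ.SameKey τ x p q w p'' q'' :=
  ⟨fun hτ => (h.1 hτ).trans (h'.1 hτ), h.2.1.trans h'.2.1, h.2.2.1.trans h'.2.2.1,
    h.2.2.2.trans h'.2.2.2⟩

lemma SameKey.swap {τ : Fin 4} (hτ : τ = 0 ∨ τ = 2) {x y : F × (S → ZMod N)} {p q p' q' : S}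
    (h : Φ.SameKey τ x p q y p' q') : Φ.SameKey τ x q p y q' p' := by
  refine ⟨h.1, h.2.2.1, h.2.1, ?_⟩
  have := h.2.2.2
  rcases hτ with rfl | rfl
  · simp only [coef, Matrix.cons_val_zero, Int.cast_neg, Int.cast_one] at this ⊢
    linear_combination -this
  · simp only [coef, Matrix.cons_val, Int.cast_one] at this ⊢
    linear_combination this

variable (Φ)

open scoped Classical in
/-- The blocks sharing with `x` the key read off at `ρ`. -/
noncomputable def nbr (ρ : Fin 4 × S × S) (x : F × (S → ZMod N)) : Finset (F × (S → ZMod N)) :=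
  univ.filter fun y => y ≠ x ∧ Φ.Valid x.1 ρ.1 ρ.2.1 ρ.2.2 ∧
    ((ρ.1 = 0 ∨ ρ.1 = 2) → Fintype.equivFin S ρ.2.1 < Fintype.equivFin S ρ.2.2) ∧
    ∃ p q, Φ.Valid y.1 ρ.1 p q ∧ Φ.SameKey ρ.1 x ρ.2.1 ρ.2.2 y p q

variable {Φ}

lemma mem_nbr {τ : Fin 4} {p q : S} {x y : F × (S → ZMod N)} :
    y ∈ Φ.nbr (τ, p, q) x ↔ y ≠ x ∧ Φ.Valid x.1 τ p q ∧
      ((τ = 0 ∨ τ = 2) → Fintype.equivFin S p < Fintype.equivFin S q) ∧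
      ∃ p' q', Φ.Valid y.1 τ p' q' ∧ Φ.SameKey τ x p q y p' q' := by
  simp [nbr]

lemma exists_mem_nbr {τ : Fin 4} {p q p' q' : S} {x y : F × (S → ZMod N)} (hxy : y ≠ x)
    (hx : Φ.Valid x.1 τ p q) (hy : Φ.Valid y.1 τ p' q') (h : Φ.SameKey τ x p q y p' q') :
    ∃ ρ, y ∈ Φ.nbr ρ x := by
  by_cases hτ : (τ = 0 ∨ τ = 2)
  · have hpq : p ≠ q := by
      rintro rfl
      have := hx.2.2.1 rfl
      subst this
      revert hτ
      decide
    rcases lt_or_gt_of_ne fun e => hpq ((Fintype.equivFin S).injective e) with hlt | hlt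
    · exact ⟨(τ, p, q), mem_nbr.2 ⟨hxy, hx, fun _ => hlt, p', q', hy, h⟩⟩
    · exact ⟨(τ, q, p), mem_nbr.2 ⟨hxy, hx.swap, fun _ => hlt, q', p', hy.swap, h.swap hτ⟩⟩
  · exact ⟨(τ, p, q), mem_nbr.2 ⟨hxy, hx, fun h => absurd h hτ, p', q', hy, h⟩⟩

lemma nbr_symm (ρ : Fin 4 × S × S) (x y : F × (S → ZMod N)) (h : y ∈ Φ.nbr ρ x) :
    ∃ ρ', x ∈ Φ.nbr ρ' y := by
  obtain ⟨τ, p, q⟩ := ρ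
  obtain ⟨hne, hx, -, p', q', hy, hk⟩ := mem_nbr.1 h
  exact exists_mem_nbr hne.symm hy hx hk.symm

open scoped Classical in
lemma card_nbr_le {D₀ : ℕ}
    (hinc : ∀ c β, (univ.filter fun t : F × S =>
      Φ.act t.1 t.2 ∧ Φ.col t.1 = c ∧ Φ.base t.1 t.2 = β).card ≤ D₀)
    (hdiff : ∀ β β', (univ.filter fun t : F × S × S => t.2.1 ≠ t.2.2 ∧ Φ.act t.1 t.2.1 ∧
      Φ.act t.1 t.2.2 ∧ Φ.base t.1 t.2.1 = β ∧ Φ.base t.1 t.2.2 = β').card ≤ D₀)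
    (ρ : Fin 4 × S × S) (x : F × (S → ZMod N)) :
    (Φ.nbr ρ x).card ≤ D₀ * N ^ (Fintype.card S - 1) := by
  obtain ⟨τ, p, q⟩ := ρ
  set T : Finset (F × S × S) := univ.filter fun t => Φ.Valid t.1 τ t.2.1 t.2.2 ∧
    (τ ≠ 0 → Φ.col x.1 = Φ.col t.1) ∧ Φ.base x.1 p = Φ.base t.1 t.2.1 ∧
    Φ.base x.1 q = Φ.base t.1 t.2.2 with hT
  have hTc : T.card ≤ D₀ := by
    by_cases hτ : τ = 1
    · refine le_trans ?_ (hinc (Φ.col x.1) (Φ.base x.1 p))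
      refine card_le_card_of_injOn (fun t => (t.1, t.2.1)) (fun t ht => ?_) fun t ht t' ht' he => ?_
      · simp only [hT, coe_filter, mem_univ, true_and, Set.mem_ofPred_eq] at ht ⊢
        exact ⟨ht.1.1, (ht.2.1 (by rw [hτ]; decide)).symm, ht.2.2.1.symm⟩
      · simp only [hT, coe_filter, mem_univ, true_and, Set.mem_ofPred_eq] at ht ht'
        have h1 := ht.1.2.2.2 hτ
        have h2 := ht'.1.2.2.2 hτ
        obtain ⟨t1, t2, t3⟩ := t
        obtain ⟨s1, s2, s3⟩ := t'
        simp_all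
    · refine le_trans (card_le_card fun t ht => ?_) (hdiff (Φ.base x.1 p) (Φ.base x.1 q))
      simp only [hT, mem_filter, mem_univ, true_and] at ht ⊢
      exact ⟨fun e => hτ (ht.1.2.2.1 e), ht.1.1, ht.1.2.1, ht.2.2.1.symm, ht.2.2.2.symm⟩
  have hsub : Φ.nbr (τ, p, q) x ⊆ T.biUnion fun t =>
      (univ.filter fun g : S → ZMod N => g t.2.1 + coef τ * g t.2.2 = x.2 p + coef τ * x.2 q).image
        fun g => (t.1, g) := by
    intro y hy
    obtain ⟨-, hx, -, p', q', hy, hk⟩ := mem_nbr.1 hy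
    simp only [mem_biUnion, mem_image, mem_filter, mem_univ, true_and, hT]
    exact ⟨(y.1, p', q'), ⟨hy, hk.1, hk.2.1, hk.2.2.1⟩, y.2, hk.2.2.2.symm, rfl⟩
  refine (card_le_card hsub).trans (card_biUnion_le.trans ?_)
  calc _ ≤ ∑ t ∈ T, N ^ (Fintype.card S - 1) := by
        refine sum_le_sum fun t ht => card_image_le.trans ?_
        simp only [hT, mem_filter, mem_univ, true_and] at ht
        exact card_functional_le ht.1.2.2 _
    _ = T.card * N ^ (Fintype.card S - 1) := by simp
    _ ≤ _ := Nat.mul_le_mul_right _ hTc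

open scoped Classical in
lemma card_two_keys_le (hN : SmallUnits N) (τ τ' : Fin 4) (u v : ZMod N) :
    (univ.filter fun y : F × (S → ZMod N) => ∃ p q p' q', (p = q ↔ τ = 1) ∧ (p' = q' ↔ τ' = 1) ∧
      ¬ (τ = τ' ∧ p = p' ∧ q = q') ∧ ¬ (τ = τ' ∧ (τ = 0 ∨ τ = 2) ∧ p = q' ∧ q = p') ∧
      y.2 p + coef τ * y.2 q = u ∧ y.2 p' + coef τ' * y.2 q' = v).card ≤
      Fintype.card F * Fintype.card S ^ 4 * N ^ (Fintype.card S - 2) := by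
  set T : Finset (F × S × S × S × S) := univ.filter fun t =>
    (t.2.1 = t.2.2.1 ↔ τ = 1) ∧ (t.2.2.2.1 = t.2.2.2.2 ↔ τ' = 1) ∧
      ¬ (τ = τ' ∧ t.2.1 = t.2.2.2.1 ∧ t.2.2.1 = t.2.2.2.2) ∧
      ¬ (τ = τ' ∧ (τ = 0 ∨ τ = 2) ∧ t.2.1 = t.2.2.2.2 ∧ t.2.2.1 = t.2.2.2.1) with hT
  have hTc : T.card ≤ Fintype.card F * Fintype.card S ^ 4 := by
    refine (card_le_univ T).trans (le_of_eq ?_)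
    simp only [Fintype.card_prod]
    ring
  refine le_trans (card_le_card (t := T.biUnion fun t => (univ.filter fun g : S → ZMod N =>
      g t.2.1 + coef τ * g t.2.2.1 = u ∧ g t.2.2.2.1 + coef τ' * g t.2.2.2.2 = v).image
        fun g => (t.1, g)) fun y hy => ?_) (card_biUnion_le.trans ?_)
  · simp only [mem_filter, mem_univ, true_and] at hy
    obtain ⟨p, q, p', q', h1, h2, h3, h4, h5, h6⟩ := hy
    simp only [mem_biUnion, mem_image, mem_filter, mem_univ, true_and, hT]
    exact ⟨(y.1, p, q, p', q'), ⟨h1, h2, h3, h4⟩, y.2, ⟨h5, h6⟩, rfl⟩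
  · calc _ ≤ ∑ t ∈ T, N ^ (Fintype.card S - 2) := by
          refine sum_le_sum fun t ht => card_image_le.trans ?_
          simp only [hT, mem_filter, mem_univ, true_and] at ht
          exact card_independent_le hN ht.1 ht.2.1 ht.2.2.1 ht.2.2.2 _ _
      _ = T.card * N ^ (Fintype.card S - 2) := by simp
      _ ≤ _ := Nat.mul_le_mul_right _ hTc

lemma card_nbr_inter_le (hN : SmallUnits N) {ρ ρ' : Fin 4 × S × S} (hρ : ρ ≠ ρ')
    (x : F × (S → ZMod N)) : (Φ.nbr ρ x ∩ Φ.nbr ρ' x).card ≤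
      Fintype.card F * Fintype.card S ^ 4 * N ^ (Fintype.card S - 2) := by
  classical
  obtain ⟨τ, p, q⟩ := ρ
  obtain ⟨τ', p', q'⟩ := ρ'
  refine le_trans (card_le_card fun y hy => ?_)
    (card_two_keys_le hN τ τ' (x.2 p + coef τ * x.2 q) (x.2 p' + coef τ' * x.2 q'))
  obtain ⟨hy1, hy2⟩ := mem_inter.1 hy
  obtain ⟨-, hx, hord, r, s, hy, hk⟩ := mem_nbr.1 hy1
  obtain ⟨-, hx', hord', r', s', hy', hk'⟩ := mem_nbr.1 hy2
  simp only [mem_filter, mem_univ, true_and]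
  refine ⟨r, s, r', s', hy.2.2, hy'.2.2, ?_, ?_, hk.2.2.2.symm, hk'.2.2.2.symm⟩
  · rintro ⟨rfl, rfl, rfl⟩
    have h1 := Φ.base_inj x.1 p p' hx.1 hx'.1 (hk.2.1.trans hk'.2.1.symm)
    have h2 := Φ.base_inj x.1 q q' hx.2.1 hx'.2.1 (hk.2.2.1.trans hk'.2.2.1.symm)
    exact hρ (by rw [h1, h2])
  · rintro ⟨rfl, hτ, rfl, rfl⟩
    have h1 := Φ.base_inj x.1 p q' hx.1 hx'.2.1 (hk.2.1.trans hk'.2.2.1.symm)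
    have h2 := Φ.base_inj x.1 q p' hx.2.1 hx'.1 (hk.2.2.1.trans hk'.2.1.symm)
    have h3 := hord hτ
    have h4 := hord' hτ
    rw [h1, h2] at h3
    exact lt_asymm h3 h4

open scoped Classical in
lemma card_nbr_common_le (hN : SmallUnits N) (ρ : Fin 4 × S × S) (x u : F × (S → ZMod N))
    (hux : u ≠ x) (hu : u ∉ Φ.nbr ρ x) :
    ((Φ.nbr ρ x).filter fun v => ∃ ρ', v ∈ Φ.nbr ρ' u).card ≤
      (4 * Fintype.card S ^ 2) *
        (Fintype.card F * Fintype.card S ^ 4 * N ^ (Fintype.card S - 2)) := by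
  obtain ⟨τ, p, q⟩ := ρ
  refine le_trans (card_le_card (t := (univ : Finset (Fin 4 × S × S)).biUnion fun ρ' =>
    (univ.filter fun y : F × (S → ZMod N) => ∃ r s r' s', (r = s ↔ τ = 1) ∧ (r' = s' ↔ ρ'.1 = 1) ∧
      ¬ (τ = ρ'.1 ∧ r = r' ∧ s = s') ∧ ¬ (τ = ρ'.1 ∧ (τ = 0 ∨ τ = 2) ∧ r = s' ∧ s = r') ∧
      y.2 r + coef τ * y.2 s = x.2 p + coef τ * x.2 q ∧
      y.2 r' + coef ρ'.1 * y.2 s' = u.2 ρ'.2.1 + coef ρ'.1 * u.2 ρ'.2.2)) fun v hv => ?_)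
    (card_biUnion_le.trans ?_)
  · obtain ⟨hv1, ⟨τ', p', q'⟩, hv2⟩ := mem_filter.1 hv
    obtain ⟨-, hx, hord, r, s, hy, hk⟩ := mem_nbr.1 hv1
    obtain ⟨-, hx', -, r', s', hy', hk'⟩ := mem_nbr.1 hv2
    simp only [mem_biUnion, mem_filter, mem_univ, true_and]
    refine ⟨(τ', p', q'), r, s, r', s', hy.2.2, hy'.2.2, ?_, ?_, hk.2.2.2.symm, hk'.2.2.2.symm⟩
    · rintro ⟨rfl, rfl, rfl⟩
      exact hu (mem_nbr.2 ⟨hux, hx, hord, p', q', hx', hk.trans hk'.symm⟩)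
    · rintro ⟨rfl, hτ, rfl, rfl⟩
      exact hu (mem_nbr.2 ⟨hux, hx, hord, q', p', hx'.swap, hk.trans (hk'.swap hτ).symm⟩)
  · refine (sum_le_sum fun ρ' _ => card_two_keys_le hN τ ρ'.1 _ _).trans (le_of_eq ?_)
    simp only [sum_const, card_univ, Fintype.card_prod, Fintype.card_fin, smul_eq_mul]
    ring

end Frame

end Keys

lemma cyclic_induction {n : ℕ} {P : Fin (n + 1) → Prop} {b : Fin (n + 1)} (hb : P b)
    (hs : ∀ t, P t → P (t + 1)) (t : Fin (n + 1)) : P t := by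
  have h : ∀ i : ℕ, P (b + Fin.ofNat (n + 1) i) := by
    intro i
    induction i with
    | zero => simpa using hb
    | succ i ih =>
      have e : b + Fin.ofNat (n + 1) (i + 1) = b + Fin.ofNat (n + 1) i + 1 := by
        rw [add_assoc]
        congr 1
        ext
        simp [Fin.val_add]
      rw [e]
      exact hs _ ih
  have e : b + Fin.ofNat (n + 1) ((t - b : Fin (n + 1)) : ℕ) = t := by
    rw [Fin.ofNat_val_eq_self]
    exact add_sub_cancel b t
  rw [← e]
  exact h _

/-- The multiples of the shift that occur in a conflict. -/
def mult : Fin 4 → ℤ := ![1, -1, 2, -2]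

section Conflicts

variable {F S Q B : Type} [Fintype F] [DecidableEq F] [Fintype S] [DecidableEq S]
  [Fintype Q] [DecidableEq Q] [Fintype B] [DecidableEq B]

lemma SmallUnits.mult_cancel {N : ℕ} [NeZero N] (hN : SmallUnits N) (s : Fin 4) {z z' : ZMod N}
    (h : (mult s : ZMod N) * z = mult s * z') : z = z' := by
  refine sub_eq_zero.1 (hN.cancel (c := mult s) ?_ (by rw [mul_sub, h, sub_self]))
  fin_cases s <;> simp [mult]

namespace Frame

variable (Φ : Frame F S Q B) {N : ℕ} [NeZero N]

/-- A closed chain of blocks: going from the exit slot of each block to the entry slot of the next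
one moves by a small multiple of a common shift `z`. -/
structure Chain {n : ℕ} (e h : Fin (n + 1) → S) (s : Fin (n + 1) → Fin 4) (z : ZMod N)
    (x : Fin (n + 1) → F × (S → ZMod N)) : Prop where
  inj : Function.Injective x
  ne : ∀ t, e t ≠ h t
  act_entry : ∀ t, Φ.act (x t).1 (e t)
  act_exit : ∀ t, Φ.act (x t).1 (h t)
  step : ∀ t, (x (t + 1)).2 (e (t + 1)) - (x t).2 (h t) = mult (s t) * z

open scoped Classical in
/-- The vertex sets of the chains with at least three and at most `J` blocks. -/
noncomputable def conflicts (N : ℕ) [NeZero N] (J : ℕ) : Finset (Finset (F × (S → ZMod N))) :=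
  univ.filter fun L => ∃ n, 2 ≤ n ∧ n + 1 ≤ J ∧ ∃ (e h : Fin (n + 1) → S)
    (s : Fin (n + 1) → Fin 4) (z : ZMod N) (x : Fin (n + 1) → F × (S → ZMod N)),
    Φ.Chain e h s z x ∧ L = univ.image x

variable {Φ}

lemma mem_conflicts {J : ℕ} {L : Finset (F × (S → ZMod N))} :
    L ∈ Φ.conflicts N J ↔ ∃ n, 2 ≤ n ∧ n + 1 ≤ J ∧ ∃ (e h : Fin (n + 1) → S)
    (s : Fin (n + 1) → Fin 4) (z : ZMod N) (x : Fin (n + 1) → F × (S → ZMod N)),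
    Φ.Chain e h s z x ∧ L = univ.image x := by
  simp [conflicts]

lemma Chain.card_image {n : ℕ} {e h : Fin (n + 1) → S} {s : Fin (n + 1) → Fin 4} {z : ZMod N}
    {x : Fin (n + 1) → F × (S → ZMod N)} (hx : Φ.Chain e h s z x) :
    (univ.image x).card = n + 1 := by
  rw [card_image_of_injective _ hx.inj, card_univ, Fintype.card_fin]

lemma Chain.rotate {n : ℕ} {e h : Fin (n + 1) → S} {s : Fin (n + 1) → Fin 4} {z : ZMod N}
    {x : Fin (n + 1) → F × (S → ZMod N)} (hx : Φ.Chain e h s z x) (r : Fin (n + 1)) :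
    Φ.Chain (fun t => e (t + r)) (fun t => h (t + r)) (fun t => s (t + r)) z fun t => x (t + r) where
  inj := fun t t' e => add_right_cancel (hx.inj e)
  ne := fun t => hx.ne _
  act_entry := fun t => hx.act_entry _
  act_exit := fun t => hx.act_exit _
  step := fun t => by
    have := hx.step (t + r)
    rwa [add_right_comm] at this

/-- Set the coordinates in `U` to zero. -/
def clear (U : Finset S) (g : S → ZMod N) : S → ZMod N := fun t => if t ∈ U then 0 else g t

lemma eq_of_clear {U : Finset S} {g g' : S → ZMod N} (h : clear U g = clear U g')
    (hU : ∀ u ∈ U, g u = g' u) : g = g' := by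
  funext t
  by_cases ht : t ∈ U
  · exact hU t ht
  · simpa [clear, ht] using congrFun h t

/-- The coordinates of the block at position `t` that are determined by the blocks in `P` and by
the preceding block. -/
def forced {n : ℕ} (e h : Fin (n + 1) → S) (P : Finset (Fin (n + 1))) (t : Fin (n + 1)) :
    Finset S :=
  if t + 1 ∈ P then {e t, h t} else {e t}

open scoped Classical in
lemma card_chains_le_prod (hN : SmallUnits N) {n : ℕ} (e h : Fin (n + 1) → S)
    (s : Fin (n + 1) → Fin 4) (P : Finset (Fin (n + 1))) (hP : P.Nonempty)
    (y : Fin (n + 1) → F × (S → ZMod N)) :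
    (univ.filter fun w : ZMod N × (Fin (n + 1) → F × (S → ZMod N)) =>
      Φ.Chain e h s w.1 w.2 ∧ ∀ t ∈ P, w.2 t = y t).card ≤
    (if ∃ t ∈ P, t + 1 ∈ P then 1 else N) *
      ∏ t, if t ∈ P then 1 else
        Fintype.card F * N ^ (Fintype.card S - (forced e h P t).card) := by
  set Z : Finset (ZMod N) := if ∃ t ∈ P, t + 1 ∈ P then {0} else univ with hZ
  set Y : Fin (n + 1) → Finset (F × (S → ZMod N)) := fun t => if t ∈ P then {y t} else
    univ ×ˢ (univ.filter fun g : S → ZMod N => ∀ u ∈ forced e h P t, g u = 0) with hY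
  have hcard : (Z ×ˢ Fintype.piFinset Y).card = (if ∃ t ∈ P, t + 1 ∈ P then 1 else N) *
      ∏ t, if t ∈ P then 1 else
        Fintype.card F * N ^ (Fintype.card S - (forced e h P t).card) := by
    rw [card_product, Fintype.card_piFinset]
    congr 1
    · rw [hZ]
      split_ifs <;> simp [ZMod.card]
    · refine prod_congr rfl fun t _ => ?_
      rw [hY]
      dsimp only
      split_ifs
      · simp
      · rw [card_product, card_zero_set, card_univ]
  rw [← hcard]
  refine card_le_card_of_injOn (fun w => (if ∃ t ∈ P, t + 1 ∈ P then 0 else w.1,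
    fun t => if t ∈ P then y t else ((w.2 t).1, clear (forced e h P t) (w.2 t).2)))
    (fun w hw => ?_) ?_
  · simp only [coe_product, Set.mem_prod, mem_coe, Fintype.mem_piFinset]
    refine ⟨?_, fun t => ?_⟩
    · rw [hZ]
      split_ifs <;> simp
    · rw [hY]
      dsimp only
      split_ifs
      · simp
      · simp +contextual [clear]
  · rintro ⟨z, x⟩ hw ⟨z', x'⟩ hw' heq
    simp only [coe_filter, mem_univ, true_and, Set.mem_ofPred_eq] at hw hw'
    obtain ⟨hx, hxP⟩ := hw
    obtain ⟨hx', hxP'⟩ := hw'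
    have hPP : ∀ t ∈ P, x t = x' t := fun t ht => (hxP t ht).trans (hxP' t ht).symm
    simp only [Prod.mk.injEq] at heq
    have hz : z = z' := by
      by_cases hadj : ∃ t ∈ P, t + 1 ∈ P
      · obtain ⟨t, ht, ht'⟩ := hadj
        refine hN.mult_cancel (s t) ?_
        rw [← hx.step t, ← hx'.step t, hPP t ht, hPP _ ht']
      · simpa [hadj] using heq.1
    subst hz
    obtain ⟨b, hb⟩ := hP
    have hall : ∀ t, x t = x' t := by
      refine cyclic_induction (hPP b hb) fun t ht => ?_
      by_cases htP : t + 1 ∈ P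
      · exact hPP _ htP
      have hc := congrFun heq.2 (t + 1)
      simp only [htP, if_false, Prod.mk.injEq] at hc
      refine Prod.ext hc.1 (eq_of_clear hc.2 ?_)
      have he : (x (t + 1)).2 (e (t + 1)) = (x' (t + 1)).2 (e (t + 1)) := by
        have h1 := hx.step t
        have h2 := hx'.step t
        rw [ht] at h1
        linear_combination h1 - h2
      intro u hu
      by_cases hnext : t + 1 + 1 ∈ P
      · simp only [forced, hnext, if_true, mem_insert, mem_singleton] at hu
        rcases hu with rfl | rfl
        · exact he
        · have h1 := hx.step (t + 1)
          have h2 := hx'.step (t + 1)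
          rw [hPP _ hnext] at h1
          linear_combination h2 - h1
      · simp only [forced, hnext, if_false, mem_singleton] at hu
        rw [hu]
        exact he
    rw [funext hall]

open scoped Classical in
lemma card_chains_mul_le (hN : SmallUnits N) (hS : 2 ≤ Fintype.card S) {n : ℕ}
    (e h : Fin (n + 1) → S) (heh : ∀ t, e t ≠ h t)
    (s : Fin (n + 1) → Fin 4) (P : Finset (Fin (n + 1))) (hP : P.Nonempty) (hPn : P.card < n + 1)
    (y : Fin (n + 1) → F × (S → ZMod N)) :
    (univ.filter fun w : ZMod N × (Fin (n + 1) → F × (S → ZMod N)) =>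
      Φ.Chain e h s w.1 w.2 ∧ ∀ t ∈ P, w.2 t = y t).card * (if 2 ≤ P.card then N else 1) ≤
    (Fintype.card F * N ^ (Fintype.card S - 1)) ^ (n + 1 - P.card) := by
  have hN0 : 0 < N := Nat.pos_of_ne_zero (NeZero.ne N)
  set G := (univ.filter fun w : ZMod N × (Fin (n + 1) → F × (S → ZMod N)) =>
      Φ.Chain e h s w.1 w.2 ∧ ∀ t ∈ P, w.2 t = y t).card with hG
  set Zc := if ∃ t ∈ P, t + 1 ∈ P then 1 else N with hZc
  set runs := (univ.filter fun t => t ∉ P ∧ t + 1 ∈ P).card with hruns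
  have h1 := card_chains_le_prod (Φ := Φ) hN e h s P hP y
  rw [← hG, ← hZc] at h1
  have h2 : (∏ t, if t ∈ P then 1 else
        Fintype.card F * N ^ (Fintype.card S - (forced e h P t).card)) * N ^ runs =
      (Fintype.card F * N ^ (Fintype.card S - 1)) ^ (n + 1 - P.card) := by
    have e1 : N ^ runs = ∏ t, if t ∉ P ∧ t + 1 ∈ P then N else 1 := by
      rw [prod_ite, prod_const_one, mul_one, prod_const]
    have e2 : (Fintype.card F * N ^ (Fintype.card S - 1)) ^ (n + 1 - P.card) =
        ∏ t, if t ∈ P then 1 else Fintype.card F * N ^ (Fintype.card S - 1) := by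
      rw [prod_ite, prod_const_one, one_mul, prod_const]
      congr 1
      have : univ.filter (fun u => u ∉ P) = univ \ P := by
        ext u
        simp
      rw [this, card_sdiff_of_subset (subset_univ P), card_univ, Fintype.card_fin]
    rw [e1, e2, ← prod_mul_distrib]
    refine prod_congr rfl fun t _ => ?_
    by_cases ht : t ∈ P
    · simp [ht]
    · by_cases ht' : t + 1 ∈ P
      · simp only [ht, ht', if_false, if_true, not_false_eq_true, and_self, forced,
          card_pair (heh t)]
        rw [mul_assoc, ← pow_succ]
        congr 2
        omega
      · simp [ht, ht', forced]
  have hr1 : 1 ≤ runs := by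
    rw [hruns, Nat.succ_le_iff, card_pos]
    by_contra hne
    rw [not_nonempty_iff_eq_empty, filter_eq_empty_iff] at hne
    obtain ⟨b, hb⟩ := hP
    obtain ⟨c, hc⟩ : ∃ c, c ∉ P := by
      by_contra hall
      push Not at hall
      have : P = univ := eq_univ_iff_forall.2 hall
      rw [this, card_univ, Fintype.card_fin] at hPn
      exact lt_irrefl _ hPn
    exact cyclic_induction (P := fun t => t ∉ P) hc
      (fun t ht ht' => hne (mem_univ t) ⟨ht, ht'⟩) b hb
  have h3 : Zc * (if 2 ≤ P.card then N else 1) ≤ N ^ runs := by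
    by_cases hadj : ∃ t ∈ P, t + 1 ∈ P
    · rw [hZc, if_pos hadj, one_mul]
      refine le_trans ?_ (Nat.pow_le_pow_right hN0 hr1)
      rw [pow_one]
      split_ifs
      · exact le_rfl
      · exact hN0
    · have hrw : P.card ≤ runs := by
        refine card_le_card_of_injOn (fun t => t - 1) (fun t ht => ?_)
          fun t _ t' _ h => sub_left_inj.1 h
        simp only [coe_filter, mem_univ, true_and, Set.mem_ofPred_eq, sub_add_cancel]
        exact ⟨fun h => hadj ⟨t - 1, h, by rwa [sub_add_cancel]⟩, ht⟩
      rw [hZc, if_neg hadj]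
      split_ifs with h
      · rw [← sq]
        exact Nat.pow_le_pow_right hN0 (h.trans hrw)
      · rw [mul_one]
        exact Nat.le_self_pow (by omega) N
  refine Nat.le_of_mul_le_mul_right ?_ (pow_pos hN0 runs)
  calc _ ≤ Zc * (∏ t, if t ∈ P then 1 else
        Fintype.card F * N ^ (Fintype.card S - (forced e h P t).card)) *
        (if 2 ≤ P.card then N else 1) * N ^ runs := by gcongr
    _ = (Zc * (if 2 ≤ P.card then N else 1)) * ((∏ t, if t ∈ P then 1 else
        Fintype.card F * N ^ (Fintype.card S - (forced e h P t).card)) * N ^ runs) := by ring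
    _ ≤ _ := by
      rw [h2, mul_comm]
      gcongr

open scoped Classical in
lemma card_conflicts_le (hN : SmallUnits N) (hS : 2 ≤ Fintype.card S) (J : ℕ)
    (W : Finset (F × (S → ZMod N))) (hW : W.Nonempty) (j : ℕ) (hj : W.card < j) :
    ((Φ.conflicts N J).filter fun L => L.card = j ∧ W ⊆ L).card *
      (if 2 ≤ W.card then N else 1) ≤
    (Fintype.card S ^ J * Fintype.card S ^ J * 4 ^ J * 2 ^ J * J ^ J) *
      (Fintype.card F * N ^ (Fintype.card S - 1)) ^ (j - W.card) := by
  by_cases hjJ : J < j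
  · rw [filter_eq_empty_iff.2]
    · simp
    · rintro L hL ⟨hc, -⟩
      obtain ⟨n, hn, hnJ, e, h, s, z, x, hx, rfl⟩ := mem_conflicts.1 hL
      rw [hx.card_image] at hc
      omega
  obtain ⟨n, rfl⟩ : ∃ n, j = n + 1 := ⟨j - 1, by omega⟩
  set I : Finset ((Fin (n + 1) → S) × (Fin (n + 1) → S) × (Fin (n + 1) → Fin 4) ×
      Finset (Fin (n + 1)) × (Fin (n + 1) → W)) :=
    univ.filter fun i => (∀ t, i.1 t ≠ i.2.1 t) ∧ i.2.2.2.1.card = W.card with hI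
  have hIc : I.card ≤ Fintype.card S ^ J * Fintype.card S ^ J * 4 ^ J * 2 ^ J * J ^ J := by
    refine (card_le_univ I).trans ?_
    simp only [Fintype.card_prod, Fintype.card_fun, Fintype.card_fin, Fintype.card_finset,
      Fintype.card_coe]
    rw [← mul_assoc, ← mul_assoc, ← mul_assoc]
    gcongr <;> omega
  have hsub : ((Φ.conflicts N J).filter fun L => L.card = n + 1 ∧ W ⊆ L) ⊆ I.biUnion fun i =>
      (univ.filter fun w : ZMod N × (Fin (n + 1) → F × (S → ZMod N)) =>
        Φ.Chain i.1 i.2.1 i.2.2.1 w.1 w.2 ∧ ∀ t ∈ i.2.2.2.1, w.2 t = i.2.2.2.2 t).image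
        fun w => univ.image w.2 := by
    intro L hL
    obtain ⟨hL, hc, hWL⟩ := mem_filter.1 hL
    obtain ⟨n', hn, hnJ, e, h, s, z, x, hx, rfl⟩ := mem_conflicts.1 hL
    rw [hx.card_image] at hc
    obtain rfl : n' = n := by omega
    obtain ⟨w₀, hw₀⟩ := hW
    simp only [mem_biUnion, mem_image, mem_filter, mem_univ, true_and, hI]
    refine ⟨(e, h, s, univ.filter fun t => x t ∈ W,
      fun t => if ht : x t ∈ W then ⟨x t, ht⟩ else ⟨w₀, hw₀⟩), ⟨hx.ne, ?_⟩, (z, x),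
      ⟨hx, fun t ht => ?_⟩, rfl⟩
    · refine card_bij (fun t _ => x t) (fun t ht => (mem_filter.1 ht).2)
        (fun t _ t' _ h => hx.inj h) fun w hw => ?_
      obtain ⟨t, -, rfl⟩ := mem_image.1 (hWL hw)
      exact ⟨t, by simpa using hw, rfl⟩
    · simp only [mem_filter, mem_univ, true_and] at ht
      simp [ht]
  calc _ ≤ (∑ i ∈ I, (univ.filter fun w : ZMod N × (Fin (n + 1) → F × (S → ZMod N)) =>
        Φ.Chain i.1 i.2.1 i.2.2.1 w.1 w.2 ∧ ∀ t ∈ i.2.2.2.1, w.2 t = i.2.2.2.2 t).card) *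
        (if 2 ≤ W.card then N else 1) := by
        refine Nat.mul_le_mul_right _ ((card_le_card hsub).trans (card_biUnion_le.trans ?_))
        exact sum_le_sum fun i _ => card_image_le
    _ ≤ ∑ i ∈ I, (Fintype.card F * N ^ (Fintype.card S - 1)) ^ (n + 1 - W.card) := by
        rw [sum_mul]
        refine sum_le_sum fun i hi => ?_
        obtain ⟨hne, hic⟩ := (mem_filter.1 hi).2
        have := card_chains_mul_le (Φ := Φ) hN hS i.1 i.2.1 hne i.2.2.1 i.2.2.2.1
          (card_pos.1 (by rw [hic]; exact card_pos.2 hW)) (by rw [hic]; exact hj)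
          (fun t => (i.2.2.2.2 t : F × (S → ZMod N)))
        rwa [hic] at this
    _ = I.card * (Fintype.card F * N ^ (Fintype.card S - 1)) ^ (n + 1 - W.card) := by simp
    _ ≤ _ := Nat.mul_le_mul_right _ hIc

end Frame

end Conflicts

section Completions

variable {F S Q B : Type} [Fintype F] [DecidableEq F] [Fintype S] [DecidableEq S]
  [Fintype Q] [DecidableEq Q] [Fintype B] [DecidableEq B]

namespace Frame

variable {Φ : Frame F S Q B} {N : ℕ} [NeZero N]

lemma eq_of_incidence {M : Finset (F × (S → ZMod N))}
    (hM : ∀ ρ, ∀ x ∈ M, ∀ y ∈ M, y ∉ Φ.nbr ρ x) {x y : F × (S → ZMod N)} (hx : x ∈ M) (hy : y ∈ M)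
    {p q : S} (hp : Φ.act x.1 p) (hq : Φ.act y.1 q) (hc : Φ.col x.1 = Φ.col y.1)
    (hb : Φ.base x.1 p = Φ.base y.1 q) (hg : x.2 p = y.2 q) : x = y := by
  by_contra hne
  obtain ⟨ρ, hρ⟩ := exists_mem_nbr (τ := 1) (Ne.symm hne) (⟨hp, hp, by simp⟩ : Φ.Valid x.1 1 p p)
    (⟨hq, hq, by simp⟩ : Φ.Valid y.1 1 q q) ⟨fun _ => hc, hb, hb, by rw [hg]⟩
  exact hM ρ x hx y hy hρ

open scoped Classical in
lemma card_completing_chains_le {M : Finset (F × (S → ZMod N))}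
    (hM : ∀ ρ, ∀ x ∈ M, ∀ y ∈ M, y ∉ Φ.nbr ρ x) (hS : 2 ≤ Fintype.card S) {n : ℕ} (hn : 2 ≤ n)
    (e h : Fin (n + 1) → S) (s : Fin (n + 1) → Fin 4) :
    (univ.filter fun w : ZMod N × (Fin (n + 1) → F × (S → ZMod N)) =>
      Φ.Chain e h s w.1 w.2 ∧ ∀ t ≠ 0, w.2 t ∈ M).card ≤
    (Fintype.card Q * Fintype.card B) ^ (n + 1) * (Fintype.card F * N ^ Fintype.card S) := by
  by_cases h0 : e 0 = h 0
  · rw [filter_eq_empty_iff.2]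
    · simp
    · rintro w - ⟨hw, -⟩
      exact hw.ne 0 h0
  set T : Finset (ZMod N × ZMod N × (Fin (n + 1) → Q × B) × F × (S → ZMod N)) :=
    univ ×ˢ univ ×ˢ univ ×ˢ univ ×ˢ
      univ.filter fun g : S → ZMod N => ∀ u ∈ ({e 0, h 0} : Finset S), g u = 0 with hT
  have hTc : T.card = (Fintype.card Q * Fintype.card B) ^ (n + 1) *
      (Fintype.card F * N ^ Fintype.card S) := by
    simp only [hT, card_product, card_univ, ZMod.card, Fintype.card_fun, Fintype.card_prod,
      Fintype.card_fin]
    rw [card_zero_set, card_pair h0]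
    obtain ⟨m, hm⟩ : ∃ m, Fintype.card S = m + 2 := ⟨_, (Nat.sub_add_cancel hS).symm⟩
    rw [hm, Nat.add_sub_cancel]
    ring
  rw [← hTc]
  have h10 : (1 : Fin (n + 1)) ≠ 0 := by
    obtain ⟨m, rfl⟩ : ∃ m, n = m + 1 := ⟨n - 1, by omega⟩
    exact one_ne_zero
  refine card_le_card_of_injOn (fun w => (w.1, (w.2 1).2 (e 1),
    (fun t => (Φ.col (w.2 t).1, Φ.base (w.2 t).1 (e t))), (w.2 0).1,
      clear {e 0, h 0} (w.2 0).2)) (fun w _ => ?_) ?_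
  · simp only [hT, coe_product, Set.mem_prod, coe_univ, Set.mem_univ, true_and, coe_filter,
      mem_univ, Set.mem_ofPred_eq]
    intro u hu
    simp [clear, hu]
  · rintro ⟨z, x⟩ hw ⟨z', x'⟩ hw' heq
    simp only [coe_filter, mem_univ, true_and, Set.mem_ofPred_eq] at hw hw'
    obtain ⟨hx, hxM⟩ := hw
    obtain ⟨hx', hxM'⟩ := hw'
    simp only [Prod.mk.injEq] at heq
    obtain ⟨rfl, hg, hcb, hf, hc⟩ := heq
    have hnext : ∀ t, t ≠ 0 → (x t).2 (e t) = (x' t).2 (e t) → x t = x' t := by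
      intro t ht hgt
      have := congrFun hcb t
      simp only [Prod.mk.injEq] at this
      exact eq_of_incidence hM (hxM t ht) (hxM' t ht) (hx.act_entry t) (hx'.act_entry t) this.1
        this.2 hgt
    have h1 : x 1 = x' 1 := hnext 1 h10 hg
    have hall : ∀ t, t ≠ 0 → x t = x' t := by
      refine cyclic_induction (b := 1) (fun _ => h1) fun t ht ht0 => ?_
      by_cases htz : t = 0
      · rw [htz, zero_add, h1]
      refine hnext _ ht0 ?_
      have e1 := hx.step t
      have e2 := hx'.step t
      rw [ht htz] at e1
      linear_combination e1 - e2
    have hzero : x 0 = x' 0 := by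
      refine Prod.ext hf (eq_of_clear hc ?_)
      intro u hu
      simp only [mem_insert, mem_singleton] at hu
      rcases hu with rfl | rfl
      · have e1 := hx.step (-1)
        have e2 := hx'.step (-1)
        rw [neg_add_cancel] at e1 e2
        rw [hall (-1) (neg_ne_zero.2 h10)] at e1
        linear_combination e1 - e2
      · have e1 := hx.step 0
        have e2 := hx'.step 0
        rw [zero_add] at e1 e2
        rw [h1] at e1
        linear_combination e2 - e1
    have : x = x' := by
      funext t
      by_cases ht : t = 0
      · rw [ht, hzero]
      · exact hall t ht
    rw [this]

open scoped Classical in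
lemma sum_completions_le {M : Finset (F × (S → ZMod N))}
    (hM : ∀ ρ, ∀ x ∈ M, ∀ y ∈ M, y ∉ Φ.nbr ρ x) (hS : 2 ≤ Fintype.card S) (J : ℕ) :
    ∑ x, ((Φ.conflicts N J).filter fun L => x ∈ L ∧ L.erase x ⊆ M).card ≤
      (J * (Fintype.card S ^ J * Fintype.card S ^ J * 4 ^ J) *
        (Fintype.card Q * Fintype.card B + 1) ^ J) * (Fintype.card F * N ^ Fintype.card S) := by
  have hsum : ∑ x, ((Φ.conflicts N J).filter fun L => x ∈ L ∧ L.erase x ⊆ M).card =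
      (univ.sigma fun x => (Φ.conflicts N J).filter fun L => x ∈ L ∧ L.erase x ⊆ M).card := by
    rw [card_sigma]
  rw [hsum]
  set T : ℕ → Finset (Σ _ : F × (S → ZMod N), Finset (F × (S → ZMod N))) := fun n =>
    (univ : Finset ((Fin (n + 1) → S) × (Fin (n + 1) → S) × (Fin (n + 1) → Fin 4))).biUnion
      fun i => (univ.filter fun w : ZMod N × (Fin (n + 1) → F × (S → ZMod N)) =>
        Φ.Chain i.1 i.2.1 i.2.2 w.1 w.2 ∧ ∀ t ≠ 0, w.2 t ∈ M).image
          fun w => ⟨w.2 0, univ.image w.2⟩ with hT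
  have hsub : (univ.sigma fun x => (Φ.conflicts N J).filter fun L => x ∈ L ∧ L.erase x ⊆ M) ⊆
      ((range J).filter fun n => 2 ≤ n).biUnion T := by
    rintro ⟨x₀, L⟩ hL
    simp only [mem_sigma, mem_univ, true_and, mem_filter] at hL
    obtain ⟨hL, hx₀, hLM⟩ := hL
    obtain ⟨n, hn, hnJ, e, h, s, z, x, hx, rfl⟩ := mem_conflicts.1 hL
    obtain ⟨r, -, rfl⟩ := mem_image.1 hx₀
    simp only [mem_biUnion, mem_filter, mem_range, hT, mem_univ, true_and, mem_image]
    refine ⟨n, ⟨by omega, hn⟩, (_, _, _), (z, fun t => x (t + r)), ⟨hx.rotate r, fun t ht => ?_⟩, ?_⟩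
    · refine hLM (mem_erase.2 ⟨fun h => ht ?_, mem_image_of_mem _ (mem_univ _)⟩)
      simpa using hx.inj h
    · simp only [zero_add, Sigma.mk.injEq, heq_eq_eq, true_and]
      ext y
      simp only [mem_image, mem_univ, true_and]
      constructor
      · rintro ⟨t, rfl⟩
        exact ⟨t + r, rfl⟩
      · rintro ⟨t, rfl⟩
        exact ⟨t - r, by rw [sub_add_cancel]⟩
  have hTn : ∀ n ∈ (range J).filter fun n => 2 ≤ n, (T n).card ≤
      (Fintype.card S ^ J * Fintype.card S ^ J * 4 ^ J) *
        ((Fintype.card Q * Fintype.card B + 1) ^ J * (Fintype.card F * N ^ Fintype.card S)) := by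
    intro n hn
    obtain ⟨hnJ, hn⟩ := mem_filter.1 hn
    have hnJ' := mem_range.1 hnJ
    refine card_biUnion_le.trans ((sum_le_sum fun i _ => card_image_le.trans
      (card_completing_chains_le hM hS hn i.1 i.2.1 i.2.2)).trans ?_)
    rw [sum_const, smul_eq_mul, card_univ]
    simp only [Fintype.card_prod, Fintype.card_fun, Fintype.card_fin]
    rw [← mul_assoc (Fintype.card S ^ (n + 1))]
    have : (Fintype.card Q * Fintype.card B) ^ (n + 1) ≤
        (Fintype.card Q * Fintype.card B + 1) ^ J :=
      (Nat.pow_le_pow_left (Nat.le_succ _) _).trans (Nat.pow_le_pow_right (Nat.succ_pos _) hnJ')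
    gcongr <;> omega
  refine (card_le_card hsub).trans (card_biUnion_le.trans ((sum_le_sum hTn).trans ?_))
  rw [sum_const, smul_eq_mul]
  have : ((range J).filter fun n => 2 ≤ n).card ≤ J := (card_filter_le _ _).trans (by simp)
  calc _ ≤ J * ((Fintype.card S ^ J * Fintype.card S ^ J * 4 ^ J) *
        ((Fintype.card Q * Fintype.card B + 1) ^ J * (Fintype.card F * N ^ Fintype.card S))) :=
        Nat.mul_le_mul_right _ this
    _ = _ := by ring

open scoped Classical in
/-- The blocks over a frame form a conflict system with error `1 / N`. -/
theorem exists_conflictSystem (Φ : Frame F S Q B) (hS : 2 ≤ Fintype.card S) {J D₀ : ℕ} (hJ : 2 ≤ J)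
    (hD : 1 ≤ D₀)
    (hinc : ∀ c β, (univ.filter fun t : F × S =>
      Φ.act t.1 t.2 ∧ Φ.col t.1 = c ∧ Φ.base t.1 t.2 = β).card ≤ D₀)
    (hdiff : ∀ β β', (univ.filter fun t : F × S × S => t.2.1 ≠ t.2.2 ∧ Φ.act t.1 t.2.1 ∧
      Φ.act t.1 t.2.2 ∧ Φ.base t.1 t.2.1 = β ∧ Φ.base t.1 t.2.2 = β').card ≤ D₀) :
    ∃ C : ℝ, 1 ≤ C ∧ ∀ (N : ℕ) [NeZero N], SmallUnits N →
      ConflictSystem (Φ.nbr (N := N)) (Φ.conflicts N J) J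
        (D₀ * (N : ℝ) ^ (Fintype.card S - 1)) (1 / N) C := by
  set f := Fintype.card F with hf
  set a := Fintype.card S with ha
  set c₁ := f * a ^ 4 with hc₁
  set c₂ := (4 * a ^ 2) * (f * a ^ 4) with hc₂
  set c₃ := (a ^ J * a ^ J * 4 ^ J * 2 ^ J * J ^ J) * (f + 1) ^ J with hc₃
  set c₄ := J * (a ^ J * a ^ J * 4 ^ J) * (Fintype.card Q * Fintype.card B + 1) ^ J with hc₄
  refine ⟨((1 + c₁ + c₂ + c₃ + c₄ : ℕ) : ℝ), by norm_cast; omega, fun N _ hN => ?_⟩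
  have hN0 : 0 < N := Nat.pos_of_ne_zero (NeZero.ne N)
  have hNr : (0 : ℝ) < N := by exact_mod_cast hN0
  have hDr : (1 : ℝ) ≤ D₀ := by exact_mod_cast hD
  set C : ℝ := ((1 + c₁ + c₂ + c₃ + c₄ : ℕ) : ℝ) with hC
  have hNe : (N : ℝ) ^ (a - 1) = N ^ (a - 2) * N := by
    rw [← pow_succ]
    congr 1
    omega
  have small : ∀ m c : ℕ, c ≤ 1 + c₁ + c₂ + c₃ + c₄ → m ≤ c * N ^ (a - 2) →
      (m : ℝ) ≤ C * (1 / N) * (D₀ * (N : ℝ) ^ (a - 1)) := by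
    intro m c hc hm
    have h1 : (m : ℝ) ≤ c * (N : ℝ) ^ (a - 2) := by exact_mod_cast hm
    have h2 : (c : ℝ) ≤ C := by
      rw [hC]
      exact_mod_cast hc
    have h3 : C * (1 / N) * (D₀ * (N : ℝ) ^ (a - 1)) = C * N ^ (a - 2) * D₀ := by
      rw [hNe]
      field_simp
    rw [h3]
    have h4 : (0 : ℝ) ≤ (N : ℝ) ^ (a - 2) := by positivity
    have h5 : (0 : ℝ) ≤ C := by positivity
    nlinarith [mul_le_mul_of_nonneg_right h2 h4, mul_nonneg h5 h4]
  have conf : ∀ (W : Finset (F × (S → ZMod N))) j, W.Nonempty → W.card < j →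
      (((Φ.conflicts N J).filter fun L => L.card = j ∧ W ⊆ L).card : ℝ) *
        (if 2 ≤ W.card then N else 1 : ℕ) ≤ C * (D₀ * (N : ℝ) ^ (a - 1)) ^ (j - W.card) := by
    intro W j hW hj
    by_cases hjJ : J < j
    · rw [filter_eq_empty_iff.2]
      · simp only [card_empty, Nat.cast_zero, zero_mul]
        positivity
      · rintro L hL ⟨hc, -⟩
        obtain ⟨n, hn, hnJ, e, h, s, z, x, hx, rfl⟩ := mem_conflicts.1 hL
        rw [hx.card_image] at hc
        omega
    have h1 := card_conflicts_le (Φ := Φ) hN hS J W hW j hj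
    have h2 : (a ^ J * a ^ J * 4 ^ J * 2 ^ J * J ^ J) * (f * N ^ (a - 1)) ^ (j - W.card) ≤
        c₃ * (D₀ * N ^ (a - 1)) ^ (j - W.card) := by
      rw [hc₃, mul_pow, mul_pow, ← mul_assoc, ← mul_assoc]
      have h3 : f ^ (j - W.card) ≤ (f + 1) ^ J * D₀ ^ (j - W.card) := by
        calc f ^ (j - W.card) ≤ (f + 1) ^ (j - W.card) := Nat.pow_le_pow_left (Nat.le_succ _) _
          _ ≤ (f + 1) ^ J := Nat.pow_le_pow_right (Nat.succ_pos _) (by omega)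
          _ ≤ _ := Nat.le_mul_of_pos_right _ (pow_pos hD _)
      refine Nat.mul_le_mul_right _ ?_
      rw [mul_assoc _ ((f + 1) ^ J)]
      exact Nat.mul_le_mul_left _ h3
    have h3 : (((Φ.conflicts N J).filter fun L => L.card = j ∧ W ⊆ L).card : ℝ) *
        (if 2 ≤ W.card then N else 1 : ℕ) ≤ c₃ * (D₀ * (N : ℝ) ^ (a - 1)) ^ (j - W.card) := by
      exact_mod_cast h1.trans h2
    refine h3.trans ?_
    have : (c₃ : ℝ) ≤ C := by
      rw [hC]
      exact_mod_cast (by omega : c₃ ≤ 1 + c₁ + c₂ + c₃ + c₄)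
    gcongr
  refine
    { one_le_delta_mul := ?_
      delta_pos := by positivity
      one_le_C := by rw [hC]; norm_cast; omega
      two_le_J := hJ
      irrefl := fun ρ x h => (mem_nbr (τ := ρ.1) (p := ρ.2.1) (q := ρ.2.2)).1 h |>.1 rfl
      symm := nbr_symm
      degree := fun ρ x => by exact_mod_cast card_nbr_le hinc hdiff ρ x
      inter := fun ρ ρ' x hρ => small _ c₁ (by omega) (card_nbr_inter_le hN hρ x)
      common := fun ρ x u hux hu => small _ c₂ (by omega) ?_
      three_le := ?_
      card_le := ?_
      conflict_degree := fun x j => ?_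
      conflict_codegree := fun W j hW hj => ?_
      completions := fun M hM => ?_ }
  · rw [hNe]
    have : (1 : ℝ) ≤ (N : ℝ) ^ (a - 2) := one_le_pow₀ (by exact_mod_cast hN0)
    have e : 1 / (N : ℝ) * (D₀ * (N ^ (a - 2) * N)) = D₀ * N ^ (a - 2) := by field_simp
    rw [e]
    nlinarith
  · refine le_trans (le_of_eq ?_) ((card_nbr_common_le hN ρ x u hux hu).trans (le_of_eq ?_))
    · congr
    · rw [hc₂]
      ring
  · intro L hL
    obtain ⟨n, hn, hnJ, e, h, s, z, x, hx, rfl⟩ := mem_conflicts.1 hL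
    rw [hx.card_image]
    omega
  · intro L hL
    obtain ⟨n, hn, hnJ, e, h, s, z, x, hx, rfl⟩ := mem_conflicts.1 hL
    rwa [hx.card_image]
  · by_cases hj : 1 < j
    · have := conf {x} j (singleton_nonempty x) (by simpa using hj)
      simp only [card_singleton, singleton_subset_iff] at this
      simpa using this
    · rw [filter_eq_empty_iff.2]
      · simp only [card_empty, Nat.cast_zero]
        positivity
      · rintro L hL ⟨hc, -⟩
        obtain ⟨n, hn, hnJ, e, h, s, z, x, hx, rfl⟩ := mem_conflicts.1 hL
        rw [hx.card_image] at hc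
        omega
  · have := conf W j (card_pos.1 (by omega)) hj
    rw [if_pos hW] at this
    rw [mul_assoc, mul_comm (1 / (N : ℝ)), ← mul_assoc, mul_one_div, le_div_iff₀ hNr]
    exact this
  · have h1 := sum_completions_le hM hS J
    have h2 : (Fintype.card (F × (S → ZMod N)) : ℝ) = f * (N : ℝ) ^ a := by
      simp [Fintype.card_prod, ZMod.card, hf, ha]
    rw [h2]
    have h3 : ∑ x, (((Φ.conflicts N J).filter fun L => x ∈ L ∧ L.erase x ⊆ M).card : ℝ) ≤
        c₄ * (f * (N : ℝ) ^ a) := by exact_mod_cast h1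
    refine (le_of_eq (by congr)).trans (h3.trans ?_)
    have : (c₄ : ℝ) ≤ C := by
      rw [hC]
      exact_mod_cast (by omega : c₄ ≤ 1 + c₁ + c₂ + c₃ + c₄)
    gcongr

end Frame

end Completions

section Pieces

variable {F S Q I : Type} [Fintype F] [DecidableEq F] [Fintype S] [DecidableEq S]
  [Fintype Q] [DecidableEq Q] [Fintype I] [DecidableEq I]

namespace Frame

variable (Φ : Frame F S Q (Bool × I)) {N : ℕ} [NeZero N]

/-- The set `M` of blocks contains no two blocks with a common key and no short chain. -/
structure Free (J : ℕ) (M : Finset (F × (S → ZMod N))) : Prop where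
  key : ∀ {x y : F × (S → ZMod N)}, x ∈ M → y ∈ M → ∀ {τ : Fin 4} {p q p' q' : S},
    Φ.Valid x.1 τ p q → Φ.Valid y.1 τ p' q' → Φ.SameKey τ x p q y p' q' → x = y
  chain : ∀ {n : ℕ}, 2 ≤ n → n + 1 ≤ J → ∀ {e h : Fin (n + 1) → S} {s : Fin (n + 1) → Fin 4}
    {z : ZMod N} {x : Fin (n + 1) → F × (S → ZMod N)}, Φ.Chain e h s z x → ∃ t, x t ∉ M

lemma free_of_links {J : ℕ} {M : Finset (F × (S → ZMod N))}
    (hM : ∀ L ∈ links (Φ.nbr (N := N)) (Φ.conflicts N J), ¬ L ⊆ M) : Φ.Free J M where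
  key := by
    intro x y hx hy τ p q p' q' hvx hvy hk
    by_contra hne
    obtain ⟨ρ, hρ⟩ := exists_mem_nbr (Ne.symm hne) hvx hvy hk
    refine hM {y, x} (mem_links.2 (Or.inr ⟨x, y, ρ, hρ, rfl⟩)) ?_
    simp [insert_subset_iff, hx, hy]
  chain := by
    intro n hn hnJ e h s z x hx
    by_contra hall
    push Not at hall
    refine hM (univ.image x) (mem_links.2 (Or.inl
      (mem_conflicts.2 ⟨n, hn, hnJ, e, h, s, z, x, hx, rfl⟩))) ?_
    intro y hy
    obtain ⟨t, -, rfl⟩ := mem_image.1 hy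
    exact hall t

/-- The slot of the translate of the block `x` by `t` at which the point `u` lies. -/
def At (x : F × (S → ZMod N)) (t : ZMod N) (p : S) (u : (Bool × I) × ZMod N) : Prop :=
  Φ.act x.1 p ∧ Φ.base x.1 p = u.1 ∧ x.2 p + t = u.2

variable {Φ}

lemma At.slot_eq {x : F × (S → ZMod N)} {t t' : ZMod N} {p q : S} {u v : (Bool × I) × ZMod N}
    (hp : Φ.At x t p u) (hq : Φ.At x t' q v) (huv : u.1 = v.1) : p = q :=
  Φ.base_inj x.1 p q hp.1 hq.1 (by rw [hp.2.1, hq.2.1, huv])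

lemma At.point_eq {x : F × (S → ZMod N)} {t : ZMod N} {p : S} {u v : (Bool × I) × ZMod N}
    (hp : Φ.At x t p u) (hq : Φ.At x t p v) : u = v :=
  Prod.ext (hp.2.1.symm.trans hq.2.1) (hp.2.2.symm.trans hq.2.2)

lemma At.slot_ne {x : F × (S → ZMod N)} {t : ZMod N} {p q : S} {u v : (Bool × I) × ZMod N}
    (hp : Φ.At x t p u) (hq : Φ.At x t q v) (huv : u ≠ v) : p ≠ q := by
  rintro rfl
  exact huv (hp.point_eq hq)

lemma At.shift_eq {x : F × (S → ZMod N)} {t t' : ZMod N} {p q : S} {u : (Bool × I) × ZMod N}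
    (hp : Φ.At x t p u) (hq : Φ.At x t' q u) : t = t' := by
  obtain rfl := hp.slot_eq hq rfl
  exact add_left_cancel (hp.2.2.trans hq.2.2.symm)

/-- A piece is either a translate of a block, or a single edge. -/
abbrev Piece (F S I : Type) (N : ℕ) : Type :=
  ((F × (S → ZMod N)) × ZMod N) ⊕ (((Bool × I) × ZMod N) × ((Bool × I) × ZMod N))

variable (Φ)

/-- The point `u` lies on the piece. -/
def On (u : (Bool × I) × ZMod N) : Piece F S I N → Prop
  | .inl b => ∃ p, Φ.At b.1 b.2 p u
  | .inr w => u = w.1 ∨ u = w.2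

/-- The colour of a piece. -/
def pieceCol : Piece F S I N → (Q × ZMod N) ⊕ ((Bool × I) × (Bool × I) × ZMod N)
  | .inl b => .inl (Φ.col b.1.1, b.2)
  | .inr w => .inr (w.1.1, w.2.1, w.2.2 - w.1.2)

/-- The pieces in use: translates of blocks in `M`, and edges not inside any of those. -/
def Used (M : Finset (F × (S → ZMod N))) : Piece F S I N → Prop
  | .inl b => b.1 ∈ M
  | .inr w => w.1.1.1 = false ∧ w.2.1.1 = true ∧
      ∀ x ∈ M, ∀ t, ¬ (Φ.On w.1 (.inl (x, t)) ∧ Φ.On w.2 (.inl (x, t)))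

variable {Φ} {J : ℕ} {M : Finset (F × (S → ZMod N))}

lemma Free.eq_of_pieceCol (hM : Φ.Free J M) {b b' : Piece F S I N} (hb : Φ.Used M b)
    (hb' : Φ.Used M b') (hc : Φ.pieceCol b = Φ.pieceCol b') {u : (Bool × I) × ZMod N}
    (hu : Φ.On u b) (hu' : Φ.On u b') : b = b' := by
  rcases b with ⟨x, t⟩ | ⟨v, w⟩ <;> rcases b' with ⟨x', t'⟩ | ⟨v', w'⟩
  · simp only [pieceCol, Sum.inl.injEq, Prod.mk.injEq] at hc
    obtain ⟨hc, rfl⟩ := hc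
    obtain ⟨p, hp⟩ := hu
    obtain ⟨q, hq⟩ := hu'
    have hbase : Φ.base x.1 p = Φ.base x'.1 q := hp.2.1.trans hq.2.1.symm
    have hval : x.2 p = x'.2 q := add_right_cancel (hp.2.2.trans hq.2.2.symm)
    have hxx : x = x' := hM.key hb hb' (τ := 1) (p := p) (q := p) (p' := q) (q' := q)
      ⟨hp.1, hp.1, by simp⟩
      ⟨hq.1, hq.1, by simp⟩ ⟨fun _ => hc, hbase, hbase, by rw [hval]⟩
    rw [hxx]
  · simp [pieceCol] at hc
  · simp [pieceCol] at hc
  · simp only [pieceCol, Sum.inr.injEq, Prod.mk.injEq] at hc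
    obtain ⟨h1, h2, h3⟩ := hc
    obtain ⟨l1, l2, -⟩ := hb
    obtain ⟨l1', l2', -⟩ := hb'
    simp only at l1 l2 l1' l2'
    rcases hu with rfl | rfl <;> rcases hu' with h | h
    · subst h
      rw [Sum.inr.injEq, Prod.mk.injEq]
      exact ⟨rfl, Prod.ext h2 (sub_left_inj.1 h3)⟩
    · rw [h, l2'] at l1
      exact absurd l1 (by decide)
    · rw [h, l1'] at l2
      exact absurd l2 (by decide)
    · subst h
      rw [Sum.inr.injEq, Prod.mk.injEq]
      exact ⟨Prod.ext h1 (sub_right_inj.1 h3), rfl⟩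

lemma Free.eq_of_two_points (hM : Φ.Free J M) {b b' : Piece F S I N} (hb : Φ.Used M b)
    (hb' : Φ.Used M b') {u v : (Bool × I) × ZMod N} (huv : u ≠ v)
    (hu : Φ.On u b) (hu' : Φ.On u b') (hv : Φ.On v b) (hv' : Φ.On v b') : b = b' := by
  have mixed : ∀ (x : F × (S → ZMod N)) t w w', x ∈ M → Φ.Used M (.inr (w, w')) →
      Φ.On u (.inl (x, t)) → Φ.On v (.inl (x, t)) → (u = w ∨ u = w') → (v = w ∨ v = w') →
      False := by
    rintro x t w w' hx hw h1 h2 (rfl | rfl) (rfl | rfl)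
    · exact huv rfl
    · exact hw.2.2 x hx t ⟨h1, h2⟩
    · exact hw.2.2 x hx t ⟨h2, h1⟩
    · exact huv rfl
  rcases b with ⟨x, t⟩ | ⟨w, w'⟩ <;> rcases b' with ⟨x', t'⟩ | ⟨y, y'⟩
  · obtain ⟨p, hp⟩ := hu
    obtain ⟨p', hp'⟩ := hu'
    obtain ⟨q, hq⟩ := hv
    obtain ⟨q', hq'⟩ := hv'
    have hxx : x = x' := by
      refine hM.key hb hb' (τ := 0) (p := p) (q := q) (p' := p') (q' := q')
        ⟨hp.1, hq.1, by simpa using hp.slot_ne hq huv⟩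
        ⟨hp'.1, hq'.1, by simpa using hp'.slot_ne hq' huv⟩
        ⟨fun h => absurd rfl h, hp.2.1.trans hp'.2.1.symm, hq.2.1.trans hq'.2.1.symm, ?_⟩
      simp only [coef, Matrix.cons_val_zero, Int.cast_neg, Int.cast_one]
      have h1 := hp.2.2.trans hp'.2.2.symm
      have h2 := hq.2.2.trans hq'.2.2.symm
      simp only at h1 h2
      linear_combination h1 - h2
    subst hxx
    have : t = t' := hp.shift_eq hp'
    rw [this]
  · exact (mixed x t y y' hb hb' hu hv hu' hv').elim
  · exact (mixed x' t' w w' hb' hb hu' hv' hu hv).elim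
  · obtain ⟨l1, l2, -⟩ := hb
    obtain ⟨l1', l2', -⟩ := hb'
    simp only at l1 l2 l1' l2'
    have cross : ∀ {w y : (Bool × I) × ZMod N}, w.1.1 = false → y.1.1 = true → w ≠ y := by
      rintro w y h1 h2 rfl
      rw [h1] at h2
      exact absurd h2 (by decide)
    rcases hu with rfl | rfl <;> rcases hv with rfl | rfl <;> rcases hu' with h | h <;>
      rcases hv' with h' | h'
    all_goals first
      | exact absurd rfl huv
      | exact absurd (h.trans h'.symm) huv
      | exact absurd h (cross l1 l2')
      | exact absurd h.symm (cross l1' l2)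
      | (subst h h'; rfl)

end Frame

end Pieces

section Loops

variable {F S Q I : Type} [Fintype F] [DecidableEq F] [Fintype S] [DecidableEq S]
  [Fintype Q] [DecidableEq Q] [Fintype I] [DecidableEq I]

namespace Frame

variable (Φ : Frame F S Q (Bool × I)) {N : ℕ} [NeZero N]

variable {Φ} {J : ℕ} {M : Finset (F × (S → ZMod N))}

lemma Free.no_segment (hM : Φ.Free J M) {n : ℕ} (hn : 2 ≤ n) (hnJ : n + 1 ≤ J)
    (x : ℕ → F × (S → ZMod N)) (e h : ℕ → S) (s : ℕ → Fin 4) (z : ZMod N)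
    (hx : ∀ t, x t ∈ M) (hinj : ∀ t t', t < t' → t' ≤ n → x t ≠ x t') (hne : ∀ t, e t ≠ h t)
    (he : ∀ t, Φ.act (x t).1 (e t)) (hh : ∀ t, Φ.act (x t).1 (h t))
    (hstep : ∀ t < n, (x (t + 1)).2 (e (t + 1)) - (x t).2 (h t) = mult (s t) * z)
    (hclose : (x 0).2 (e 0) - (x n).2 (h n) = mult (s n) * z) : False := by
  have hc : Φ.Chain (n := n) (fun t => e t) (fun t => h t) (fun t => s t) z fun t => x t := by
    refine ⟨fun t t' htt => ?_, fun t => hne t, fun t => he t, fun t => hh t, fun t => ?_⟩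
    · by_contra hne'
      rcases lt_or_gt_of_ne fun e => hne' (Fin.ext e) with h | h
      · exact hinj _ _ h (by omega) htt
      · exact hinj _ _ h (by omega) htt.symm
    · rcases eq_or_ne t (Fin.last n) with rfl | ht
      · simpa [Fin.last_add_one] using hclose
      · have hlt : t < Fin.last n := lt_of_le_of_ne (Fin.le_last t) ht
        rw [Fin.val_add_one_of_lt hlt]
        exact hstep t hlt
  obtain ⟨t, ht⟩ := hM.chain hn hnJ hc
  exact ht (hx t)

variable (Φ)

/-- A closed sequence of pieces in use, consecutive ones being distinct and meeting in distinct
points, with at most two colours. -/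
structure Loop (M : Finset (F × (S → ZMod N))) (m : ℕ) (b : ℕ → Piece F S I N)
    (p : ℕ → (Bool × I) × ZMod N) : Prop where
  two_le : 2 ≤ m
  periodic : ∀ i, b (i + m) = b i
  periodic_point : ∀ i, p (i + m) = p i
  inj : ∀ i j, i < j → j < i + m → p i ≠ p j
  used : ∀ i, Φ.Used M (b i)
  on : ∀ i, Φ.On (p i) (b i)
  on_succ : ∀ i, Φ.On (p i) (b (i + 1))
  ne_succ : ∀ i, b i ≠ b (i + 1)
  col : ∀ i, Φ.pieceCol (b (i + 2)) = Φ.pieceCol (b i)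

variable {Φ} {m : ℕ} {b : ℕ → Piece F S I N} {p : ℕ → (Bool × I) × ZMod N}

namespace Loop

lemma shift (hl : Φ.Loop M m b p) : Φ.Loop M m (fun i => b (i + 1)) (fun i => p (i + 1)) where
  two_le := hl.two_le
  periodic := fun i => by
    rw [add_right_comm]
    exact hl.periodic _
  periodic_point := fun i => by
    rw [add_right_comm]
    exact hl.periodic_point _
  inj := fun i j h1 h2 => hl.inj _ _ (by omega) (by omega)
  used := fun i => hl.used _
  on := fun i => hl.on _
  on_succ := fun i => hl.on_succ _
  ne_succ := fun i => hl.ne_succ _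
  col := fun i => hl.col (i + 1)

lemma point_ne (hl : Φ.Loop M m b p) (i : ℕ) : p i ≠ p (i + 1) :=
  hl.inj _ _ (by omega) (by have := hl.two_le; omega)

lemma col_ne (hl : Φ.Loop M m b p) (hM : Φ.Free J M) (i : ℕ) :
    Φ.pieceCol (b i) ≠ Φ.pieceCol (b (i + 1)) := fun h =>
  hl.ne_succ i (hM.eq_of_pieceCol (hl.used i) (hl.used _) h (hl.on i) (hl.on_succ i))

lemma col_even (hl : Φ.Loop M m b p) (i j : ℕ) :
    Φ.pieceCol (b (i + 2 * j)) = Φ.pieceCol (b i) := by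
  induction j with
  | zero => rfl
  | succ j ih =>
    rw [← ih]
    exact hl.col (i + 2 * j)

lemma exists_half (hl : Φ.Loop M m b p) (hM : Φ.Free J M) : ∃ r, 2 ≤ r ∧ m = 2 * r := by
  rcases Nat.even_or_odd' m with ⟨r, hr | hr⟩
  · refine ⟨r, ?_, hr⟩
    by_contra hlt
    have h2 : m = 2 := by
      have := hl.two_le
      omega
    subst h2
    have h0 := hl.periodic 0
    have h1 := hl.on_succ 1
    rw [show 1 + 1 = 0 + 2 from rfl, h0] at h1
    exact hl.ne_succ 0 (hM.eq_of_two_points (hl.used _) (hl.used _) (hl.point_ne 0) (hl.on 0)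
      (hl.on_succ 0) h1 (hl.on 1))
  · exfalso
    refine hl.col_ne hM 0 ?_
    have h1 := hl.col_even 1 r
    have h2 := hl.periodic 0
    rw [zero_add, hr, add_comm] at h2
    rw [zero_add, ← h1, h2]

lemma exists_inl (hl : Φ.Loop M m b p) {w} (h : b 0 = .inl w) (i : ℕ) :
    ∃ x, b (2 * i) = .inl (x, w.2) ∧ Φ.col x.1 = Φ.col w.1.1 := by
  have := hl.col_even 0 i
  rw [zero_add, h] at this
  rcases hb : b (2 * i) with ⟨x, t⟩ | y
  · rw [hb] at this
    simp only [pieceCol, Sum.inl.injEq, Prod.mk.injEq] at this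
    exact ⟨x, by rw [this.2], this.1⟩
  · rw [hb] at this
    simp [pieceCol] at this

lemma exists_inr (hl : Φ.Loop M m b p) {w} (h : b 0 = .inr w) (i : ℕ) :
    ∃ u v, b (2 * i) = .inr (u, v) ∧ u.1 = w.1.1 ∧ v.1 = w.2.1 ∧ v.2 - u.2 = w.2.2 - w.1.2 := by
  have := hl.col_even 0 i
  rw [zero_add, h] at this
  rcases hb : b (2 * i) with x | ⟨u, v⟩
  · rw [hb] at this
    simp [pieceCol] at this
  · rw [hb] at this
    simp only [pieceCol, Sum.inr.injEq, Prod.mk.injEq] at this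
    exact ⟨u, v, rfl, this⟩

lemma false_of_edge_edge_left (hl : Φ.Loop M m b p) (hM : Φ.Free J M) (hmJ : m ≤ J)
    (hU : ∀ j : ℕ, 1 ≤ j → 2 * j ≤ J → IsUnit (j : ZMod N)) {w w'} (h0 : b 0 = .inr w)
    (h1 : b 1 = .inr w') (hp : (p 0).1.1 = false) : False := by
  obtain ⟨r, hr, hm⟩ := hl.exists_half hM
  have hev := hl.exists_inr h0
  have hod := hl.shift.exists_inr h1
  choose u v hb hu hv hd using hev
  choose u' v' hb' hu' hv' hd' using hod
  have hside : ∀ i, (u i).1.1 = false ∧ (v i).1.1 = true := by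
    intro i
    have := hl.used (2 * i)
    rw [hb i] at this
    exact ⟨this.1, this.2.1⟩
  have hside' : ∀ i, (u' i).1.1 = false ∧ (v' i).1.1 = true := by
    intro i
    have := hl.used (2 * i + 1)
    rw [hb' i] at this
    exact ⟨this.1, this.2.1⟩
  have hodd : ∀ i, (p (2 * i)).1.1 = false → p (2 * i) = u' i ∧ p (2 * i + 1) = v' i ∧
      p (2 * i + 1) = v (i + 1) ∧ p (2 * i + 2) = u (i + 1) := by
    intro i hi
    have o1 := hl.on_succ (2 * i)
    have o2 := hl.on (2 * i + 1)
    have o3 := hl.on_succ (2 * i + 1)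
    have o4 := hl.on (2 * i + 2)
    have n1 := hl.point_ne (2 * i)
    have n2 := hl.point_ne (2 * i + 1)
    rw [hb' i] at o1 o2
    rw [show 2 * i + 1 + 1 = 2 * (i + 1) by ring, hb (i + 1)] at o3
    rw [show 2 * i + 2 = 2 * (i + 1) by ring, hb (i + 1)] at o4
    simp only [On] at o1 o2 o3 o4
    have e1 : p (2 * i) = u' i := by
      rcases o1 with h | h
      · exact h
      · rw [h, (hside' i).2] at hi
        exact absurd hi (by decide)
    have e2 : p (2 * i + 1) = v' i := by
      rcases o2 with h | h
      · exact absurd (e1.trans h.symm) n1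
      · exact h
    have e3 : p (2 * i + 1) = v (i + 1) := by
      rcases o3 with h | h
      · have := (hside' i).2
        rw [← e2, h, (hside (i + 1)).1] at this
        exact absurd this (by decide)
      · exact h
    refine ⟨e1, e2, e3, ?_⟩
    rw [show 2 * i + 2 = 2 * (i + 1) by ring]
    rcases o4 with h | h
    · exact h
    · exact absurd (e3.trans h.symm) n2
  have hleft : ∀ i, (p (2 * i)).1.1 = false := by
    intro i
    induction i with
    | zero => exact hp
    | succ i ih =>
      have := (hodd i ih).2.2.2
      rw [show 2 * (i + 1) = 2 * i + 2 by ring, this]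
      exact (hside _).1
  have hoff : ∀ i : ℕ, (p (2 * i)).2 =
      (p 0).2 + i * ((w'.2.2 - w'.1.2) - (w.2.2 - w.1.2)) := by
    intro i
    induction i with
    | zero => simp
    | succ i ih =>
      obtain ⟨a1, a2, a3, a4⟩ := hodd i (hleft i)
      have d1 := hd (i + 1)
      have d2 := hd' i
      rw [← a3, ← a4] at d1
      rw [← a1, ← a2] at d2
      rw [show 2 * (i + 1) = 2 * i + 2 by ring]
      push_cast
      linear_combination d2 - d1 + ih
  have hz : (w'.2.2 - w'.1.2) - (w.2.2 - w.1.2) = 0 := by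
    have := hoff r
    rw [← hm] at this
    have h' := hl.periodic_point 0
    rw [zero_add] at h'
    rw [h'] at this
    refine (hU r (by omega) (by omega)).mul_right_eq_zero.1 ?_
    linear_combination -this
  refine hl.col_ne hM 0 ?_
  rw [h0, h1]
  obtain ⟨a1, a2, a3, -⟩ := hodd 0 (hleft 0)
  have o := hl.on 0
  rw [h0] at o
  simp only [On] at o
  have e0 : p 0 = w.1 := by
    rcases o with h | h
    · exact h
    · have := hl.used 0
      rw [h0] at this
      rw [h, this.2.1] at hp
      exact absurd hp (by decide)
  simp only [pieceCol, Sum.inr.injEq, Prod.mk.injEq]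
  refine ⟨?_, ?_, (sub_eq_zero.1 hz).symm⟩
  · rw [← hu' 0, ← a1, mul_zero, e0]
  · rw [← hv' 0, ← a2, a3, hv]

lemma false_of_edge_edge (hl : Φ.Loop M m b p) (hM : Φ.Free J M) (hmJ : m ≤ J)
    (hU : ∀ j : ℕ, 1 ≤ j → 2 * j ≤ J → IsUnit (j : ZMod N)) {w w'} (h0 : b 0 = .inr w)
    (h1 : b 1 = .inr w') : False := by
  by_cases hp : (p 0).1.1 = false
  · exact hl.false_of_edge_edge_left hM hmJ hU h0 h1 hp
  · obtain ⟨u, v, h2, -⟩ := hl.exists_inr h0 1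
    refine hl.shift.false_of_edge_edge_left hM hmJ hU h1 h2 ?_
    have o1 := hl.on_succ 0
    have o2 := hl.on 1
    have hu := hl.used 1
    rw [zero_add, h1] at o1
    rw [h1] at o2 hu
    simp only [On] at o1 o2
    have n := hl.point_ne 0
    rw [zero_add] at n ⊢
    rcases o1 with h | h
    · rw [h, hu.1] at hp
      exact absurd rfl hp
    · rcases o2 with h' | h'
      · rw [h', hu.1]
      · exact absurd (h.trans h'.symm) n

lemma oriented {w w' a c a' c' : (Bool × I) × ZMod N} {y y' : (Bool × I) × ZMod N}
    (ha : a = w ∨ a = w') (hc : c = w ∨ c = w') (hac : a ≠ c) (ha' : a' = y ∨ a' = y')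
    (hc' : c' = y ∨ c' = y') (hac' : a' ≠ c') (h1 : y.1 = w.1) (h2 : y'.1 = w'.1)
    (h3 : y'.2 - y.2 = w'.2 - w.2) (hne : c.1 ≠ a'.1) :
    a'.1 = a.1 ∧ c'.1 = c.1 ∧ c'.2 - a'.2 = c.2 - a.2 := by
  rcases ha with rfl | rfl <;> rcases hc with rfl | rfl <;> rcases ha' with rfl | rfl <;>
    rcases hc' with rfl | rfl
  all_goals first
    | exact absurd rfl hac
    | exact absurd rfl hac'
    | exact ⟨h1, h2, h3⟩
    | exact ⟨h2, h1, by linear_combination -h3⟩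
    | exact absurd h1.symm hne
    | exact absurd h2.symm hne

lemma false_of_block_edge (hl : Φ.Loop M m b p) (hM : Φ.Free J M) (hmJ : m ≤ J) {w w'}
    (h0 : b 0 = .inl w) (h1 : b 1 = .inr w') : False := by
  obtain ⟨r, hr, hm⟩ := hl.exists_half hM
  have hev := fun i => hl.exists_inl h0 (i + 1)
  have hod := hl.shift.exists_inr h1
  choose y hb hcol using hev
  choose u v hb' hu hv hd using hod
  have hE : ∀ i, ∃ e, Φ.At (y i) w.2 e (p (2 * i + 1)) := by
    intro i
    have := hl.on_succ (2 * i + 1)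
    rw [show 2 * i + 1 + 1 = 2 * (i + 1) by ring, hb i] at this
    exact this
  have hH : ∀ i, ∃ h, Φ.At (y i) w.2 h (p (2 * i + 2)) := by
    intro i
    have := hl.on (2 * i + 2)
    rw [show b (2 * i + 2) = b (2 * (i + 1)) from rfl, hb i] at this
    exact this
  choose E hE using hE
  choose H hH using hH
  have hEH : ∀ i, E i ≠ H i := fun i => (hE i).slot_ne (hH i) (hl.point_ne _)
  have hbase : ∀ i, (p (2 * i + 1)).1 ≠ (p (2 * i + 2)).1 := fun i h =>
    hEH i ((hE i).slot_eq (hH i) h)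
  have hon : ∀ i, (p (2 * i) = u i ∨ p (2 * i) = v i) ∧
      (p (2 * i + 1) = u i ∨ p (2 * i + 1) = v i) := by
    intro i
    have o1 := hl.on_succ (2 * i)
    have o2 := hl.on (2 * i + 1)
    rw [hb' i] at o1 o2
    exact ⟨o1, o2⟩
  have hor : ∀ i, (p (2 * i)).1 = (p 0).1 ∧ (p (2 * i + 1)).1 = (p 1).1 ∧
      (p (2 * i + 1)).2 - (p (2 * i)).2 = (p 1).2 - (p 0).2 := by
    intro i
    induction i with
    | zero => exact ⟨rfl, rfl, rfl⟩
    | succ i ih =>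
      have := oriented (hon i).1 (hon i).2 (hl.point_ne _) (hon (i + 1)).1 (hon (i + 1)).2
        (hl.point_ne _) ((hu _).trans (hu _).symm) ((hv _).trans (hv _).symm)
        ((hd _).trans (hd _).symm) (hbase i)
      exact ⟨this.1.trans ih.1, this.2.1.trans ih.2.1, this.2.2.trans ih.2.2⟩
  have hinj : ∀ i j, i < j → j ≤ r - 1 → y i ≠ y j := by
    intro i j hij hj h
    have hi := hH i
    have hj' := hH j
    rw [← h] at hj'
    have hs := hi.slot_eq hj' ((hor (i + 1)).1.trans (hor (j + 1)).1.symm)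
    rw [← hs] at hj'
    exact hl.inj (2 * i + 2) (2 * j + 2) (by omega) (by omega) (hi.point_eq hj')
  have hyM : ∀ i, y i ∈ M := by
    intro i
    have := hl.used (2 * (i + 1))
    rw [hb i] at this
    exact this
  have hstep : ∀ i, (y (i + 1)).2 (E (i + 1)) - (y i).2 (H i) = (p 1).2 - (p 0).2 := by
    intro i
    have h1 := (hE (i + 1)).2.2
    have h2 := (hH i).2.2
    have h3 := (hor (i + 1)).2.2
    rw [show 2 * (i + 1) = 2 * i + 2 by ring] at h1 h3
    linear_combination h1 - h2 + h3
  have hclose : (y 0).2 (E 0) - (y (r - 1)).2 (H (r - 1)) = (p 1).2 - (p 0).2 := by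
    have h1 := (hE 0).2.2
    have h2 := (hH (r - 1)).2.2
    rw [show 2 * (r - 1) + 2 = 0 + m by omega, hl.periodic_point] at h2
    rw [mul_zero, zero_add] at h1
    linear_combination h1 - h2
  by_cases hr2 : r = 2
  · subst hr2
    refine hinj 0 1 (by omega) (by omega) (hM.key (hyM 0) (hyM 1) (τ := 2) (p := E 0) (q := H 0)
      (p' := E 1) (q' := H 1) ⟨(hE 0).1, (hH 0).1, by simpa using hEH 0⟩
      ⟨(hE 1).1, (hH 1).1, by simpa using hEH 1⟩ ⟨fun _ => (hcol 0).trans (hcol 1).symm, ?_, ?_, ?_⟩)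
    · rw [(hE 0).2.1, (hE 1).2.1, (hor 1).2.1]
    · rw [(hH 0).2.1, (hH 1).2.1]
      exact (hor 1).1.trans (hor 2).1.symm
    · have := hstep 0
      simp only [coef, Matrix.cons_val, Int.cast_one]
      simp only [zero_add, Nat.add_one_sub_one] at this hclose
      linear_combination hclose - this
  · refine hM.no_segment (n := r - 1) (by omega) (by omega) y E H (fun _ => 0)
      ((p 1).2 - (p 0).2) hyM hinj hEH (fun t => (hE t).1) (fun t => (hH t).1) (fun t _ => ?_) ?_
    · rw [hstep]
      simp [mult]
    · rw [hclose]
      simp [mult]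

end Loop

end Frame

end Loops

section BlockLoops

variable {F S Q I : Type} [Fintype F] [DecidableEq F] [Fintype S] [DecidableEq S]
  [Fintype Q] [DecidableEq Q] [Fintype I] [DecidableEq I]

namespace Frame

variable {Φ : Frame F S Q (Bool × I)} {N : ℕ} [NeZero N]
  {J : ℕ} {M : Finset (F × (S → ZMod N))} {m : ℕ} {b : ℕ → Piece F S I N}
  {p : ℕ → (Bool × I) × ZMod N}

namespace Loop

lemma false_of_block_block (hl : Φ.Loop M m b p) (hM : Φ.Free J M) (hmJ : m ≤ J) {w w'}
    (h0 : b 0 = .inl w) (h1 : b 1 = .inl w') : False := by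
  have hall : ∀ i, ∃ y t, b (i + 1) = .inl (y, t) := by
    intro i
    rcases Nat.even_or_odd' i with ⟨j, rfl | rfl⟩
    · obtain ⟨x, hx, -⟩ := hl.shift.exists_inl h1 j
      exact ⟨x, _, hx⟩
    · obtain ⟨x, hx, -⟩ := hl.exists_inl h0 (j + 1)
      exact ⟨x, _, hx⟩
  choose y t hb using hall
  have hct : ∀ i, Φ.col (y (i + 2)).1 = Φ.col (y i).1 ∧ t (i + 2) = t i := by
    intro i
    have := hl.col (i + 1)
    rw [show i + 1 + 2 = i + 2 + 1 by ring, hb, hb] at this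
    simpa [pieceCol] using this
  have hper : ∀ i, y (i + m) = y i ∧ t (i + m) = t i := by
    intro i
    have := hl.periodic (i + 1)
    rw [add_right_comm, hb, hb] at this
    simpa using this
  have hcte : ∀ i j, Φ.col (y (i + 2 * j)).1 = Φ.col (y i).1 ∧ t (i + 2 * j) = t i := by
    intro i j
    induction j with
    | zero => exact ⟨rfl, rfl⟩
    | succ j ih => exact ⟨(hct (i + 2 * j)).1.trans ih.1, (hct (i + 2 * j)).2.trans ih.2⟩
  have hE : ∀ i, ∃ e, Φ.At (y i) (t i) e (p i) := by
    intro i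
    have := hl.on_succ i
    rw [hb i] at this
    exact this
  have hH : ∀ i, ∃ h, Φ.At (y i) (t i) h (p (i + 1)) := by
    intro i
    have := hl.on (i + 1)
    rw [hb i] at this
    exact this
  choose E hE using hE
  choose H hH using hH
  have hEH : ∀ i, E i ≠ H i := fun i => (hE i).slot_ne (hH i) (hl.point_ne _)
  have hyM : ∀ i, y i ∈ M := by
    intro i
    have := hl.used (i + 1)
    rw [hb i] at this
    exact this
  set z := t 0 - t 1 with hz
  set sg : ℕ → Fin 4 := fun i => if Even i then 0 else 1 with hsg
  have htz : ∀ i, t i - t (i + 1) = mult (sg i) * z := by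
    intro i
    rcases Nat.even_or_odd' i with ⟨j, rfl | rfl⟩
    · have h1 := (hcte 0 j).2
      have h2 := (hcte 1 j).2
      rw [zero_add] at h1
      rw [h1, add_comm (2 * j), h2]
      simp [hsg, mult, hz]
    · have h1 := (hcte 1 j).2
      have h2 := (hcte 0 (j + 1)).2
      rw [zero_add] at h2
      rw [add_comm (2 * j), h1, show 1 + 2 * j + 1 = 2 * (j + 1) by ring, h2]
      have : ¬ Even (1 + 2 * j) := by
        rw [Nat.not_even_iff_odd, add_comm]
        exact odd_two_mul_add_one j
      simp [hsg, mult, hz, this]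
  have hstep : ∀ i, (y (i + 1)).2 (E (i + 1)) - (y i).2 (H i) = mult (sg i) * z := by
    intro i
    have h1 := (hE (i + 1)).2.2
    have h2 := (hH i).2.2
    rw [← htz]
    linear_combination h1 - h2
  have hex : ∃ d, 1 ≤ d ∧ ∃ i, y i = y (i + d) :=
    ⟨m, by have := hl.two_le; omega, 0, (hper 0).1.symm⟩
  classical
  obtain ⟨d, ⟨hd1, i, hi⟩, hdmin⟩ : ∃ d, (1 ≤ d ∧ ∃ i, y i = y (i + d)) ∧
      ∀ d' < d, ¬ (1 ≤ d' ∧ ∃ i, y i = y (i + d')) :=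
    ⟨Nat.find hex, Nat.find_spec hex, fun d' hd' => Nat.find_min hex hd'⟩
  have hdm : d ≤ m := by
    by_contra hlt
    exact hdmin m (by omega) ⟨by have := hl.two_le; omega, 0, (hper 0).1.symm⟩
  have hdist : ∀ a c, a < c → c < a + d → y a ≠ y c := by
    intro a c hac hc h
    refine hdmin (c - a) (by omega) ⟨by omega, a, ?_⟩
    rwa [show a + (c - a) = c by omega]
  have hd_ne_one : d ≠ 1 := by
    rintro rfl
    have h2 := hE (i + 1)
    rw [← hi] at h2
    have := (hH i).shift_eq h2
    refine hl.ne_succ (i + 1) ?_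
    rw [hb, hb, ← hi, this]
  have hd_ne_two : d ≠ 2 := by
    rintro rfl
    have h2 : b (i + 2 + 1) = b (i + 1) := by rw [hb, hb, ← hi, (hct i).2]
    have h3 := hl.on_succ (i + 2)
    rw [h2] at h3
    exact hl.ne_succ (i + 1) (hM.eq_of_two_points (hl.used _) (hl.used _) (hl.point_ne (i + 1))
      (hl.on _) (hl.on_succ _) h3 (hl.on _))
  by_cases hslot : E (i + d) = H i
  · have hti : t i ≠ t (i + d) := by
      intro h
      have h1 := hE (i + d)
      rw [hslot, ← hi, ← h] at h1
      exact hl.inj (i + 1) (i + d) (by omega) (by omega) ((hH i).point_eq h1)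
    obtain ⟨r, hr⟩ : ∃ r, d = 2 * r + 1 := by
      rcases Nat.even_or_odd' d with ⟨r, hr | hr⟩
      · rw [hr] at hti
        exact absurd (hcte i r).2.symm hti
      · exact ⟨r, hr⟩
    have hcol : Φ.col (y (i + 1)).1 = Φ.col (y i).1 := by
      rw [hi, hr, ← (hcte (i + 1) r).1, show i + 1 + 2 * r = i + (2 * r + 1) by ring]
    have hsi : sg (i + 2 * r) = sg i := by
      simp only [hsg, Nat.even_add, even_two_mul, iff_true]
    have hcl : (y (i + 1)).2 (E (i + 1)) - (y (i + 2 * r)).2 (H (i + 2 * r)) =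
        2 * (mult (sg i) * z) := by
      have h1 := hstep i
      have h2 := hstep (i + 2 * r)
      rw [hsi, show i + 2 * r + 1 = i + d by omega, hslot, ← hi] at h2
      linear_combination h1 + h2
    by_cases hr1 : r = 1
    · subst hr1 hr
      refine hdist (i + 1) (i + 2) (by omega) (by omega) (hM.key (hyM _) (hyM _) (τ := 3)
        (p := E (i + 1)) (q := H (i + 1)) (p' := H (i + 2)) (q' := E (i + 2))
        ⟨(hE _).1, (hH _).1, by simpa using hEH (i + 1)⟩
        ⟨(hH _).1, (hE _).1, by simpa using (hEH (i + 2)).symm⟩ ⟨fun _ => ?_, ?_, ?_, ?_⟩)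
      · rw [hcol, (hct i).1]
      · have h1 := (hE (i + 3)).2.1
        rw [(hE _).2.1, (hH _).2.1, ← (hH i).2.1, ← hslot]
        rw [← hi] at h1
        exact h1
      · rw [(hH _).2.1, (hE _).2.1]
      · have h1 := hstep (i + 1)
        have hs2 : (mult (sg (i + 1)) : ZMod N) = - mult (sg i) := by
          simp only [hsg, Nat.even_add_one]
          by_cases he : Even i <;> simp [he, mult]
        rw [hs2] at h1
        simp only [coef, Matrix.cons_val, Int.cast_neg, Int.cast_ofNat]
        rw [show i + 1 + 1 = i + 2 from rfl] at h1
        rw [show i + 2 * 1 = i + 2 from rfl] at hcl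
        linear_combination hcl + 2 * h1
    · refine hM.no_segment (n := 2 * r - 1) (by omega) (by omega) (fun a => y (i + 1 + a))
        (fun a => E (i + 1 + a)) (fun a => H (i + 1 + a))
        (fun a => if a = 2 * r - 1 then (if Even i then 2 else 3) else sg (i + 1 + a)) z
        (fun a => hyM _) (fun a c h1 h2 => hdist _ _ (by omega) (by omega)) (fun a => hEH _)
        (fun a => (hE _).1) (fun a => (hH _).1) (fun a ha => ?_) ?_
      · simp only [ha.ne, if_false]
        exact hstep _
      · simp only [if_true, add_zero, show i + 1 + (2 * r - 1) = i + 2 * r by omega]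
        rw [hcl]
        by_cases he : Even i <;> simp [he, hsg, mult]
  · refine hM.no_segment (n := d - 1) (by omega) (by omega) (fun a => y (i + a))
      (fun a => if a = 0 then E (i + d) else E (i + a)) (fun a => H (i + a))
      (fun a => sg (i + a)) z
      (fun a => hyM _) (fun a c h1 h2 => hdist _ _ (by omega) (by omega)) (fun a => ?_)
      (fun a => ?_) (fun a => (hH _).1) (fun a ha => ?_) ?_
    · by_cases ha : a = 0
      · simpa [ha] using hslot
      · simpa [ha] using hEH _
    · by_cases ha : a = 0
      · simp only [ha, if_true, add_zero]
        have := (hE (i + d)).1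
        rwa [← hi] at this
      · simpa [ha] using (hE _).1
    · simp only [Nat.succ_ne_zero, if_false]
      exact hstep _
    · simp only [if_true, add_zero]
      have := hstep (i + (d - 1))
      rwa [show i + (d - 1) + 1 = i + d by omega, ← hi] at this

theorem elim (hl : Φ.Loop M m b p) (hM : Φ.Free J M) (hmJ : m ≤ J)
    (hU : ∀ j : ℕ, 1 ≤ j → 2 * j ≤ J → IsUnit (j : ZMod N)) : False := by
  rcases h0 : b 0 with w | w <;> rcases h1 : b 1 with w' | w'
  · exact hl.false_of_block_block hM hmJ h0 h1
  · exact hl.false_of_block_edge hM hmJ h0 h1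
  · obtain ⟨u, v, h2, -⟩ := hl.exists_inr h0 1
    exact hl.shift.false_of_block_edge hM hmJ h1 h2
  · exact hl.false_of_edge_edge hM hmJ hU h0 h1

end Loop

/-- A closed sequence of pieces in use with at most two colours, meeting in distinct points, is
constant. -/
theorem Free.eq_of_closed (hM : Φ.Free J M)
    (hU : ∀ j : ℕ, 1 ≤ j → 2 * j ≤ J → IsUnit (j : ZMod N))
    (A A' : (Q × ZMod N) ⊕ ((Bool × I) × (Bool × I) × ZMod N)) (m : ℕ) :
    m ≤ J → ∀ (b : ℕ → Piece F S I N) (p : ℕ → (Bool × I) × ZMod N), b m = b 0 →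
    (∀ i, Φ.Used M (b i)) → (∀ i, Φ.pieceCol (b i) = A ∨ Φ.pieceCol (b i) = A') →
    (∀ i < m, Φ.On (p i) (b i) ∧ Φ.On (p i) (b (i + 1))) →
    (∀ i j, i < j → j < m → p i ≠ p j) → ∀ i ≤ m, b i = b 0 := by
  induction m with
  | zero =>
    intro _ b p _ _ _ _ _ i hi
    rw [Nat.le_zero.1 hi]
  | succ m ih =>
    intro hmJ b p hclosed hused hcol hon hinj
    by_cases hex : ∃ i ≤ m, b i = b (i + 1)
    · obtain ⟨i, him, hi⟩ := hex
      have key := ih (by omega) (fun j => if j ≤ i then b j else b (j + 1))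
        (fun j => if j < i then p j else p (j + 1)) ?_ ?_ ?_ ?_ ?_
      · have hle : ∀ j ≤ i, b j = b 0 := by
          intro j hj
          have := key j (by omega)
          simpa [hj] using this
        intro j hj
        rcases le_or_gt j i with h | h
        · exact hle j h
        rcases eq_or_ne j (i + 1) with rfl | hne
        · rw [← hi, hle i le_rfl]
        · have := key (j - 1) (by omega)
          rw [if_neg (by omega), if_pos (Nat.zero_le i), show j - 1 + 1 = j by omega] at this
          exact this
      · rw [if_pos (Nat.zero_le i)]
        split_ifs with h
        · obtain rfl : i = m := by omega
          rw [hi, hclosed]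
        · exact hclosed
      · intro j
        split_ifs <;> exact hused _
      · intro j
        split_ifs <;> exact hcol _
      · intro j hj
        rcases lt_trichotomy j i with h | rfl | h
        · rw [if_pos h, if_pos h.le, if_pos (by omega)]
          exact hon j (by omega)
        · rw [if_neg (lt_irrefl j), if_pos le_rfl, if_neg (by omega), hi]
          exact hon (j + 1) (by omega)
        · rw [if_neg (by omega), if_neg (by omega), if_neg (by omega)]
          exact hon (j + 1) (by omega)
      · intro j j' h1 h2
        split_ifs <;> exact hinj _ _ (by omega) (by omega)
    · exfalso
      push Not at hex
      have hm : m ≠ 0 := by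
        rintro rfl
        exact hex 0 le_rfl (by rw [zero_add] at hclosed ⊢; exact hclosed.symm)
      have hsucc : ∀ i, b ((i + 1) % (m + 1)) = b (i % (m + 1) + 1) := by
        intro i
        have hlt : i % (m + 1) < m + 1 := Nat.mod_lt i (Nat.succ_pos m)
        rw [Nat.add_mod i 1, Nat.mod_eq_of_lt (by omega : 1 < m + 1)]
        rcases eq_or_ne (i % (m + 1)) m with h | h
        · rw [h, Nat.mod_self, hclosed]
        · rw [Nat.mod_eq_of_lt (by omega)]
      have hne : ∀ i, b (i % (m + 1)) ≠ b ((i + 1) % (m + 1)) := by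
        intro i
        rw [hsucc]
        exact hex _ (Nat.lt_succ_iff.1 (Nat.mod_lt i (Nat.succ_pos m)))
      have hon' : ∀ i, Φ.On (p (i % (m + 1))) (b (i % (m + 1))) ∧
          Φ.On (p (i % (m + 1))) (b ((i + 1) % (m + 1))) := by
        intro i
        rw [hsucc]
        exact hon _ (Nat.mod_lt i (Nat.succ_pos m))
      have hcne : ∀ i, Φ.pieceCol (b (i % (m + 1))) ≠ Φ.pieceCol (b ((i + 1) % (m + 1))) :=
        fun i h => hne i (hM.eq_of_pieceCol (hused _) (hused _) h (hon' i).1 (hon' i).2)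
      have hl : Φ.Loop M (m + 1) (fun i => b (i % (m + 1))) (fun i => p (i % (m + 1))) :=
        { two_le := by omega
          periodic := fun i => by simp
          periodic_point := fun i => by simp
          inj := fun i j hij hj => by
            have hmod : i % (m + 1) ≠ j % (m + 1) := by
              intro h
              have : m + 1 ∣ j - i := (Nat.modEq_iff_dvd' hij.le).1 h
              have := Nat.le_of_dvd (by omega) this
              omega
            have h1 := Nat.mod_lt i (Nat.succ_pos m)
            have h2 := Nat.mod_lt j (Nat.succ_pos m)
            rcases lt_or_gt_of_ne hmod with h | h
            · exact hinj _ _ h h2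
            · exact (hinj _ _ h h1).symm
          used := fun i => hused _
          on := fun i => (hon' i).1
          on_succ := fun i => (hon' i).2
          ne_succ := hne
          col := fun i => by
            have h1 := hcne i
            have h2 := hcne (i + 1)
            rcases hcol (i % (m + 1)) with c1 | c1 <;> rcases hcol ((i + 1) % (m + 1)) with c2 | c2 <;>
              rcases hcol ((i + 1 + 1) % (m + 1)) with c3 | c3
            all_goals first
              | exact absurd (c1.trans c2.symm) h1
              | exact absurd (c2.trans c3.symm) h2
              | exact c3.trans c1.symm }
      exact hl.elim hM hmJ hU

end Frame

end BlockLoops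

section EdgeColoring

variable {F S Q I : Type} [Fintype F] [DecidableEq F] [Fintype S] [DecidableEq S]
  [Fintype Q] [DecidableEq Q] [Fintype I] [DecidableEq I]

namespace Frame

variable (Φ : Frame F S Q (Bool × I)) {N : ℕ} [NeZero N]

/-- The copy of `u` on the side `σ` of the complete bipartite graph. -/
def side (σ : Bool) (u : I × ZMod N) : (Bool × I) × ZMod N := ((σ, u.1), u.2)

lemma side_injective (σ : Bool) : Function.Injective (side (N := N) (I := I) σ) := by
  rintro ⟨i, t⟩ ⟨j, t'⟩ h
  simp only [side, Prod.mk.injEq, true_and] at h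
  rw [h.1, h.2]

open scoped Classical in
/-- The piece containing the edge between `u` on the left and `v` on the right. -/
noncomputable def pieceOf (M : Finset (F × (S → ZMod N))) (u v : I × ZMod N) : Piece F S I N :=
  if h : ∃ b : (F × (S → ZMod N)) × ZMod N,
      b.1 ∈ M ∧ Φ.On (side false u) (.inl b) ∧ Φ.On (side true v) (.inl b)
  then .inl h.choose else .inr (side false u, side true v)

/-- The colour of the edge between `u` on the left and `v` on the right. -/
noncomputable def edgeCol (M : Finset (F × (S → ZMod N))) (u v : I × ZMod N) :
    (Q × ZMod N) ⊕ ((Bool × I) × (Bool × I) × ZMod N) :=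
  Φ.pieceCol (Φ.pieceOf M u v)

lemma pieceOf_spec (M : Finset (F × (S → ZMod N))) (u v : I × ZMod N) :
    Φ.Used M (Φ.pieceOf M u v) ∧ Φ.On (side false u) (Φ.pieceOf M u v) ∧
      Φ.On (side true v) (Φ.pieceOf M u v) := by
  unfold pieceOf
  split_ifs with h
  · exact ⟨h.choose_spec.1, h.choose_spec.2.1, h.choose_spec.2.2⟩
  · refine ⟨⟨rfl, rfl, fun x hx t hxt => h ⟨(x, t), hx, hxt⟩⟩, Or.inl rfl, Or.inr rfl⟩

open scoped Classical in
/-- The active slots of `f` on the side `σ`. -/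
noncomputable def slots (f : F) (σ : Bool) : Finset S :=
  univ.filter fun p => Φ.act f p ∧ (Φ.base f p).1 = σ

variable {Φ} {J : ℕ} {M : Finset (F × (S → ZMod N))}

lemma le_card_slots {k : ℕ} {x : F × (S → ZMod N)} {t : ZMod N} {σ : Bool}
    {a : ℕ → I × ZMod N} (ha : ∀ i j, i < k → j < k → a i = a j → i = j)
    (hon : ∀ i < k, Φ.On (side σ (a i)) (.inl (x, t))) : k ≤ (Φ.slots x.1 σ).card := by
  classical
  rcases Nat.eq_zero_or_pos k with rfl | hk
  · exact Nat.zero_le _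
  have : Nonempty S := ⟨(hon 0 hk).choose⟩
  choose! s hs using hon
  rw [← card_range k]
  refine card_le_card_of_injOn s ?_ ?_
  · intro i hi
    have := hs i (by simpa using hi)
    simp only [slots, coe_filter, mem_univ, true_and]
    exact ⟨this.1, by rw [this.2.1]; rfl⟩
  · intro i hi j hj hij
    have hi' : i < k := by simpa using hi
    have hj' : j < k := by simpa using hj
    have h1 := hs i hi'
    have h2 := hs j hj'
    rw [← hij] at h2
    exact ha i j hi' hj' (side_injective σ (h1.point_eq h2))

theorem Free.exists_third_color {k : ℕ} (hk : 3 ≤ k) (hM : Φ.Free (2 * k) M)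
    (hU : ∀ j : ℕ, 1 ≤ j → j ≤ k → IsUnit (j : ZMod N))
    (hsize : ∀ f, ¬ (k ≤ (Φ.slots f false).card ∧ k ≤ (Φ.slots f true).card))
    {a b : ℕ → I × ZMod N} (ha : ∀ i j, i < k → j < k → a i = a j → i = j)
    (hb : ∀ i j, i < k → j < k → b i = b j → i = j)
    (A A' : (Q × ZMod N) ⊕ ((Bool × I) × (Bool × I) × ZMod N)) :
    ¬ ∀ i < k, (Φ.edgeCol M (a i) (b i) = A ∨ Φ.edgeCol M (a i) (b i) = A') ∧
      (Φ.edgeCol M (a ((i + 1) % k)) (b i) = A ∨ Φ.edgeCol M (a ((i + 1) % k)) (b i) = A') := by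
  intro hcol
  have hk0 : 0 < k := by omega
  set β : ℕ → Piece F S I N := fun j =>
    if j % 2 = 0 then Φ.pieceOf M (a (j / 2 % k)) (b (j / 2 % k))
    else Φ.pieceOf M (a ((j / 2 % k + 1) % k)) (b (j / 2 % k)) with hβ
  set P : ℕ → (Bool × I) × ZMod N := fun j =>
    if j % 2 = 0 then side true (b (j / 2 % k)) else side false (a ((j / 2 % k + 1) % k)) with hP
  have heven : ∀ i, β (2 * i) = Φ.pieceOf M (a (i % k)) (b (i % k)) := by
    intro i
    simp [hβ]
  have hodd : ∀ i, β (2 * i + 1) = Φ.pieceOf M (a ((i % k + 1) % k)) (b (i % k)) := by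
    intro i
    have h1 : (2 * i + 1) % 2 = 1 := by omega
    have h2 : (2 * i + 1) / 2 = i := by omega
    simp [hβ, h1, h2]
  have hPeven : ∀ i, P (2 * i) = side true (b (i % k)) := by
    intro i
    simp [hP]
  have hPodd : ∀ i, P (2 * i + 1) = side false (a ((i % k + 1) % k)) := by
    intro i
    have h1 : (2 * i + 1) % 2 = 1 := by omega
    have h2 : (2 * i + 1) / 2 = i := by omega
    simp [hP, h1, h2]
  have hall : ∀ i ≤ 2 * k, β i = β 0 := by
    refine hM.eq_of_closed (fun j h1 h2 => hU j h1 (by omega)) A A' (2 * k) le_rfl β P ?_ ?_ ?_ ?_ ?_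
    · rw [heven, show (0 : ℕ) = 2 * 0 from rfl, heven]
      simp
    · intro j
      rcases Nat.even_or_odd' j with ⟨i, rfl | rfl⟩
      · rw [heven]
        exact (Φ.pieceOf_spec M _ _).1
      · rw [hodd]
        exact (Φ.pieceOf_spec M _ _).1
    · intro j
      rcases Nat.even_or_odd' j with ⟨i, rfl | rfl⟩
      · rw [heven]
        exact (hcol (i % k) (Nat.mod_lt _ hk0)).1
      · rw [hodd]
        exact (hcol (i % k) (Nat.mod_lt _ hk0)).2
    · intro j _
      rcases Nat.even_or_odd' j with ⟨i, rfl | rfl⟩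
      · rw [heven, hodd, hPeven]
        exact ⟨(Φ.pieceOf_spec M _ _).2.2, (Φ.pieceOf_spec M _ _).2.2⟩
      · rw [show 2 * i + 1 + 1 = 2 * (i + 1) by ring, heven, hodd, hPodd]
        refine ⟨(Φ.pieceOf_spec M _ _).2.1, ?_⟩
        rw [Nat.mod_add_mod]
        exact (Φ.pieceOf_spec M _ _).2.1
    · intro j j' hjj hj' h
      rcases Nat.even_or_odd' j with ⟨i, rfl | rfl⟩ <;>
        rcases Nat.even_or_odd' j' with ⟨i', rfl | rfl⟩
      · rw [hPeven, hPeven] at h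
        have := hb _ _ (Nat.mod_lt _ hk0) (Nat.mod_lt _ hk0) (side_injective _ h)
        rw [Nat.mod_eq_of_lt (by omega), Nat.mod_eq_of_lt (by omega)] at this
        omega
      · rw [hPeven, hPodd] at h
        simp [side] at h
      · rw [hPeven, hPodd] at h
        simp [side] at h
      · rw [hPodd, hPodd] at h
        have := ha _ _ (Nat.mod_lt _ hk0) (Nat.mod_lt _ hk0) (side_injective _ h)
        rw [Nat.mod_add_mod, Nat.mod_add_mod] at this
        have := Nat.ModEq.add_right_cancel' 1 this
        rw [Nat.ModEq, Nat.mod_eq_of_lt (by omega), Nat.mod_eq_of_lt (by omega)] at this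
        omega
  have hedge : ∀ i < k, Φ.pieceOf M (a i) (b i) = β 0 := by
    intro i hi
    have := hall (2 * i) (by omega)
    rwa [heven, Nat.mod_eq_of_lt hi] at this
  have hused : Φ.Used M (β 0) := by
    rw [← hedge 0 hk0]
    exact (Φ.pieceOf_spec M _ _).1
  have hA : ∀ i < k, Φ.On (side false (a i)) (β 0) := fun i hi => by
    rw [← hedge i hi]
    exact (Φ.pieceOf_spec M _ _).2.1
  have hB : ∀ i < k, Φ.On (side true (b i)) (β 0) := fun i hi => by
    rw [← hedge i hi]
    exact (Φ.pieceOf_spec M _ _).2.2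
  rcases hβ0 : β 0 with ⟨x, t⟩ | ⟨w, w'⟩
  · rw [hβ0] at hA hB
    exact hsize x.1 ⟨le_card_slots ha hA, le_card_slots hb hB⟩
  · rw [hβ0] at hA hused
    have hw : ∀ i < k, side false (a i) = w := by
      intro i hi
      rcases hA i hi with h | h
      · exact h
      · have := hused.2.1
        simp only at this
        rw [← show side false (a i) = w' from h] at this
        simp [side] at this
    have := ha 0 1 (by omega) (by omega) (side_injective _
      ((hw 0 (by omega)).trans (hw 1 (by omega)).symm))
    omega

open scoped Classical in
theorem Free.card_colors_add (hM : Φ.Free J M) :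
    (univ.image fun p : (I × ZMod N) × (I × ZMod N) => Φ.edgeCol M p.1 p.2).card +
      ∑ x ∈ M, (Φ.slots x.1 false).card * (Φ.slots x.1 true).card ≤
        Fintype.card Q * N + Fintype.card I ^ 2 * N := by
  set T : Finset (I × I × ZMod N) :=
    (M.sigma fun x => Φ.slots x.1 false ×ˢ Φ.slots x.1 true).image fun z =>
      ((Φ.base z.1.1 z.2.1).2, (Φ.base z.1.1 z.2.2).2, z.1.2 z.2.2 - z.1.2 z.2.1) with hT
  have hcard : T.card = ∑ x ∈ M, (Φ.slots x.1 false).card * (Φ.slots x.1 true).card := by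
    rw [hT, card_image_of_injOn, card_sigma]
    · simp [card_product]
    · rintro ⟨x, p, q⟩ hx ⟨y, p', q'⟩ hy h
      simp only [slots, coe_sigma, Set.mem_sigma_iff, mem_coe, mem_product, mem_filter, mem_univ,
        true_and] at hx hy
      obtain ⟨hx, ⟨hp, hp1⟩, hq, hq1⟩ := hx
      obtain ⟨hy, ⟨hp', hp1'⟩, hq', hq1'⟩ := hy
      simp only [Prod.mk.injEq] at h
      have e1 : Φ.base x.1 p = Φ.base y.1 p' := Prod.ext (hp1.trans hp1'.symm) h.1
      have e2 : Φ.base x.1 q = Φ.base y.1 q' := Prod.ext (hq1.trans hq1'.symm) h.2.1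
      have hne : p ≠ q := by
        rintro rfl
        rw [hp1] at hq1
        exact absurd hq1 (by decide)
      have hne' : p' ≠ q' := by
        rintro rfl
        rw [hp1'] at hq1'
        exact absurd hq1' (by decide)
      obtain rfl : x = y := by
        refine hM.key hx hy (τ := 0) (p := p) (q := q) (p' := p') (q' := q')
          ⟨hp, hq, by simpa using hne⟩ ⟨hp', hq', by simpa using hne'⟩
          ⟨fun h => absurd rfl h, e1, e2, ?_⟩
        simp only [coef, Matrix.cons_val_zero, Int.cast_neg, Int.cast_one]
        linear_combination -h.2.2
      obtain rfl := Φ.base_inj _ _ _ hp hp' e1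
      obtain rfl := Φ.base_inj _ _ _ hq hq' e2
      rfl
  have hsub : (univ.image fun p : (I × ZMod N) × (I × ZMod N) => Φ.edgeCol M p.1 p.2) ⊆
      (univ.image fun c : Q × ZMod N => Sum.inl c) ∪
        (univ \ T).image fun z : I × I × ZMod N => Sum.inr ((false, z.1), (true, z.2.1), z.2.2) := by
    intro c hc
    obtain ⟨⟨u, v⟩, -, rfl⟩ := mem_image.1 hc
    rw [mem_union]
    simp only [edgeCol, pieceOf]
    split_ifs with h
    · exact Or.inl (mem_image.2 ⟨_, mem_univ _, rfl⟩)
    · refine Or.inr (mem_image.2 ⟨(u.1, v.1, v.2 - u.2), ?_, rfl⟩)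
      rw [mem_sdiff]
      refine ⟨mem_univ _, fun hmem => h ?_⟩
      obtain ⟨⟨x, p, q⟩, hx, hz⟩ := mem_image.1 hmem
      simp only [slots, mem_sigma, mem_product, mem_filter, mem_univ, true_and] at hx
      obtain ⟨hx, ⟨hp, hp1⟩, hq, hq1⟩ := hx
      simp only [Prod.mk.injEq] at hz
      refine ⟨(x, u.2 - x.2 p), hx, ⟨p, hp, Prod.ext hp1 hz.1, ?_⟩,
        ⟨q, hq, Prod.ext hq1 hz.2.1, ?_⟩⟩
      · simp [side]
      · simp only [side]
        linear_combination hz.2.2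
  have h1 := (card_le_card hsub).trans (card_union_le _ _)
  have h2 : (univ.image fun c : Q × ZMod N =>
      (Sum.inl c : (Q × ZMod N) ⊕ ((Bool × I) × (Bool × I) × ZMod N))).card ≤
        Fintype.card Q * N := by
    refine card_image_le.trans ?_
    simp [ZMod.card]
  have h3 : ((univ \ T).image fun z : I × I × ZMod N =>
      (Sum.inr ((false, z.1), (true, z.2.1), z.2.2) :
        (Q × ZMod N) ⊕ ((Bool × I) × (Bool × I) × ZMod N))).card + T.card ≤
        Fintype.card I ^ 2 * N := by
    refine (Nat.add_le_add_right card_image_le _).trans ?_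
    rw [card_sdiff_add_card_eq_card (subset_univ T)]
    simp [ZMod.card, sq, mul_assoc]
  rw [← hcard]
  omega

end Frame

end EdgeColoring

section AffineFrame

variable {K : Type} [Fintype K] [DecidableEq K] {l : ℕ} [Fact l.Prime]

lemma natCast_injOn_of_le {a : ℕ} (ha : a ≤ l) {i j : Fin a}
    (h : ((i : ℕ) : ZMod l) = ((j : ℕ) : ZMod l)) : i = j := by
  rw [ZMod.natCast_eq_natCast_iff, Nat.ModEq, Nat.mod_eq_of_lt (i.2.trans_le ha),
    Nat.mod_eq_of_lt (j.2.trans_le ha)] at h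
  exact Fin.ext h

/-- On each side `σ` the active slots are `0, …, α φ σ - 1`, placed along an arithmetic
progression of nonzero difference in `ZMod l`. -/
def affineFrame (κ : ℕ) {a : ℕ} (α : K → Bool → ℕ) (ha : a ≤ l) :
    Frame (K × Fin κ × (Bool → ZMod l) × (Bool → (ZMod l)ˣ)) (Bool × Fin a) (Fin κ)
      (Bool × ZMod l) where
  act f p := (p.2 : ℕ) < α f.1 p.1
  base f p := (p.1, f.2.2.1 p.1 + (f.2.2.2 p.1 : ZMod l) * ((p.2 : ℕ) : ZMod l))
  col f := f.2.1
  base_inj := by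
    rintro f ⟨σ, i⟩ ⟨σ', j⟩ - - h
    simp only [Prod.mk.injEq] at h
    obtain ⟨rfl, h⟩ := h
    rw [add_right_inj, Units.mul_right_inj] at h
    rw [natCast_injOn_of_le ha h]

variable {κ a : ℕ} {α : K → Bool → ℕ} (ha : a ≤ l)

lemma card_fin_filter_lt {a b : ℕ} (h : b ≤ a) :
    (univ.filter fun i : Fin a => (i : ℕ) < b).card = b := by
  rw [← Fintype.card_subtype]
  conv_rhs => rw [← Fintype.card_fin b]
  exact Fintype.card_congr
    ⟨fun i => ⟨i.1, i.2⟩, fun i => ⟨⟨i, i.2.trans_le h⟩, i.2⟩, fun _ => rfl, fun _ => rfl⟩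

lemma card_affineFrame_slots (hα : ∀ φ σ, α φ σ ≤ a)
    (f : K × Fin κ × (Bool → ZMod l) × (Bool → (ZMod l)ˣ)) (σ : Bool) :
    ((affineFrame κ α ha).slots f σ).card = α f.1 σ := by
  classical
  have : (affineFrame κ α ha).slots f σ =
      (univ.filter fun i : Fin a => (i : ℕ) < α f.1 σ).image fun i => (σ, i) := by
    ext ⟨σ', i⟩
    simp only [Frame.slots, mem_filter, mem_univ, true_and, mem_image, Prod.mk.injEq]
    constructor
    · rintro ⟨h, rfl⟩
      exact ⟨i, h, rfl, rfl⟩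
    · rintro ⟨j, h, rfl, rfl⟩
      exact ⟨h, rfl⟩
  rw [this, card_image_of_injective _ (Prod.mk_right_injective σ), card_fin_filter_lt (hα _ _)]

lemma eq_of_apply_not {V : Type} {r r' : Bool → V} (σ : Bool) (h : r σ = r' σ)
    (hnot : r (!σ) = r' (!σ)) : r = r' := by
  funext τ
  rcases eq_or_ne τ σ with rfl | hne
  · exact h
  · rw [Bool.eq_not_of_ne hne]
    exact hnot

/-- The pairs of an index in `K` and an active slot on the side `σ`. -/
def slotPairs (a : ℕ) (α : K → Bool → ℕ) (σ : Bool) : Finset (K × Fin a) :=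
  univ.filter fun z => (z.2 : ℕ) < α z.1 σ

lemma card_filter_prod {V W : Type} [Fintype V] [Fintype W] (P : V → W → Prop)
    [∀ v w, Decidable (P v w)] :
    (univ.filter fun z : V × W => P z.1 z.2).card = ∑ v, (univ.filter fun w => P v w).card := by
  simp only [card_filter]
  rw [Fintype.sum_prod_type]

lemma card_slotPairs (hα : ∀ φ σ, α φ σ ≤ a) (σ : Bool) :
    (slotPairs a α σ).card = ∑ φ, α φ σ := by
  rw [slotPairs, card_filter_prod (fun (φ : K) (i : Fin a) => (i : ℕ) < α φ σ)]
  exact sum_congr rfl fun φ _ => card_fin_filter_lt (hα φ σ)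

lemma card_units_fun : Fintype.card (Bool → (ZMod l)ˣ) = (l - 1) ^ 2 := by
  rw [Fintype.card_fun, ZMod.card_units, Fintype.card_bool]

open scoped Classical in
lemma affineFrame_incidence (hα : ∀ φ σ, α φ σ ≤ a) (hsum : ∀ σ, ∑ φ, α φ σ ≤ κ)
    (c : Fin κ) (β : Bool × ZMod l) :
    (univ.filter fun t : (K × Fin κ × (Bool → ZMod l) × (Bool → (ZMod l)ˣ)) × (Bool × Fin a) =>
      (affineFrame κ α ha).act t.1 t.2 ∧ (affineFrame κ α ha).col t.1 = c ∧
        (affineFrame κ α ha).base t.1 t.2 = β).card ≤ κ * l * (l - 1) ^ 2 := by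
  obtain ⟨σ, b⟩ := β
  calc _ ≤ (slotPairs a α σ ×ˢ (univ : Finset (ZMod l)) ×ˢ
          (univ : Finset (Bool → (ZMod l)ˣ))).card := by
        refine card_le_card_of_injOn
          (fun t => ((t.1.1, t.2.2), t.1.2.2.1 (!σ), t.1.2.2.2)) ?_ ?_
        · rintro ⟨⟨φ, c', r, m⟩, σ', i⟩ h
          simp only [affineFrame, coe_filter, mem_univ, true_and, Set.mem_ofPred_eq,
            Prod.mk.injEq] at h
          obtain ⟨h1, -, rfl, -⟩ := h
          simpa [slotPairs] using h1
        · rintro ⟨⟨φ, c', r, m⟩, σ', i⟩ h ⟨⟨φ', d', r', m'⟩, τ', j⟩ h' e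
          simp only [affineFrame, coe_filter, mem_univ, true_and, Set.mem_ofPred_eq,
            Prod.mk.injEq] at h h' e
          obtain ⟨-, rfl, rfl, hr⟩ := h
          obtain ⟨-, rfl, rfl, hr'⟩ := h'
          obtain ⟨⟨rfl, rfl⟩, e1, rfl⟩ := e
          obtain rfl : r = r' := eq_of_apply_not _ (add_right_cancel (hr.trans hr'.symm)) e1
          rfl
    _ = (∑ φ, α φ σ) * (l * (l - 1) ^ 2) := by
        rw [card_product, card_product, card_slotPairs hα, card_univ, card_univ, ZMod.card,
          card_units_fun]
    _ ≤ κ * (l * (l - 1) ^ 2) := Nat.mul_le_mul_right _ (hsum σ)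
    _ = _ := by ring

open scoped Classical in
lemma affineFrame_difference (hα : ∀ φ σ, α φ σ ≤ a)
    (hsame : ∀ σ, ∑ φ, α φ σ * (α φ σ - 1) ≤ l - 1)
    (hcross : ∑ φ, α φ false * α φ true ≤ l) (β β' : Bool × ZMod l) :
    (univ.filter fun t : (K × Fin κ × (Bool → ZMod l) × (Bool → (ZMod l)ˣ)) ×
        (Bool × Fin a) × (Bool × Fin a) =>
      t.2.1 ≠ t.2.2 ∧ (affineFrame κ α ha).act t.1 t.2.1 ∧ (affineFrame κ α ha).act t.1 t.2.2 ∧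
        (affineFrame κ α ha).base t.1 t.2.1 = β ∧
          (affineFrame κ α ha).base t.1 t.2.2 = β').card ≤ κ * l * (l - 1) ^ 2 := by
  obtain ⟨σ, b⟩ := β
  obtain ⟨σ', b'⟩ := β'
  rcases eq_or_ne σ σ' with rfl | hσ
  · have hoff : ∀ φ, (univ.filter fun w : Fin a × Fin a =>
        w.1 ≠ w.2 ∧ (w.1 : ℕ) < α φ σ ∧ (w.2 : ℕ) < α φ σ).card = α φ σ * (α φ σ - 1) := by
      intro φ
      have : (univ.filter fun w : Fin a × Fin a =>
          w.1 ≠ w.2 ∧ (w.1 : ℕ) < α φ σ ∧ (w.2 : ℕ) < α φ σ) =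
          (univ.filter fun i : Fin a => (i : ℕ) < α φ σ).offDiag := by
        ext w
        simp only [mem_filter, mem_univ, true_and, mem_offDiag]
        exact ⟨fun h => ⟨h.2.1, h.2.2, h.1⟩, fun h => ⟨h.2.2, h.1, h.2.1⟩⟩
      rw [this, offDiag_card, card_fin_filter_lt (hα φ σ), Nat.mul_sub, mul_one]
    calc _ ≤ ((univ.filter fun z : K × Fin a × Fin a =>
            z.2.1 ≠ z.2.2 ∧ (z.2.1 : ℕ) < α z.1 σ ∧ (z.2.2 : ℕ) < α z.1 σ) ×ˢ
            (univ : Finset (Fin κ)) ×ˢ (univ : Finset (ZMod l)) ×ˢ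
            (univ : Finset (ZMod l)ˣ)).card := by
          refine card_le_card_of_injOn (fun t => ((t.1.1, t.2.1.2, t.2.2.2), t.1.2.1,
            t.1.2.2.1 (!σ), t.1.2.2.2 (!σ))) ?_ ?_
          · rintro ⟨⟨φ, c', r, m⟩, ⟨τ, i⟩, ⟨τ', j⟩⟩ h
            simp only [affineFrame, coe_filter, mem_univ, true_and, Set.mem_ofPred_eq,
              Prod.mk.injEq] at h
            obtain ⟨h1, h2, h3, ⟨rfl, -⟩, rfl, -⟩ := h
            have hij : i ≠ j := by
              rintro rfl
              exact h1 rfl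
            simp [hij, h2, h3]
          · rintro ⟨⟨φ, c', r, m⟩, ⟨τ, i⟩, ⟨τ', j⟩⟩ h ⟨⟨φ', c'', r', m'⟩, ⟨τ₁, i'⟩, ⟨τ₁', j'⟩⟩ h' e
            simp only [affineFrame, coe_filter, mem_univ, true_and, Set.mem_ofPred_eq,
              Prod.mk.injEq] at h h' e
            obtain ⟨h1, -, -, ⟨rfl, hb⟩, rfl, hb'⟩ := h
            obtain ⟨-, -, -, ⟨rfl, hc⟩, rfl, hc'⟩ := h'
            obtain ⟨⟨rfl, rfl, rfl⟩, rfl, er, em⟩ := e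
            have hij : ((i : ℕ) : ZMod l) - ((j : ℕ) : ZMod l) ≠ 0 := by
              intro h
              exact h1 (by rw [natCast_injOn_of_le ha (sub_eq_zero.1 h)])
            have hm : m τ₁' = m' τ₁' := by
              refine Units.ext (mul_right_cancel₀ hij ?_)
              linear_combination hb - hb' - hc + hc'
            have hr : r τ₁' = r' τ₁' := by
              rw [hm] at hb
              exact add_right_cancel (hb.trans hc.symm)
            obtain rfl := eq_of_apply_not _ hm em
            obtain rfl := eq_of_apply_not _ hr er
            rfl
      _ = (∑ φ, α φ σ * (α φ σ - 1)) * (κ * (l * (l - 1))) := by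
          rw [card_product, card_product, card_product,
            card_filter_prod (fun (φ : K) (w : Fin a × Fin a) =>
              w.1 ≠ w.2 ∧ (w.1 : ℕ) < α φ σ ∧ (w.2 : ℕ) < α φ σ), sum_congr rfl fun φ _ => hoff φ]
          simp only [card_univ, Fintype.card_fin, ZMod.card, ZMod.card_units]
      _ ≤ (l - 1) * (κ * (l * (l - 1))) := Nat.mul_le_mul_right _ (hsame σ)
      _ = _ := by ring
  · have hpair : ∀ φ, (univ.filter fun w : Fin a × Fin a =>
        (w.1 : ℕ) < α φ σ ∧ (w.2 : ℕ) < α φ σ').card = α φ false * α φ true := by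
      intro φ
      have : (univ.filter fun w : Fin a × Fin a => (w.1 : ℕ) < α φ σ ∧ (w.2 : ℕ) < α φ σ') =
          (univ.filter fun i : Fin a => (i : ℕ) < α φ σ) ×ˢ
            (univ.filter fun i : Fin a => (i : ℕ) < α φ σ') := by
        ext w
        simp
      rw [this, card_product, card_fin_filter_lt (hα φ _), card_fin_filter_lt (hα φ _)]
      cases σ <;> cases σ' <;> first | rfl | exact mul_comm _ _ | exact absurd rfl hσ
    calc _ ≤ ((univ.filter fun z : K × Fin a × Fin a =>
            (z.2.1 : ℕ) < α z.1 σ ∧ (z.2.2 : ℕ) < α z.1 σ') ×ˢ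
            (univ : Finset (Fin κ)) ×ˢ (univ : Finset (Bool → (ZMod l)ˣ))).card := by
          refine card_le_card_of_injOn (fun t => ((t.1.1, t.2.1.2, t.2.2.2), t.1.2.1,
            t.1.2.2.2)) ?_ ?_
          · rintro ⟨⟨φ, c', r, m⟩, ⟨τ, i⟩, ⟨τ', j⟩⟩ h
            simp only [affineFrame, coe_filter, mem_univ, true_and, Set.mem_ofPred_eq,
              Prod.mk.injEq] at h
            obtain ⟨h1, h2, h3, ⟨rfl, -⟩, rfl, -⟩ := h
            simp [h2, h3]
          · rintro ⟨⟨φ, c', r, m⟩, ⟨τ, i⟩, ⟨τ', j⟩⟩ h ⟨⟨φ', c'', r', m'⟩, ⟨τ₁, i'⟩, ⟨τ₁', j'⟩⟩ h' e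
            simp only [affineFrame, coe_filter, mem_univ, true_and, Set.mem_ofPred_eq,
              Prod.mk.injEq] at h h' e
            obtain ⟨-, -, -, ⟨rfl, hb⟩, rfl, hb'⟩ := h
            obtain ⟨-, -, -, ⟨rfl, hc⟩, rfl, hc'⟩ := h'
            obtain ⟨⟨rfl, rfl, rfl⟩, rfl, rfl⟩ := e
            have h1 : r τ₁ = r' τ₁ := add_right_cancel (hb.trans hc.symm)
            have h2 : r τ₁' = r' τ₁' := add_right_cancel (hb'.trans hc'.symm)
            rw [Bool.eq_not_of_ne hσ.symm] at h2
            obtain rfl := eq_of_apply_not _ h1 h2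
            rfl
      _ = (∑ φ, α φ false * α φ true) * (κ * (l - 1) ^ 2) := by
          rw [card_product, card_product,
            card_filter_prod (fun (φ : K) (w : Fin a × Fin a) =>
              (w.1 : ℕ) < α φ σ ∧ (w.2 : ℕ) < α φ σ'), sum_congr rfl fun φ _ => hpair φ]
          simp only [card_univ, Fintype.card_fin, card_units_fun]
      _ ≤ l * (κ * (l - 1) ^ 2) := Nat.mul_le_mul_right _ hcross
      _ = _ := by ring

end AffineFrame

section AffineColoring

variable {K : Type} [Fintype K] [DecidableEq K] {l : ℕ} [Fact l.Prime]

lemma sum_affine_weight {κ a N : ℕ} [NeZero N] {α : K → Bool → ℕ}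
    (hcross : ∑ φ, α φ false * α φ true = l) :
    ∑ x : (K × Fin κ × (Bool → ZMod l) × (Bool → (ZMod l)ˣ)) × (Bool × Fin a → ZMod N),
      ((α x.1.1 false * α x.1.1 true : ℕ) : ℝ) =
        l * (κ * (l ^ 2 * ((l - 1 : ℕ) : ℝ) ^ 2)) * (N : ℝ) ^ (2 * a) := by
  rw [Fintype.sum_prod_type]
  simp only [sum_const, card_univ, nsmul_eq_mul]
  rw [← mul_sum, Fintype.sum_prod_type]
  simp only [sum_const, card_univ, nsmul_eq_mul]
  rw [← mul_sum, ← Nat.cast_sum, hcross]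
  simp only [Fintype.card_prod, Fintype.card_fin, Fintype.card_fun, ZMod.card, ZMod.card_units,
    Fintype.card_bool]
  push_cast
  ring

set_option synthInstance.maxSize 1000 in
theorem exists_affine_coloring {κ a k : ℕ} {α : K → Bool → ℕ} (ha : a ≤ l) (ha0 : 1 ≤ a)
    (hκ : 1 ≤ κ) (hk : 3 ≤ k) (hα1 : ∀ φ σ, 1 ≤ α φ σ) (hα : ∀ φ σ, α φ σ ≤ a)
    (hsum : ∀ σ, ∑ φ, α φ σ ≤ κ) (hsame : ∀ σ, ∑ φ, α φ σ * (α φ σ - 1) ≤ l - 1)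
    (hcross : ∑ φ, α φ false * α φ true = l)
    (hsize : ∀ φ, ¬ (k ≤ α φ false ∧ k ≤ α φ true)) {ε : ℝ} (hε : 0 < ε) (hε1 : ε < 1) :
    ∃ N₀ : ℕ, ∀ (N : ℕ) [NeZero N], N₀ ≤ N → SmallUnits N →
      (∀ j : ℕ, 1 ≤ j → j ≤ k → IsUnit (j : ZMod N)) →
      ∃ c : ZMod l × ZMod N → ZMod l × ZMod N → ℕ,
        ((univ.image fun p : (ZMod l × ZMod N) × (ZMod l × ZMod N) => c p.1 p.2).card : ℝ) ≤
          (κ + 3 * ε * l ^ 2) * N ∧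
        ∀ u v : ℕ → ZMod l × ZMod N, (∀ i j, i < k → j < k → u i = u j → i = j) →
          (∀ i j, i < k → j < k → v i = v j → i = j) → ∀ A A' : ℕ,
            ¬ ∀ i < k, (c (u i) (v i) = A ∨ c (u i) (v i) = A') ∧
              (c (u ((i + 1) % k)) (v i) = A ∨ c (u ((i + 1) % k)) (v i) = A') := by
  have hl : 2 ≤ l := (Fact.out : l.Prime).two_le
  have hD : 1 ≤ κ * l * (l - 1) ^ 2 :=
    Nat.mul_pos (Nat.mul_pos hκ (by omega)) (pow_pos (by omega) _)
  have hS : 2 ≤ Fintype.card (Bool × Fin a) := by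
    simp only [Fintype.card_prod, Fintype.card_bool, Fintype.card_fin]
    omega
  obtain ⟨C, hC, hsys⟩ := (affineFrame κ α ha).exists_conflictSystem hS (J := 2 * k) (by omega) hD
    (affineFrame_incidence ha hα hsum) (affineFrame_difference ha hα hsame hcross.le)
  obtain ⟨δ₀, hδ₀, hlink⟩ := exists_linkFree
    (Fintype.card (Fin 4 × (Bool × Fin a) × (Bool × Fin a))) (2 * k) hε hε1 hC
    (W := (a : ℝ) * a) (by
      have : (1 : ℝ) ≤ a := by exact_mod_cast ha0
      nlinarith)
  obtain ⟨N₀, hN₀⟩ := exists_nat_gt (1 / δ₀)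
  refine ⟨N₀, fun N _ hN hsmall hunits => ?_⟩
  have hNpos : (0 : ℝ) < N := by exact_mod_cast Nat.pos_of_ne_zero (NeZero.ne N)
  have hδ : 1 / (N : ℝ) ≤ δ₀ := by
    rw [div_le_iff₀ hNpos]
    have h1 : (N₀ : ℝ) ≤ N := by exact_mod_cast hN
    rw [div_lt_iff₀ hδ₀] at hN₀
    nlinarith
  obtain ⟨M, hM, hweight⟩ := hlink (hsys N hsmall) rfl hδ
    (fun x => ((α x.1.1 false * α x.1.1 true : ℕ) : ℝ))
    (fun x => by
      have := Nat.mul_pos (hα1 x.1.1 false) (hα1 x.1.1 true)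
      exact_mod_cast this)
    (fun x => by
      have := Nat.mul_le_mul (hα x.1.1 false) (hα x.1.1 true)
      exact_mod_cast this)
  have hfree := (affineFrame κ α ha).free_of_links hM
  have hcount := hfree.card_colors_add
  simp only [card_affineFrame_slots ha hα, Fintype.card_fin, ZMod.card] at hcount
  set e := Fintype.equivFin ((Fin κ × ZMod N) ⊕ ((Bool × ZMod l) × (Bool × ZMod l) × ZMod N))
  refine ⟨fun u v => (e ((affineFrame κ α ha).edgeCol M u v) : ℕ), ?_, ?_⟩
  · have hle : (univ.image fun p : (ZMod l × ZMod N) × (ZMod l × ZMod N) =>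
        (e ((affineFrame κ α ha).edgeCol M p.1 p.2) : ℕ)).card ≤
        (univ.image fun p : (ZMod l × ZMod N) × (ZMod l × ZMod N) =>
          (affineFrame κ α ha).edgeCol M p.1 p.2).card := by
      have : (univ.image fun p : (ZMod l × ZMod N) × (ZMod l × ZMod N) =>
          (e ((affineFrame κ α ha).edgeCol M p.1 p.2) : ℕ)) =
          (univ.image fun p : (ZMod l × ZMod N) × (ZMod l × ZMod N) =>
            (affineFrame κ α ha).edgeCol M p.1 p.2).image fun z => (e z : ℕ) := by
        rw [image_image]
        rfl
      rw [this]
      exact card_image_le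
    have hratio : (1 - 3 * ε) * (l ^ 2 * N) ≤
        ∑ x ∈ M, ((α x.1.1 false * α x.1.1 true : ℕ) : ℝ) := by
      refine le_trans (le_of_eq ?_) hweight
      rw [sum_affine_weight hcross]
      have hpow : (N : ℝ) ^ (2 * a) = (N : ℝ) ^ (Fintype.card (Bool × Fin a) - 1) * N := by
        rw [← pow_succ]
        congr 1
        simp only [Fintype.card_prod, Fintype.card_bool, Fintype.card_fin]
        omega
      have hDr : (0 : ℝ) < ((κ * l * (l - 1) ^ 2 : ℕ) : ℝ) := by exact_mod_cast hD
      rw [hpow, eq_div_iff (by positivity)]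
      push_cast
      ring
    have hcount' : ((univ.image fun p : (ZMod l × ZMod N) × (ZMod l × ZMod N) =>
        (affineFrame κ α ha).edgeCol M p.1 p.2).card : ℝ) +
        ∑ x ∈ M, ((α x.1.1 false * α x.1.1 true : ℕ) : ℝ) ≤ κ * N + (l : ℝ) ^ 2 * N := by
      exact_mod_cast hcount
    have hle' : ((univ.image fun p : (ZMod l × ZMod N) × (ZMod l × ZMod N) =>
        (e ((affineFrame κ α ha).edgeCol M p.1 p.2) : ℕ)).card : ℝ) ≤
        ((univ.image fun p : (ZMod l × ZMod N) × (ZMod l × ZMod N) =>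
          (affineFrame κ α ha).edgeCol M p.1 p.2).card : ℝ) := by
      exact_mod_cast hle
    nlinarith
  · intro u v hu hv A A' hAA
    have hinj : ∀ {z z' : (Fin κ × ZMod N) ⊕ ((Bool × ZMod l) × (Bool × ZMod l) × ZMod N)},
        (e z : ℕ) = e z' → z = z' := fun h => e.injective (Fin.ext h)
    have key : ∀ B : ℕ, ∃ z, ∀ z', (e z' : ℕ) = B → z' = z := by
      intro B
      by_cases h : ∃ z, (e z : ℕ) = B
      · obtain ⟨z, rfl⟩ := h
        exact ⟨z, fun z' hz' => hinj hz'⟩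
      · exact ⟨(affineFrame κ α ha).edgeCol M (u 0) (v 0), fun z' hz' => absurd ⟨z', hz'⟩ h⟩
    obtain ⟨z, hz⟩ := key A
    obtain ⟨z', hz'⟩ := key A'
    refine hfree.exists_third_color hk hunits ?_ hu hv z z' fun i hi =>
      ⟨(hAA i hi).1.imp (hz _) (hz' _), (hAA i hi).2.imp (hz _) (hz' _)⟩
    intro f
    rw [card_affineFrame_slots ha hα, card_affineFrame_slots ha hα]
    exact hsize f.1

end AffineColoring

/-- Blocks of three kinds: `a` points on the left and `s` on the right, the other way around,
or a single edge. -/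
def blockSize (a s μ : ℕ) : Fin μ ⊕ Fin μ ⊕ Unit → Bool → ℕ
  | .inl _, σ => if σ then s else a
  | .inr (.inl _), σ => if σ then a else s
  | .inr (.inr _), _ => 1

theorem exists_coloring_of_prime {k a s μ l : ℕ} [Fact l.Prime] (hk : 3 ≤ k) (hs : s + 1 = k)
    (hsa : s ≤ a) (hquad : a * (a - 1) + s * (s - 1) ≤ 2 * a * s) (hl : l = 2 * μ * a * s + 1)
    (hal : a ≤ l) {ε : ℝ} (hε : 0 < ε) (hε1 : ε < 1) :
    ∃ N₀ : ℕ, ∀ (N : ℕ) [NeZero N], N₀ ≤ N → SmallUnits N →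
      (∀ j : ℕ, 1 ≤ j → j ≤ k → IsUnit (j : ZMod N)) →
      ∃ c : ZMod l × ZMod N → ZMod l × ZMod N → ℕ,
        ((univ.image fun p : (ZMod l × ZMod N) × (ZMod l × ZMod N) => c p.1 p.2).card : ℝ) ≤
          ((μ * (a + s) + 1 : ℕ) + 3 * ε * l ^ 2) * N ∧
        ∀ u v : ℕ → ZMod l × ZMod N, (∀ i j, i < k → j < k → u i = u j → i = j) →
          (∀ i j, i < k → j < k → v i = v j → i = j) → ∀ A A' : ℕ,
            ¬ ∀ i < k, (c (u i) (v i) = A ∨ c (u i) (v i) = A') ∧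
              (c (u ((i + 1) % k)) (v i) = A ∨ c (u ((i + 1) % k)) (v i) = A') := by
  refine exists_affine_coloring (κ := μ * (a + s) + 1) (α := blockSize a s μ) hal (by omega)
    (Nat.succ_pos _) hk ?_ ?_ ?_ ?_ ?_ ?_ hε hε1
  · rintro (φ | φ | φ) (_ | _) <;> simp [blockSize] <;> omega
  · rintro (φ | φ | φ) (_ | _) <;> simp [blockSize] <;> omega
  · rintro (_ | _) <;> simp [blockSize, Fintype.sum_sum_type] <;> ring_nf <;> rfl
  · have h := Nat.mul_le_mul_left μ hquad
    rintro (_ | _) <;> simp [blockSize, Fintype.sum_sum_type] <;> rw [hl, Nat.add_sub_cancel] <;>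
      nlinarith
  · simp [blockSize, Fintype.sum_sum_type]
    rw [hl]
    ring
  · rintro (φ | φ | φ) <;> simp [blockSize] <;> omega

lemma quadratic_of_floor {k a s : ℕ} (hk : 3 ≤ k) (hs : s + 1 = k)
    (ha : a = ⌊((2 * (k : ℝ) - 1) + Real.sqrt (8 * (k : ℝ) - 7)) / 2⌋₊) :
    s ≤ a ∧ a * (a - 1) + s * (s - 1) ≤ 2 * a * s := by
  have hkr : (k : ℝ) = s + 1 := by rw [← hs]; push_cast; ring
  set r := Real.sqrt (8 * (k : ℝ) - 7)
  have hr0 : 0 ≤ r := Real.sqrt_nonneg _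
  have hrr : r * r = 8 * (k : ℝ) - 7 := Real.mul_self_sqrt (by
    rw [hkr]
    have : (0 : ℝ) ≤ s := Nat.cast_nonneg s
    linarith)
  have hs0 : (0 : ℝ) ≤ s := Nat.cast_nonneg s
  have hsa : s ≤ a := by
    rw [ha]
    refine Nat.le_floor ?_
    rw [hkr]
    linarith
  have hax : (a : ℝ) ≤ ((2 * (k : ℝ) - 1) + r) / 2 := by
    rw [ha]
    exact Nat.floor_le (by rw [hkr]; linarith)
  refine ⟨hsa, ?_⟩
  obtain ⟨d, rfl⟩ := Nat.exists_eq_add_of_le hsa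
  have hd : d * d ≤ d + 2 * s := by
    rcases Nat.eq_zero_or_pos d with rfl | hd
    · simp
    have hd1 : (1 : ℝ) ≤ d := by exact_mod_cast hd
    push_cast at hax
    rw [hkr] at hax hrr
    have h1 : 2 * (d : ℝ) - 1 ≤ r := by linarith
    have h2 : (2 * (d : ℝ) - 1) * (2 * d - 1) ≤ r * r :=
      mul_le_mul h1 h1 (by linarith) hr0
    have h3 : (d : ℝ) * d ≤ d + 2 * s := by nlinarith
    exact_mod_cast h3
  obtain ⟨s, rfl⟩ : ∃ t, s = t + 1 := ⟨s - 1, by omega⟩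
  rw [show s + 1 + d - 1 = s + d by omega, Nat.add_sub_cancel]
  nlinarith

lemma exists_pair_of_card_lt_three {V : Type} [Inhabited V] [DecidableEq V] {T : Finset V}
    (h : T.card < 3) : ∃ A A', ∀ x ∈ T, x = A ∨ x = A' := by
  have h' : T.card = 0 ∨ T.card = 1 ∨ T.card = 2 := by omega
  rcases h' with h' | h' | h'
  · rw [card_eq_zero.1 h']
    exact ⟨default, default, by simp⟩
  · obtain ⟨A, rfl⟩ := card_eq_one.1 h'
    exact ⟨A, A, by simp⟩
  · obtain ⟨A, A', -, rfl⟩ := card_eq_two.1 h'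
    exact ⟨A, A', by simp⟩

lemma coprime_of_dvd_of_eq_mul_add_one {j P t : ℕ} (h : j ∣ P) : j.Coprime (P * t + 1) := by
  obtain ⟨m, rfl⟩ := h
  rw [mul_assoc]
  simp

end RamseyCycle

/-- For fixed `k ≥ 3`, with `a = ⌊(2k−1+√(8k−7))/2⌋`, for every `ε > 0`
there is `N` such that for all `n ≥ N` there is an edge-coloring of `K_{n,n}` using at
most `(1/(2(k-1)) + 1/(2a) + ε)·n` colors in which every cycle on `2k` vertices receives
at least 3 colors. -/
theorem generalized_ramsey_bipartite_cycle_upper (k : ℕ) (hk : 3 ≤ k)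
    (a : ℕ) (ha : a = ⌊((2 * (k : ℝ) - 1) + Real.sqrt (8 * (k : ℝ) - 7)) / 2⌋₊)
    (ε : ℝ) (hε : 0 < ε) :
    ∃ N : ℕ, ∀ n : ℕ, N ≤ n →
      ∃ c : Fin n → Fin n → ℕ,
        (usedColorsBip n c : ℝ) ≤ (1 / (2 * ((k : ℝ) - 1)) + 1 / (2 * (a : ℝ)) + ε) * n ∧
        ∀ p q : ℕ → Fin n, InjOnFirst n k p → InjOnFirst n k q →
          3 ≤ bipCycleColorCount n k c p q := by
  obtain ⟨s, hs⟩ : ∃ s, s + 1 = k := ⟨k - 1, by omega⟩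
  obtain ⟨hsa, hquad⟩ := RamseyCycle.quadratic_of_floor hk hs ha
  clear ha
  have hs2 : 2 ≤ s := by omega
  have hs0 : (0 : ℝ) < s := by exact_mod_cast (by omega : 0 < s)
  have ha0 : (0 : ℝ) < a := by exact_mod_cast (by omega : 0 < a)
  have hks : (k : ℝ) - 1 = s := by rw [← hs]; push_cast; ring
  rw [hks]
  set ρ : ℝ := 1 / (2 * (s : ℝ)) + 1 / (2 * (a : ℝ)) with hρ
  have hρ0 : 0 < ρ := by positivity
  have hρas : ρ * (2 * a * s) = a + s := by
    rw [hρ]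
    field_simp
  obtain ⟨m, hm⟩ := exists_nat_gt (4 / ε)
  obtain ⟨l, hlp, hlm, hlmod⟩ := Nat.exists_prime_gt_modEq_one (k := 2 * a * s) (m + a)
    (Nat.mul_ne_zero (by omega) (by omega))
  obtain ⟨μ, hμ⟩ := (Nat.modEq_iff_dvd' hlp.one_le).1 hlmod.symm
  have hl : l = 2 * μ * a * s + 1 := by
    have := hlp.one_le
    rw [show 2 * μ * a * s = 2 * a * s * μ by ring, ← hμ]
    omega
  have : Fact l.Prime := ⟨hlp⟩
  have hl0 : (0 : ℝ) < l := by exact_mod_cast hlp.pos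
  have hlε : 1 ≤ ε / 4 * l := by
    have h1 : (m : ℝ) ≤ l := by exact_mod_cast (by omega : m ≤ l)
    rw [div_lt_iff₀ hε] at hm
    nlinarith
  obtain ⟨N₀, hN₀⟩ := RamseyCycle.exists_coloring_of_prime (ε := min (1 / 2) (ε / (12 * l))) hk hs hsa hquad hl
    (by omega) (by positivity) (lt_of_le_of_lt (min_le_left _ _) (by norm_num))
  set P : ℕ := 6 * k.factorial with hP
  have hP0 : 0 < P := by positivity
  have hlP : 0 < l * P := Nat.mul_pos hlp.pos hP0
  obtain ⟨n₀, hn₀⟩ := exists_nat_gt ((ρ + ε / 2) * (l * P + l) / (ε / 2))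
  refine ⟨max n₀ (N₀ * (l * P)), fun n hn => ?_⟩
  set N : ℕ := P * (n / (l * P) + 1) + 1 with hN
  have : NeZero N := ⟨Nat.succ_ne_zero _⟩
  have hnN : n ≤ l * N := by
    have := Nat.lt_mul_div_succ n hlP
    rw [hN]
    nlinarith
  have hNn : l * N ≤ n + (l * P + l) := by
    have := Nat.mul_div_le n (l * P)
    rw [hN]
    nlinarith
  have hN₀N : N₀ ≤ N := by
    have h1 : N₀ ≤ n / (l * P) := (Nat.le_div_iff_mul_le hlP).2 ((le_max_right _ _).trans hn)
    rw [hN]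
    nlinarith
  have hunit : ∀ j : ℕ, j ∣ P → IsUnit (j : ZMod N) := fun j hj =>
    (ZMod.isUnit_iff_coprime j N).2 (RamseyCycle.coprime_of_dvd_of_eq_mul_add_one hj)
  obtain ⟨c, hcard, hcycle⟩ := hN₀ N hN₀N
    ⟨by exact_mod_cast hunit 2 (Dvd.dvd.mul_right (by norm_num) _),
      by exact_mod_cast hunit 3 (Dvd.dvd.mul_right (by norm_num) _)⟩
    (fun j h1 h2 => hunit j (Dvd.dvd.mul_left (Nat.dvd_factorial h1 h2) _))
  obtain ⟨e⟩ : Nonempty (Fin n ↪ ZMod l × ZMod N) :=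
    Function.Embedding.nonempty_of_card_le (by simpa [ZMod.card] using hnN)
  refine ⟨fun i j => c (e i) (e j), ?_, ?_⟩
  · have hsub : usedColorsBip n (fun i j => c (e i) (e j)) ≤
        (univ.image fun p : (ZMod l × ZMod N) × (ZMod l × ZMod N) => c p.1 p.2).card := by
      refine card_le_card fun x hx => ?_
      obtain ⟨p, -, rfl⟩ := mem_image.1 hx
      exact mem_image.2 ⟨(e p.1, e p.2), mem_univ _, rfl⟩
    have hκ : ((μ * (a + s) + 1 : ℕ) : ℝ) ≤ (ρ + ε / 4) * l := by
      have : (l : ℝ) = 2 * μ * a * s + 1 := by exact_mod_cast hl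
      push_cast
      nlinarith
    have hε' : 3 * min (1 / 2) (ε / (12 * (l : ℝ))) * (l : ℝ) ^ 2 ≤ ε / 4 * l := by
      have h1 := min_le_right (1 / 2) (ε / (12 * (l : ℝ)))
      calc _ ≤ 3 * (ε / (12 * (l : ℝ))) * (l : ℝ) ^ 2 := by gcongr
        _ = ε / 4 * l := by
          field_simp
          ring
    have hn₁ : (n₀ : ℝ) ≤ n := by exact_mod_cast (le_max_left _ _).trans hn
    have hNn' : (l : ℝ) * N ≤ n + (l * P + l) := by exact_mod_cast hNn
    have hNnn : (0 : ℝ) ≤ N := Nat.cast_nonneg N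
    rw [div_lt_iff₀ (by positivity)] at hn₀
    calc (usedColorsBip n (fun i j => c (e i) (e j)) : ℝ) ≤ _ := by exact_mod_cast hsub
      _ ≤ _ := hcard
      _ ≤ ((ρ + ε / 4) * l + ε / 4 * l) * N := by gcongr
      _ = (ρ + ε / 2) * (l * N) := by ring
      _ ≤ (ρ + ε / 2) * (n + (l * P + l)) := by gcongr
      _ ≤ (ρ + ε) * n := by nlinarith
  · intro p q hp hq
    by_contra! hlt
    obtain ⟨A, A', hAA⟩ := RamseyCycle.exists_pair_of_card_lt_three hlt
    refine hcycle (fun i => e (p i)) (fun i => e (q i))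
      (fun i j hi hj h => hp i j hi hj (e.injective h))
      (fun i j hi hj h => hq i j hi hj (e.injective h)) A A' fun i hi => ⟨hAA _ ?_, hAA _ ?_⟩
    · exact mem_union_left _ (mem_image.2 ⟨i, mem_range.2 hi, rfl⟩)
    · exact mem_union_right _ (mem_image.2 ⟨i, mem_range.2 hi, rfl⟩)
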